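/- arXiv:2312.02766 — 18 statements merged into one kernel-verified Lean document; each statement's English description precedes it below -/
import Mathlib

section
/- Let n ≥ 1 and let V be a completely monotone function on the Boolean lattice of subsets of {1,…,n}. Then for every real α such that α is a positive integer or α ≥ n − 1, the pointwise power V^α is completely monotone. -/
/-- A function `f` on a lattice `L` is completely monotone if it is nonnegative and all its
successive discrete derivatives `Δ_{x_k} … Δ_{x_1} f (x) =
Σ_{J ⊆ [k]} (−1)^{|J|} f(x ∨ ⋁_{i∈J} x_i)` are nonnegative. -/
def IsCM {L : Type*} [Lattice L] (f : L → ℝ) : Prop :=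
  (∀ x, 0 ≤ f x) ∧
  ∀ (k : ℕ) (x : L) (y : Fin (k + 1) → L),
    0 ≤ ∑ J : Finset (Fin (k + 1)),
      (-1 : ℝ) ^ J.card * f (J.fold (· ⊔ ·) x y)

/-- Complete monotonicity with respect to the successive insertion of the elements of a list. -/
def CMl {ι : Type} [DecidableEq ι] : List ι → (Finset ι → ℝ) → Prop
  | [], f => ∀ A, 0 ≤ f A
  | a :: l, f => CMl l (fun A => f (insert a A)) ∧ CMl l (fun A => f A - f (insert a A))

section
variable {ι : Type} [DecidableEq ι]

theorem CMl.add {l : List ι} : ∀ {f g : Finset ι → ℝ}, CMl l f → CMl l g →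
    CMl l (fun A => f A + g A) := by
  induction l with
  | nil => intro f g hf hg A; exact add_nonneg (hf A) (hg A)
  | cons a l ih =>
    intro f g hf hg
    refine ⟨ih hf.1 hg.1, ?_⟩
    have := ih hf.2 hg.2
    convert this using 2
    ring

theorem CMl.const (l : List ι) : ∀ {c : ℝ}, 0 ≤ c → CMl l (fun _ => c) := by
  induction l with
  | nil => intro c hc A; exact hc
  | cons a l ih =>
    intro c hc
    refine ⟨ih hc, ?_⟩
    have := ih (le_refl 0)
    simpa using this

theorem CMl.tail {a : ι} {l : List ι} {f : Finset ι → ℝ} (h : CMl (a :: l) f) : CMl l f := by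
  have := h.1.add h.2
  simpa using this

theorem CMl.nonneg {l : List ι} : ∀ {f : Finset ι → ℝ}, CMl l f → ∀ A, 0 ≤ f A := by
  induction l with
  | nil => intro f h; exact h
  | cons a l ih => intro f h; exact ih h.tail

theorem CMl.mul {l : List ι} : ∀ {f g : Finset ι → ℝ}, CMl l f → CMl l g →
    CMl l (fun A => f A * g A) := by
  induction l with
  | nil => intro f g hf hg A; exact mul_nonneg (hf A) (hg A)
  | cons a l ih =>
    intro f g hf hg
    refine ⟨ih hf.1 hg.1, ?_⟩
    have := (ih hf.2 hg.tail).add (ih hf.1 hg.2)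
    convert this using 2
    ring

theorem CMl.npow {l : List ι} {f : Finset ι → ℝ} (h : CMl l f) (j : ℕ) :
    CMl l (fun A => f A ^ j) := by
  induction j with
  | zero => simpa using CMl.const l zero_le_one
  | succ j ih => simpa [pow_succ] using ih.mul h

theorem CMl.of_deriv {l : List ι} : ∀ {F F' : ℝ → Finset ι → ℝ},
    (∀ t A, HasDerivAt (fun s => F s A) (F' t A) t) →
    (∀ t, 0 < t → t < 1 → CMl l (F' t)) → CMl l (fun A => F 1 A - F 0 A) := by
  induction l with
  | nil =>
    intro F F' hd h A
    have hm : MonotoneOn (fun s => F s A) (Set.Icc 0 1) := by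
      apply monotoneOn_of_deriv_nonneg (convex_Icc 0 1)
      · exact fun t _ => (hd t A).continuousAt.continuousWithinAt
      · exact fun t _ => (hd t A).differentiableAt.differentiableWithinAt
      · intro t ht
        rw [interior_Icc] at ht
        rw [(hd t A).deriv]
        exact h t ht.1 ht.2 A
    have := hm (by simp) (by simp) zero_le_one
    simpa using this
  | cons a l ih =>
    intro F F' hd h
    refine ⟨ih (F := fun t A => F t (insert a A)) (F' := fun t A => F' t (insert a A))
      (fun t A => hd t _) (fun t h0 h1 => (h t h0 h1).1), ?_⟩
    have := ih (F := fun t A => F t A - F t (insert a A))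
      (F' := fun t A => F' t A - F' t (insert a A))
      (fun t A => (hd t _).sub (hd t _)) (fun t h0 h1 => (h t h0 h1).2)
    convert this using 2
    ring

theorem CMl.rpow {l : List ι} : ∀ {f : Finset ι → ℝ} {α : ℝ}, CMl l f →
    (l.length : ℝ) - 1 ≤ α → CMl l (fun A => f A ^ α) := by
  induction l with
  | nil => intro f α h _ A; exact Real.rpow_nonneg (h A) α
  | cons a l ih =>
    intro f α h hα
    simp only [List.length_cons, Nat.cast_add, Nat.cast_one, add_sub_cancel_right] at hα
    refine ⟨ih h.1 (by linarith), ?_⟩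
    rcases Nat.eq_zero_or_pos l.length with hl | hl
    · rw [List.length_eq_zero_iff] at hl
      subst hl
      intro A
      have h1 := h.1 A
      have h2 := h.2 A
      have := Real.rpow_le_rpow h1 (sub_nonneg.mp h2) (by simpa using hα)
      linarith
    · have hl' : (1 : ℝ) ≤ l.length := by exact_mod_cast hl
      have key := CMl.of_deriv (l := l)
        (F := fun t A => (f (insert a A) + t * (f A - f (insert a A))) ^ α)
        (F' := fun t A => (f A - f (insert a A)) * α *
          (f (insert a A) + t * (f A - f (insert a A))) ^ (α - 1)) ?_ ?_
      · convert key using 2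
        simp
      · intro t A
        have h0 : HasDerivAt (fun s : ℝ => f (insert a A) + s * (f A - f (insert a A)))
            (f A - f (insert a A)) t := by
          simpa using ((hasDerivAt_id t).mul_const (f A - f (insert a A))).const_add
            (f (insert a A))
        exact h0.rpow_const (Or.inr (by linarith))
      · intro t ht _
        have hc : CMl l (fun A => f (insert a A) + t * (f A - f (insert a A))) :=
          h.1.add ((CMl.const l ht.le).mul h.2)
        exact (h.2.mul (CMl.const l (by linarith))).mul (ih hc (by linarith))

theorem CMl.ins {l : List ι} {a : ι} (ha : a ∈ l) : ∀ {f : Finset ι → ℝ}, CMl l f →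
    CMl l (fun A => f (insert a A)) ∧ CMl l (fun A => f A - f (insert a A)) := by
  induction l with
  | nil => simp at ha
  | cons b l ih =>
    intro f h
    by_cases hab : a = b
    · subst hab
      have h0 : CMl l (fun _ : Finset ι => (0 : ℝ)) := CMl.const l le_rfl
      refine ⟨⟨?_, ?_⟩, ⟨?_, ?_⟩⟩
      · simpa using h.1
      · simpa using h0
      · simpa using h0
      · simpa using h.2
    · have ha' : a ∈ l := by simpa [hab] using ha
      have h1 := ih ha' h.1
      have h2 := ih ha' h.2
      refine ⟨⟨?_, ?_⟩, ⟨?_, ?_⟩⟩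
      · simpa only [Finset.insert_comm a b] using h1.1
      · simpa only [Finset.insert_comm a b] using h2.1
      · simpa only [Finset.insert_comm a b] using h1.2
      · have := h2.2
        convert this using 2
        simp only [Finset.insert_comm a b]
        ring

theorem CMl.union {l : List ι} (hl : ∀ a, a ∈ l) (B : Finset ι) : ∀ {f : Finset ι → ℝ},
    CMl l f → CMl l (fun A => f (A ⊔ B)) ∧ CMl l (fun A => f A - f (A ⊔ B)) := by
  induction B using Finset.induction_on with
  | empty =>
    intro f h
    have h0 : CMl l (fun _ : Finset ι => (0 : ℝ)) := CMl.const l le_rfl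
    exact ⟨by simpa using h, by simpa using h0⟩
  | insert a B _ ih =>
    intro f h
    have h1 := CMl.ins (hl a) h
    have h2 := ih h1.1
    have e : ∀ A : Finset ι, A ⊔ insert a B = insert a (A ⊔ B) := fun A => by
      simp [Finset.sup_eq_union]
    simp only [e]
    refine ⟨h2.1, ?_⟩
    have := h1.2.add h2.2
    convert this using 2
    ring

end

section
variable {L : Type*} [Lattice L]

theorem fold_sup_sup {κ : Type*} (J : Finset κ) (x z : L) (y : κ → L) :
    J.fold (fun a b : L => a ⊔ b) (x ⊔ z) y = J.fold (fun a b : L => a ⊔ b) x y ⊔ z := by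
  classical
  induction J using Finset.induction_on with
  | empty => simp
  | insert a s ha ih => rw [Finset.fold_insert ha, Finset.fold_insert ha, ih, sup_assoc]

/-- The iterated difference. -/
def DS (f : L → ℝ) (k : ℕ) (x : L) (y : Fin k → L) : ℝ :=
  ∑ J : Finset (Fin k), (-1 : ℝ) ^ J.card * f (J.fold (· ⊔ ·) x y)

theorem DS_zero (f : L → ℝ) (x : L) (y : Fin 0 → L) : DS f 0 x y = f x := by
  unfold DS
  rw [Fintype.sum_eq_single ∅]
  · simp
  · intro J hJ
    exact absurd (Finset.eq_empty_of_isEmpty J) hJ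

theorem DS_succ (f : L → ℝ) (k : ℕ) (x : L) (y : Fin (k + 1) → L) :
    DS f (k + 1) x y =
      DS (fun z => f z - f (z ⊔ y 0)) k x (fun i => y i.succ) := by
  unfold DS
  have h0 : (0 : Fin (k + 1)) ∉ (Finset.univ : Finset (Fin k)).map (Fin.succEmb k) := by
    simp
  have hu : (Finset.univ : Finset (Finset (Fin (k + 1)))) =
      (insert 0 ((Finset.univ : Finset (Fin k)).map (Fin.succEmb k))).powerset := by
    rw [← Finset.powerset_univ, Fin.univ_succ]
    congr 1
    ext i
    simp
  have hp : ((Finset.univ : Finset (Fin k)).map (Fin.succEmb k)).powerset =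
      (Finset.univ : Finset (Finset (Fin k))).map
        (Finset.mapEmbedding (Fin.succEmb k)).toEmbedding := by
    ext J
    simp only [Finset.mem_powerset, Finset.subset_map_iff, Finset.mem_map, Finset.mem_univ,
      true_and]
    constructor
    · rintro ⟨u, _, rfl⟩
      exact ⟨u, rfl⟩
    · rintro ⟨u, rfl⟩
      exact ⟨u, Finset.subset_univ _, rfl⟩
  rw [hu, Finset.sum_powerset_insert h0, hp, Finset.sum_map, Finset.sum_map,
    ← Finset.sum_add_distrib]
  refine Finset.sum_congr rfl fun J _ => ?_
  have hJ : (0 : Fin (k + 1)) ∉ J.map (Fin.succEmb k) := by simp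
  change (-1 : ℝ) ^ (J.map (Fin.succEmb k)).card *
      f ((J.map (Fin.succEmb k)).fold (· ⊔ ·) x y) +
    (-1 : ℝ) ^ (insert 0 (J.map (Fin.succEmb k))).card *
      f ((insert 0 (J.map (Fin.succEmb k))).fold (· ⊔ ·) x y) = _
  rw [Finset.card_insert_of_notMem hJ, Finset.fold_insert hJ, Finset.card_map, Finset.fold_map,
    sup_comm (y 0)]
  change (-1 : ℝ) ^ J.card * f (J.fold (· ⊔ ·) x (fun i => y i.succ)) +
    (-1 : ℝ) ^ (J.card + 1) * f (J.fold (· ⊔ ·) x (fun i => y i.succ) ⊔ y 0) = _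
  ring

theorem IsCM.ds {f : L → ℝ} (h : IsCM f) (k : ℕ) (x : L) (y : Fin k → L) : 0 ≤ DS f k x y := by
  cases k with
  | zero => rw [DS_zero]; exact h.1 x
  | succ k => exact h.2 k x y

theorem IsCM.of_ds {f : L → ℝ} (h : ∀ k x y, 0 ≤ DS f k x y) : IsCM f := by
  refine ⟨fun x => ?_, fun k x y => h (k + 1) x y⟩
  have := h 0 x Fin.elim0
  rwa [DS_zero] at this

theorem IsCM.diff {f : L → ℝ} (h : IsCM f) (z : L) : IsCM (fun x => f x - f (x ⊔ z)) := by
  apply IsCM.of_ds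
  intro k x y
  have := h.ds (k + 1) x (Fin.cons z y)
  rw [DS_succ] at this
  simpa using this

theorem IsCM.shift {f : L → ℝ} (h : IsCM f) (z : L) : IsCM (fun x => f (x ⊔ z)) := by
  apply IsCM.of_ds
  intro k x y
  have := h.ds k (x ⊔ z) y
  unfold DS at this ⊢
  simpa only [fold_sup_sup] using this

end

theorem IsCM.cml {ι : Type} [DecidableEq ι] (l : List ι) : ∀ {f : Finset ι → ℝ}, IsCM f →
    CMl l f := by
  induction l with
  | nil => intro f h; exact h.1
  | cons a l ih =>
    intro f h
    have e : ∀ A : Finset ι, insert a A = A ⊔ {a} := fun A => by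
      rw [Finset.sup_eq_union, Finset.union_comm, Finset.insert_eq]
    have h1 := ih (h.shift {a})
    have h2 := ih (h.diff {a})
    simp only [← e] at h1 h2
    exact ⟨h1, h2⟩

theorem CMl.isCM {ι : Type} [DecidableEq ι] {l : List ι} (hl : ∀ a, a ∈ l)
    {f : Finset ι → ℝ} (h : CMl l f) : IsCM f := by
  apply IsCM.of_ds
  intro k
  induction k generalizing f with
  | zero => intro x y; rw [DS_zero]; exact h.nonneg x
  | succ k ih =>
    intro x y
    rw [DS_succ]
    exact ih (CMl.union hl (y 0) h).2 x _

/-- If `V` is completely monotone on the Boolean lattice of subsets of `{1,…,n}`, then for every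
`α` that is a positive integer or satisfies `α ≥ n − 1`, the pointwise power `V^α` is
completely monotone. -/
theorem stmt0 (n : ℕ) (hn : 1 ≤ n) (V : Finset (Fin n) → ℝ) (hV : IsCM V)
    (α : ℝ) (hα : (∃ j : ℕ, 0 < j ∧ α = j) ∨ (n : ℝ) - 1 ≤ α) :
    IsCM (fun A => V A ^ α) := by
  have hc : CMl (List.finRange n) V := hV.cml _
  apply CMl.isCM (l := List.finRange n) (fun a => List.mem_finRange a)
  rcases hα with ⟨j, _, rfl⟩ | hα
  · simpa only [Real.rpow_natCast] using hc.npow j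
  · exact hc.rpow (by simpa using hα)
end

section
/- Let n ≥ 2 and define V on the Boolean lattice of subsets of {1,…,n} by V(A) := 1 − |A|/n (the void functional of a uniformly random singleton subset of {1,…,n}). Then for every non-integer real α with 0 < α < n − 1, the pointwise power V^α is not completely monotone. -/
/-- Derivative of iterated forward differences of a real power. -/
lemma hasDerivAt_fwdDiff_iter_rpow (α : ℝ) (k : ℕ) : ∀ t : ℝ, 0 < t →
    HasDerivAt ((fwdDiff (1:ℝ))^[k] (fun t : ℝ => t ^ α))
      (α * (fwdDiff (1:ℝ))^[k] (fun t : ℝ => t ^ (α - 1)) t) t := by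
  induction k with
  | zero =>
    intro t ht
    simpa using Real.hasDerivAt_rpow_const (p := α) (Or.inl ht.ne')
  | succ k ih =>
    intro t ht
    rw [Function.iterate_succ_apply', Function.iterate_succ_apply']
    have h1 := (ih (t + 1) (by linarith)).comp_add_const t 1
    have h2 := h1.sub (ih t ht)
    simp only [fwdDiff, mul_sub]
    exact h2

lemma continuous_fwdDiff_iter_rpow (α : ℝ) (hα : 0 < α) (k : ℕ) :
    Continuous ((fwdDiff (1:ℝ))^[k] (fun t : ℝ => t ^ α)) := by
  induction k with
  | zero => simpa using Real.continuous_rpow_const hα.le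
  | succ k ih =>
    rw [Function.iterate_succ_apply']
    unfold fwdDiff
    exact (ih.comp (continuous_add_const 1)).sub ih

lemma fwdDiff_iter_rpow_neg (β : ℝ) (h0 : -1 < β) (h1 : β < 0) (j : ℕ) :
    (∀ t : ℝ, 0 < t → (fwdDiff (1:ℝ))^[j+1] (fun t : ℝ => t ^ (β + j)) t < 0) ∧
    (1 ≤ j → (fwdDiff (1:ℝ))^[j+1] (fun t : ℝ => t ^ (β + j)) 0 < 0) := by
  induction j with
  | zero =>
    refine ⟨fun t ht => ?_, by simp⟩
    simp only [zero_add, Function.iterate_one, fwdDiff, Nat.cast_zero, add_zero]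
    exact sub_neg.2 (Real.rpow_lt_rpow_of_neg ht (by linarith) h1)
  | succ j ih =>
    have hα : 0 < β + ((j + 1 : ℕ) : ℝ) := by
      push_cast
      have : (0:ℝ) ≤ j := Nat.cast_nonneg j
      linarith
    have hanti : StrictAntiOn ((fwdDiff (1:ℝ))^[j+1] (fun t : ℝ => t ^ (β + ((j + 1 : ℕ) : ℝ))))
        (Set.Ici 0) := by
      apply strictAntiOn_of_deriv_neg (convex_Ici 0)
      · exact (continuous_fwdDiff_iter_rpow _ hα _).continuousOn
      · intro t ht
        rw [interior_Ici] at ht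
        rw [(hasDerivAt_fwdDiff_iter_rpow _ (j+1) t ht).deriv]
        have := ih.1 t ht
        have e : β + ((j + 1 : ℕ) : ℝ) - 1 = β + j := by push_cast; ring
        rw [e]
        exact mul_neg_of_pos_of_neg hα this
    have key : ∀ t : ℝ, 0 ≤ t →
        (fwdDiff (1:ℝ))^[j+1+1] (fun t : ℝ => t ^ (β + ((j + 1 : ℕ) : ℝ))) t < 0 := by
      intro t ht
      rw [Function.iterate_succ_apply']
      exact sub_neg.2 (hanti ht (show (0:ℝ) ≤ t + 1 by linarith) (by linarith))
    exact ⟨fun t ht => key t ht.le, fun _ => key 0 le_rfl⟩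

lemma fold_sup_singletons {k n : ℕ} (e : Fin k ↪ Fin n) (x : Finset (Fin n)) (J : Finset (Fin k)) :
    J.fold (· ⊔ ·) x (fun i => {e i}) = J.map e ∪ x := by
  induction J using Finset.induction_on with
  | empty => simp
  | insert a s ha ih =>
    rw [Finset.fold_insert ha, ih, Finset.map_insert]
    ext; simp

/-- For the void functional `V A = 1 − |A|/n` of a uniformly random singleton subset of
`{1,…,n}` (with `n ≥ 2`), the pointwise power `V^α` is not completely monotone for any
non-integer `α` with `0 < α < n − 1`. -/
theorem stmt1 (n : ℕ) (hn : 2 ≤ n)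
    (α : ℝ) (hαint : ∀ j : ℤ, α ≠ j) (hα0 : 0 < α) (hα1 : α < (n : ℝ) - 1) :
    ¬ IsCM (fun A : Finset (Fin n) => (1 - (A.card : ℝ) / n) ^ α) := by
  rintro ⟨-, h⟩
  obtain ⟨p, hp⟩ : ∃ p : ℕ, p = ⌊α⌋₊ := ⟨_, rfl⟩
  have hp1 : (p : ℝ) < α := by
    rw [hp]
    exact lt_of_le_of_ne (Nat.floor_le hα0.le) (fun e => hαint (⌊α⌋₊ : ℤ) (by simpa using e.symm))
  have hp2 : α < p + 1 := by rw [hp]; exact Nat.lt_floor_add_one α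
  have hpn : p + 1 + 1 ≤ n := by
    have : (p : ℝ) + 1 < n := by linarith
    exact_mod_cast this
  have hneg := (fwdDiff_iter_rpow_neg (α - p - 1) (by linarith) (by linarith) (p + 1)).2 (by omega)
  have e1 : α - p - 1 + ((p + 1 : ℕ) : ℝ) = α := by push_cast; ring
  rw [e1, fwdDiff_iter_eq_sum_shift] at hneg
  have hn0 : (0 : ℝ) < n := by exact_mod_cast (by omega : 0 < n)
  let e : Fin (p + 1 + 1) ↪ Fin n := Fin.castLEEmb hpn
  have hs := h (p + 1) (Finset.univ.map e)ᶜ (fun i => {e i})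
  have hcard : ∀ J : Finset (Fin (p + 1 + 1)),
      (((J.fold (· ⊔ ·) (Finset.univ.map e)ᶜ (fun i => {e i}) : Finset (Fin n))).card : ℝ)
        = J.card + (n - (p + 1 + 1 : ℕ)) := by
    intro J
    rw [fold_sup_singletons, Finset.card_union_of_disjoint, Finset.card_map, Finset.card_compl,
      Finset.card_map, Finset.card_univ, Fintype.card_fin, Fintype.card_fin]
    · push_cast [Nat.cast_sub hpn]; ring
    · rw [disjoint_compl_right_iff]
      exact Finset.map_subset_map.2 (Finset.subset_univ _)
  simp only [hcard] at hs
  rw [← Finset.powerset_univ, Finset.sum_powerset_apply_card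
    (fun m : ℕ => (-1 : ℝ) ^ m * (1 - ((m : ℝ) + (n - (p + 1 + 1 : ℕ))) / n) ^ α),
    Finset.card_univ, Fintype.card_fin] at hs
  rw [← Finset.sum_range_reflect] at hneg
  have : ∑ m ∈ Finset.range (p + 1 + 1 + 1), (p + 1 + 1).choose m •
      ((-1 : ℝ) ^ m * (1 - ((m : ℝ) + (n - (p + 1 + 1 : ℕ))) / n) ^ α) < 0 := by
    refine lt_of_eq_of_lt ?_ (div_neg_of_neg_of_pos hneg (Real.rpow_pos_of_pos hn0 α))
    rw [Finset.sum_div]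
    refine Finset.sum_congr rfl fun m hm => ?_
    have hm' : m ≤ p + 1 + 1 := by
      have := Finset.mem_range.1 hm
      omega
    have a1 : p + 1 + 1 + 1 - 1 - m = p + 1 + 1 - m := by omega
    rw [a1, Nat.sub_sub_self hm', Nat.choose_symm hm']
    have a2 : 1 - ((m : ℝ) + (n - (p + 1 + 1 : ℕ))) / n = ((p + 1 + 1 - m : ℕ) : ℝ) / n := by
      rw [Nat.cast_sub hm']
      field_simp
      ring
    rw [a2, Real.div_rpow (Nat.cast_nonneg _) hn0.le]
    simp only [zsmul_eq_mul, nsmul_eq_mul, zero_add, mul_one]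
    push_cast
    ring
  linarith
end

section
/- Let L be a finite distributive lattice and let d_max denote the maximum, over x ∈ L, of the number of elements covering x. Then there exists a completely monotone function f on L such that for every non-integer real α with 0 < α < d_max − 1, the pointwise power f^α is not completely monotone. -/
section helpers
open Finset

lemma fold_sup_le {L ι : Type*} [Lattice L] (J : Finset ι) (x z : L) (y : ι → L) :
    (J.fold (α := ι) (β := L) (· ⊔ ·) x y) ≤ z ↔ x ≤ z ∧ ∀ i ∈ J, y i ≤ z := by
  classical
  induction J using Finset.induction_on with
  | empty => simp
  | insert a s ha ih =>
    rw [Finset.fold_insert ha, sup_le_iff, ih]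
    simp only [Finset.mem_insert, forall_eq_or_imp]
    tauto

lemma fold_mult {L ι : Type*} [Lattice L] (g : L → ℝ) (hg : ∀ x y, g (x ⊔ y) = g x * g y)
    (J : Finset ι) (x : L) (y : ι → L) :
    g (J.fold (· ⊔ ·) x y) = g x * ∏ i ∈ J, g (y i) := by
  classical
  induction J using Finset.induction_on with
  | empty => simp
  | insert a s ha ih =>
    rw [Finset.fold_insert ha, hg, ih, Finset.prod_insert ha]
    ring

lemma isCM_mult {L : Type*} [Lattice L] (g : L → ℝ) (hg : ∀ x y, g (x ⊔ y) = g x * g y)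
    (h0 : ∀ x, 0 ≤ g x) (h1 : ∀ x, g x ≤ 1) : IsCM g := by
  refine ⟨h0, fun k x y => ?_⟩
  have key : ∑ J : Finset (Fin (k + 1)), (-1 : ℝ) ^ J.card * g (J.fold (· ⊔ ·) x y)
      = g x * ∏ i, (1 - g (y i)) := by
    have : ∏ i, (1 - g (y i)) = ∏ i, (-g (y i) + 1) :=
      Finset.prod_congr rfl fun i _ => by ring
    rw [this, Finset.prod_add, Finset.mul_sum, Finset.powerset_univ]
    refine Finset.sum_congr rfl fun J _ => ?_
    rw [fold_mult g hg, Finset.prod_neg]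
    simp
    ring
  rw [key]
  exact mul_nonneg (h0 x) (Finset.prod_nonneg fun i _ => sub_nonneg.2 (h1 _))

lemma isCM_add {L : Type*} [Lattice L] {f g : L → ℝ} (hf : IsCM f) (hg : IsCM g) :
    IsCM (fun x => f x + g x) := by
  refine ⟨fun x => add_nonneg (hf.1 x) (hg.1 x), fun k x y => ?_⟩
  simp only [mul_add, Finset.sum_add_distrib]
  exact add_nonneg (hf.2 k x y) (hg.2 k x y)

lemma isCM_sum {L ι : Type*} [Lattice L] (s : Finset ι) (f : ι → L → ℝ)
    (hf : ∀ i, IsCM (f i)) : IsCM (fun x => ∑ i ∈ s, f i x) := by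
  refine ⟨fun x => Finset.sum_nonneg fun i _ => (hf i).1 x, fun k x y => ?_⟩
  simp only [Finset.mul_sum]
  rw [Finset.sum_comm]
  exact Finset.sum_nonneg fun i _ => (hf i).2 k x y

/-- iterated forward difference -/
def fD (g : ℝ → ℝ) : ℕ → ℝ → ℝ
  | 0 => g
  | n + 1 => fun t => fD g n (t + 1) - fD g n t

lemma fD_deriv (g g' : ℝ → ℝ) (h : ∀ t, 0 < t → HasDerivAt g (g' t) t) (n : ℕ) :
    ∀ t, 0 < t → HasDerivAt (fD g n) (fD g' n t) t := by
  induction n with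
  | zero => exact h
  | succ n ih =>
    intro t ht
    exact ((ih (t + 1) (by linarith)).comp_add_const t 1).sub (ih t ht)

lemma fD_smul (c : ℝ) (g : ℝ → ℝ) (n : ℕ) (t : ℝ) :
    fD (fun s => c * g s) n t = c * fD g n t := by
  induction n generalizing t with
  | zero => rfl
  | succ n ih => simp only [fD, ih]; ring

lemma fD_neg (n : ℕ) : ∀ (a t : ℝ), (n : ℝ) - 1 < a → a < n → 0 < t →
    fD (fun s => s ^ a) (n + 1) t < 0 := by
  induction n with
  | zero =>
    intro a t h1 h2 ht
    simp only [fD]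
    have := Real.rpow_lt_rpow_of_neg ht (by linarith : t < t + 1) (by simpa using h2)
    linarith
  | succ n ih =>
    intro a t h1 h2 ht
    push_cast at h1 h2
    have hd : ∀ s, 0 < s → HasDerivAt (fD (fun s => s ^ a) (n + 1))
        (a * fD (fun s => s ^ (a - 1)) (n + 1) s) s := by
      intro s hs
      rw [← fD_smul]
      refine fD_deriv _ _ (fun u hu => ?_) _ s hs
      exact Real.hasDerivAt_rpow_const (Or.inl hu.ne')
    obtain ⟨c, hc, hc'⟩ := exists_hasDerivAt_eq_slope (fD (fun s => s ^ a) (n + 1))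
      (fun s => a * fD (fun s => s ^ (a - 1)) (n + 1) s) (by linarith : t < t + 1)
      (fun s hs => (hd s (by linarith [hs.1])).continuousAt.continuousWithinAt)
      (fun s hs => hd s (by linarith [hs.1]))
    have hn : (0 : ℝ) ≤ n := Nat.cast_nonneg n
    have e : fD (fun s => s ^ a) (n + 1 + 1) t = a * fD (fun s => s ^ (a - 1)) (n + 1) c := by
      rw [hc']
      simp only [fD]
      ring
    rw [e]
    exact mul_neg_of_pos_of_neg (by linarith)
      (ih (a - 1) c (by linarith) (by linarith) (by linarith [hc.1]))

lemma sum_powerset_fD {ι : Type*} [DecidableEq ι] (g : ℝ → ℝ) (s : Finset ι) :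
    ∀ t : ℝ, ∑ J ∈ s.powerset, (-1 : ℝ) ^ J.card * g (t + s.card - J.card) = fD g s.card t := by
  induction s using Finset.induction_on with
  | empty => intro t; simp [fD]
  | insert a s ha ih =>
    intro t
    rw [Finset.sum_powerset_insert ha, Finset.card_insert_of_notMem ha]
    simp only [fD]
    rw [← ih, ← ih, sub_eq_add_neg, ← Finset.sum_neg_distrib]
    congr 1
    · refine Finset.sum_congr rfl fun J _ => ?_
      congr 2
      push_cast; ring
    · refine Finset.sum_congr rfl fun J hJ => ?_
      rw [Finset.card_insert_of_notMem (fun h => ha (Finset.mem_powerset.1 hJ h)), pow_succ,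
        show t + ((s.card + 1 : ℕ) : ℝ) - ((J.card + 1 : ℕ) : ℝ) = t + s.card - J.card by
          push_cast; ring]
      ring

lemma cover_inf_fold {L : Type*} [DistribLattice L] {x : L} (S : Finset {y : L // x ⋖ y})
    (i : {y : L // x ⋖ y}) (hi : i ∉ S) :
    i.1 ⊓ S.fold (β := L) (· ⊔ ·) x Subtype.val = x := by
  classical
  induction S using Finset.induction_on with
  | empty => simpa using i.2.le
  | insert a s ha ih =>
    rw [Finset.mem_insert, not_or] at hi
    rw [Finset.fold_insert ha, inf_sup_left, ih hi.2,
      i.2.wcovBy.inf_eq a.2.wcovBy (fun h => hi.1 (Subtype.ext h)), sup_idem]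

end helpers

/-- On a finite distributive lattice `L` with maximal covering number `d_max`, there is a
completely monotone function `f` such that `f^α` is not completely monotone for any
non-integer `α` with `0 < α < d_max − 1`. -/
theorem stmt3 {L : Type*} [DistribLattice L] [Fintype L] :
    ∃ f : L → ℝ, IsCM f ∧ ∀ α : ℝ, (∀ j : ℤ, α ≠ j) → 0 < α →
      α < ((Finset.univ.sup (fun x : L => Nat.card {y : L // x ⋖ y}) : ℕ) : ℝ) - 1 →
      ¬ IsCM (fun x => f x ^ α) := by
  classical
  have hone : IsCM (fun _ : L => (1 : ℝ)) :=
    isCM_mult _ (by simp) (by simp) (by simp)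
  rcases isEmpty_or_nonempty L with hL | hL
  · refine ⟨fun _ => 1, hone, fun α _ h0 h1 => ?_⟩
    simp at h1
    linarith
  obtain ⟨x, -, hx⟩ := Finset.exists_mem_eq_sup (Finset.univ : Finset L) Finset.univ_nonempty
    (fun x : L => Nat.card {y : L // x ⋖ y})
  rw [hx]
  let C := {y : L // x ⋖ y}
  let z : C → L := fun i => (Finset.univ.erase i).fold (· ⊔ ·) x Subtype.val
  have hz : ∀ i, x ≤ z i ∧ ∀ j ∈ Finset.univ.erase i, j.1 ≤ z i :=
    fun i => (fold_sup_le _ _ _ _).1 le_rfl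
  have hz' : ∀ i j : C, j.1 ≤ z i ↔ j ≠ i := by
    intro i j
    constructor
    · rintro h rfl
      have h1 := cover_inf_fold (Finset.univ.erase j) j (by simp)
      have h2 : j.1 ⊓ z j = j.1 := inf_eq_left.2 h
      exact j.2.ne (h1.symm.trans h2)
    · intro h
      exact (hz i).2 j (by simp [h])
  refine ⟨fun w => 1 + ∑ i : C, if w ≤ z i then 1 else 0, ?_, ?_⟩
  · refine isCM_add hone (isCM_sum _ (fun i w => if w ≤ z i then 1 else 0) fun i => ?_)
    refine isCM_mult _ (fun a b => ?_) (fun a => ?_) (fun a => ?_)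
    · by_cases h1 : a ≤ z i <;> by_cases h2 : b ≤ z i <;> simp [h1, h2]
    · split_ifs <;> norm_num
    · split_ifs <;> norm_num
  intro α hα h0 h1 hcm
  rw [Nat.card_eq_fintype_card] at h1
  set m := ⌊α⌋₊ with hm
  have hm1 : (m : ℝ) < α := lt_of_le_of_ne (Nat.floor_le h0.le) (fun h => hα m (by simpa using h.symm))
  have hm2 : α < m + 1 := Nat.lt_floor_add_one α
  have hcard : m + 2 ≤ Fintype.card C := by
    have : (m : ℝ) + 1 < Fintype.card C := by
      change α < (Fintype.card C : ℝ) - 1 at h1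
      linarith
    have : m + 1 < Fintype.card C := by exact_mod_cast this
    omega
  obtain ⟨e⟩ : Nonempty (Fin (m + 1 + 1) ↪ C) :=
    Function.Embedding.nonempty_of_card_le (by rw [Fintype.card_fin]; exact hcard)
  have hs := hcm.2 (m + 1) x (fun j => (e j).1)
  have hval : ∀ J : Finset (Fin (m + 1 + 1)),
      (∑ i : C, if J.fold (β := L) (· ⊔ ·) x (fun j => (e j).1) ≤ z i then (1 : ℝ) else 0)
        = Fintype.card C - J.card := by
    intro J
    have : ∀ i : C, J.fold (β := L) (· ⊔ ·) x (fun j => (e j).1) ≤ z i ↔ i ∈ (J.map e)ᶜ := by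
      intro i
      rw [fold_sup_le]
      simp only [hz', (hz i).1, true_and, Finset.mem_compl, Finset.mem_map, not_exists, not_and]
    simp only [this]
    rw [Finset.sum_ite_mem, Finset.univ_inter, Finset.sum_const, Finset.card_compl,
      Finset.card_map, nsmul_eq_mul, mul_one, Nat.cast_sub]
    rw [← Finset.card_map e]
    exact Finset.card_le_univ _
  simp only [hval] at hs
  have hk := sum_powerset_fD (fun s => s ^ α) (Finset.univ : Finset (Fin (m + 1 + 1)))
    ((Fintype.card C : ℝ) - (m + 1))
  rw [Finset.powerset_univ] at hk
  have hc' : ((m : ℝ) + 2) ≤ Fintype.card C := by exact_mod_cast hcard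
  have hneg := fD_neg (m + 1) α ((Fintype.card C : ℝ) - (m + 1)) (by push_cast; linarith)
    (by push_cast; linarith) (by linarith)
  rw [Finset.card_univ, Fintype.card_fin] at hk
  rw [← hk] at hneg
  refine absurd hs (not_le.2 (lt_of_eq_of_lt ?_ hneg))
  refine Finset.sum_congr rfl fun J _ => ?_
  congr 2
  push_cast
  ring
end

section
/- Let L be a finite lattice and g : L → ℝ a nonnegative function. Then g is completely monotone if and only if there exists a nonnegative function p : L → ℝ such that g(x) = Σ_{y ∈ L, y ≥ x} p(y) for every x ∈ L. -/
theorem stmt4_exists_p {L : Type*} [Lattice L] [Fintype L]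
    [DecidableRel ((· ≤ ·) : L → L → Prop)] (g : L → ℝ) :
    ∃ p : L → ℝ, ∀ x, g x = ∑ y ∈ Finset.univ.filter (fun y => x ≤ y), p y := by
  classical
  have wf : WellFounded (fun a b : L => b < a) := wellFounded_gt
  let F : (x : L) → ((y : L) → x < y → ℝ) → ℝ := fun x ih =>
    g x - ∑ y ∈ (Finset.univ.filter (fun y => x < y)).attach,
      ih y.1 (Finset.mem_filter.1 y.2).2
  let p : L → ℝ := wf.fix F
  refine ⟨p, fun x => ?_⟩
  have hp : p x = g x - ∑ y ∈ Finset.univ.filter (fun y => x < y), p y := by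
    have h1 : p x = F x (fun y _ => p y) := wf.fix_eq F x
    rw [h1]
    simp only [F]
    rw [Finset.sum_attach (Finset.univ.filter (fun y => x < y)) p]
  have hs : Finset.univ.filter (fun y => x ≤ y)
      = insert x (Finset.univ.filter (fun y => x < y)) := by
    ext y
    simp [le_iff_eq_or_lt, eq_comm]
  rw [hs, Finset.sum_insert (by simp), hp]
  ring

theorem stmt4_key {L : Type*} [Lattice L] [Fintype L]
    [DecidableRel ((· ≤ ·) : L → L → Prop)] (g p : L → ℝ)
    (h : ∀ x, g x = ∑ y ∈ Finset.univ.filter (fun y => x ≤ y), p y)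
    (n : ℕ) (x : L) (y : Fin n → L) :
    ∑ J : Finset (Fin n), (-1 : ℝ) ^ J.card * g (J.fold (· ⊔ ·) x y)
      = ∑ z ∈ Finset.univ.filter (fun z => x ≤ z ∧ ∀ i, ¬ y i ≤ z), p z := by
  classical
  have hf : ∀ (J : Finset (Fin n)) (z : L),
      J.fold (fun a b : L => a ⊔ b) x y ≤ z ↔ x ≤ z ∧ ∀ i ∈ J, y i ≤ z := by
    intro J z
    induction J using Finset.induction_on with
    | empty => simp
    | insert a s ha ih =>
      rw [Finset.fold_insert ha, sup_le_iff, ih]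
      simp only [Finset.mem_insert, forall_eq_or_imp]
      tauto
  have hsum : ∀ z : L, (∑ J : Finset (Fin n),
      if (∀ i ∈ J, y i ≤ z) then (-1 : ℝ) ^ J.card else 0)
      = if (∀ i, ¬ y i ≤ z) then 1 else 0 := by
    intro z
    have h2 := Finset.sum_powerset_neg_one_pow_card
      (x := Finset.univ.filter (fun i => y i ≤ z))
    have h3 : (Finset.univ.filter (fun J : Finset (Fin n) => ∀ i ∈ J, y i ≤ z))
        = (Finset.univ.filter (fun i => y i ≤ z)).powerset := by
      ext J
      simp [Finset.subset_iff]
    rw [← Finset.sum_filter, h3]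
    have h4 := congrArg (fun t : ℤ => (t : ℝ)) h2
    push_cast at h4
    rw [h4]
    simp [Finset.filter_eq_empty_iff]
  simp only [h, Finset.sum_filter, Finset.mul_sum]
  rw [Finset.sum_comm]
  refine Finset.sum_congr rfl fun z _ => ?_
  by_cases hx : x ≤ z
  · have h5 := congrArg (fun t => t * p z) (hsum z)
    simp only [Finset.sum_mul] at h5
    simp only [hf, hx, true_and]
    simpa using h5
  · simp [hf, hx]

/-- On a finite lattice `L`, a nonnegative function `g` is completely monotone if and only if
there is a nonnegative `p : L → ℝ` with `g x = Σ_{y ≥ x} p y` for all `x`. -/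
theorem stmt4 {L : Type*} [Lattice L] [Fintype L]
    [DecidableRel ((· ≤ ·) : L → L → Prop)]
    (g : L → ℝ) (hg : ∀ x, 0 ≤ g x) :
    IsCM g ↔ ∃ p : L → ℝ, (∀ y, 0 ≤ p y) ∧
      ∀ x, g x = ∑ y ∈ Finset.univ.filter (fun y => x ≤ y), p y := by
  classical
  constructor
  · intro hcm
    obtain ⟨p, hp⟩ := stmt4_exists_p g
    refine ⟨p, fun x => ?_, hp⟩
    have aux : ∀ (n : ℕ) (y : Fin n → L), (∀ w, x < w ↔ ∃ i, y i = w) →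
        ∑ J : Finset (Fin n), (-1 : ℝ) ^ J.card * g (J.fold (· ⊔ ·) x y) = p x := by
      intro n y hy
      rw [stmt4_key g p hp]
      have : Finset.univ.filter (fun z => x ≤ z ∧ ∀ i, ¬ y i ≤ z) = {x} := by
        ext z
        simp only [Finset.mem_filter, Finset.mem_univ, true_and, Finset.mem_singleton]
        constructor
        · rintro ⟨h1, h2⟩
          by_contra hne
          obtain ⟨i, hi⟩ := (hy z).1 (lt_of_le_of_ne h1 (Ne.symm hne))
          exact h2 i hi.le
        · rintro rfl
          exact ⟨le_rfl, fun i hi => absurd ((hy (y i)).2 ⟨i, rfl⟩) (not_lt_of_ge hi)⟩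
      rw [this, Finset.sum_singleton]
    obtain ⟨n, ⟨e⟩⟩ := Finite.exists_equiv_fin {w : L // x < w}
    have hy : ∀ w, x < w ↔ ∃ i, ((e.symm i : {w : L // x < w}) : L) = w := fun w =>
      ⟨fun hw => ⟨e ⟨w, hw⟩, by simp⟩, by rintro ⟨i, rfl⟩; exact (e.symm i).2⟩
    have h := aux n (fun i => (e.symm i : L)) hy
    cases n with
    | zero =>
      rw [← h]
      rw [Fintype.sum_unique]
      have h0 : (default : Finset (Fin 0)) = ∅ := rfl
      simp [h0, hg]
    | succ k =>
      rw [← h]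
      exact hcm.2 k x _
  · rintro ⟨p, hp0, hp⟩
    refine ⟨hg, fun k x y => ?_⟩
    rw [stmt4_key g p hp]
    exact Finset.sum_nonneg fun z _ => hp0 z
end

section
/- Let L be a finite distributive lattice, let x ∈ L, and let x₁, …, xₙ be an enumeration of all the elements covering x. Then for any two distinct nonempty subsets S and T of {1,…,n}, the joins differ: ⋁_{i∈S} x_i ≠ ⋁_{i∈T} x_i. -/
theorem cover_mem_of_le {L : Type*} [DistribLattice L] (x : L) (n : ℕ)
    (c : Fin n → L) (hinj : Function.Injective c) (hcov : ∀ i, x ⋖ c i)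
    (T : Finset (Fin n)) (hT : T.Nonempty) (i : Fin n) (h : c i ≤ T.sup' hT c) : i ∈ T := by
  by_contra hi
  have key : c i ⊓ T.sup' hT c ≤ x := by
    refine Finset.sup'_induction (p := fun a => c i ⊓ a ≤ x) hT c ?_ ?_
    · intro a ha b hb
      rw [inf_sup_left]
      exact sup_le ha hb
    · intro j hj
      have hne : c i ≠ c j := fun e => hi (hinj e ▸ hj)
      rcases (hcov i).eq_or_eq (le_inf (hcov i).le (hcov j).le) inf_le_left with e | e
      · exact e.le
      · have hle : c i ≤ c j := inf_eq_left.mp e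
        rcases (hcov j).eq_or_eq (hcov i).le hle with e' | e'
        · exact absurd e' (hcov i).lt.ne'
        · exact absurd e' hne
  rw [inf_eq_left.mpr h] at key
  exact absurd key (hcov i).lt.not_ge

/-- In a finite distributive lattice, if `c 0, …, c (n-1)` enumerate all the elements covering a
fixed element `x`, then the joins of two distinct nonempty subsets of covering elements are
distinct. -/
theorem stmt5 {L : Type*} [DistribLattice L] [Fintype L] (x : L) (n : ℕ)
    (c : Fin n → L) (hinj : Function.Injective c)
    (hcov : ∀ i, x ⋖ c i) (hall : ∀ y, x ⋖ y → ∃ i, c i = y)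
    (S T : Finset (Fin n)) (hS : S.Nonempty) (hT : T.Nonempty) (hST : S ≠ T) :
    S.sup' hS c ≠ T.sup' hT c := by
  intro h
  apply hST
  ext i
  constructor
  · intro hi
    exact cover_mem_of_le x n c hinj hcov T hT i (h ▸ Finset.le_sup' c hi)
  · intro hi
    exact cover_mem_of_le x n c hinj hcov S hS i (h.symm ▸ Finset.le_sup' c hi)
end

section
/- Let L be a lattice and S a finite sublattice of L (a finite subset closed under the join and meet of L). For every function f : S → ℝ that is completely monotone on the lattice S, there exists a completely monotone function g : L → ℝ such that g(x) = f(x) for all x ∈ S. -/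
open Classical in
theorem cm_fold_le {L : Type*} [Lattice L] {ι : Type*} (J : Finset ι) (x t : L) (y : ι → L) :
    (J.fold (· ⊔ ·) x y : L) ≤ t ↔ x ≤ t ∧ ∀ i ∈ J, y i ≤ t := by
  induction J using Finset.induction_on with
  | empty => simp
  | insert a J ha ih =>
    rw [Finset.fold_insert ha, sup_le_iff, ih]
    simp only [Finset.mem_insert, forall_eq_or_imp]
    tauto

open Classical in
theorem cm_ind {L : Type*} [Lattice L] (k : ℕ) (x t : L) (y : Fin k → L) :
    ∑ J : Finset (Fin k), (-1 : ℝ) ^ J.card * (if (J.fold (· ⊔ ·) x y : L) ≤ t then (1:ℝ) else 0)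
      = (if x ≤ t then (1:ℝ) else 0) * ∏ i, (1 - if y i ≤ t then (1:ℝ) else 0) := by
  have h : ∏ i, (1 - if y i ≤ t then (1:ℝ) else 0)
      = ∑ J : Finset (Fin k), (-1 : ℝ) ^ J.card * ∏ i ∈ J, if y i ≤ t then (1:ℝ) else 0 := by
    simp only [sub_eq_add_neg]
    rw [Finset.prod_one_add]
    simp only [Finset.powerset_univ, Finset.prod_neg]
  rw [h, Finset.mul_sum]
  refine Finset.sum_congr rfl fun J _ => ?_
  rw [Finset.prod_ite_zero, mul_left_comm]
  congr 1
  simp only [cm_fold_le]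
  by_cases h1 : x ≤ t <;> simp [h1]

open Classical in
theorem cm_sum {L : Type*} [Lattice L] {ι : Type*} (S : Finset ι) (e : ι → L) (m : ι → ℝ)
    (k : ℕ) (x : L) (y : Fin k → L) :
    ∑ J : Finset (Fin k), (-1 : ℝ) ^ J.card *
      (∑ t ∈ S, m t * (if (J.fold (· ⊔ ·) x y : L) ≤ e t then (1:ℝ) else 0))
      = ∑ t ∈ S, m t * ((if x ≤ e t then (1:ℝ) else 0) *
          ∏ i, (1 - if y i ≤ e t then (1:ℝ) else 0)) := by
  simp only [← cm_ind, Finset.mul_sum]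
  rw [Finset.sum_comm]
  refine Finset.sum_congr rfl fun t _ => Finset.sum_congr rfl fun J _ => by ring

open Classical in
theorem cm_moebius {P : Type*} [PartialOrder P] [Fintype P] (f : P → ℝ) :
    ∃ m : P → ℝ, ∀ s, f s = ∑ t, m t * (if s ≤ t then (1:ℝ) else 0) := by
  have wf : WellFounded (fun a b : P => b < a) := wellFounded_gt
  let F : (s : P) → ((t : P) → s < t → ℝ) → ℝ :=
    fun s ih => f s - ∑ t, if h : s < t then ih t h else 0
  refine ⟨wf.fix F, fun s => ?_⟩
  have h : wf.fix F s = f s - ∑ t, if s < t then wf.fix F t else 0 := by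
    rw [wf.fix_eq]; simp [F]
  have h2 : ∀ t, wf.fix F t * (if s ≤ t then (1:ℝ) else 0)
      = (if s = t then wf.fix F t else 0) + if s < t then wf.fix F t else 0 := by
    intro t
    rcases eq_or_ne s t with rfl | hne
    · simp
    · simp [hne, lt_iff_le_and_ne]
  simp only [h2, Finset.sum_add_distrib]
  rw [Finset.sum_ite_eq]
  simp only [Finset.mem_univ, if_true]
  linarith


/-- Every function which is completely monotone on a finite sublattice `S` of a lattice `L`
(that is, nonnegative on `S` with all discrete derivatives formed from elements of `S`
nonnegative) extends to a completely monotone function on all of `L`. -/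
theorem stmt6 {L : Type*} [Lattice L] (S : Finset L)
    (hsup : ∀ a ∈ S, ∀ b ∈ S, a ⊔ b ∈ S) (hinf : ∀ a ∈ S, ∀ b ∈ S, a ⊓ b ∈ S)
    (f : L → ℝ) (hf0 : ∀ x ∈ S, 0 ≤ f x)
    (hfcm : ∀ (k : ℕ) (x : L) (y : Fin (k + 1) → L), x ∈ S → (∀ i, y i ∈ S) →
      0 ≤ ∑ J : Finset (Fin (k + 1)), (-1 : ℝ) ^ J.card * f (J.fold (· ⊔ ·) x y)) :
    ∃ g : L → ℝ, IsCM g ∧ ∀ x ∈ S, g x = f x := by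
  classical
  obtain ⟨m, hm⟩ := cm_moebius (P := S) (fun s => f s)
  have hfold : ∀ (k : ℕ) (J : Finset (Fin k)) (x : L) (y : Fin k → L), x ∈ S → (∀ i, y i ∈ S) →
      (J.fold (· ⊔ ·) x y : L) ∈ S := by
    intro k J x y hx hy
    induction J using Finset.induction_on with
    | empty => simpa
    | insert a J ha ih => rw [Finset.fold_insert ha]; exact hsup _ (hy a) _ ih
  have hfS : ∀ x ∈ S, f x = ∑ t, m t * (if x ≤ (t : L) then (1:ℝ) else 0) := by
    intro x hx
    exact hm ⟨x, hx⟩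
  have hprod : ∀ (k : ℕ) (y : Fin k → L) (t : L),
      0 ≤ ∏ i, (1 - if y i ≤ t then (1:ℝ) else 0) := by
    intro k y t
    refine Finset.prod_nonneg fun i _ => ?_
    split_ifs <;> simp
  have hm0 : ∀ s, 0 ≤ m s := by
    intro s
    let U : Finset S := Finset.univ.filter (fun t => s < t)
    -- all elements strictly above `s`
    have key : ∀ (k : ℕ) (e : Fin k ≃ U),
        ∑ J : Finset (Fin k), (-1 : ℝ) ^ J.card * f (J.fold (· ⊔ ·) (s : L) fun i => ((e i : S) : L))
          = m s := by
      intro k e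
      have h1 : ∀ J : Finset (Fin k), f (J.fold (· ⊔ ·) (s : L) fun i => ((e i : S) : L))
          = _ := fun J => hfS _ (hfold k J s _ s.2 fun i => (e i : S).2)
      simp only [h1]
      rw [cm_sum Finset.univ (fun t : S => (t : L)) m, Finset.sum_eq_single s]
      · have : ∀ i, ¬ (((e i : S) : L) ≤ s) := by
          intro i
          have := (Finset.mem_filter.1 (e i).2).2
          exact not_le_of_gt this
        simp [this]
      · intro t _ hts
        by_cases hst : (s : L) ≤ t
        · have hlt : s < t := lt_of_le_of_ne hst (Ne.symm hts)
          have : ∏ i, (1 - if ((e i : S) : L) ≤ (t : L) then (1:ℝ) else 0) = 0 := by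
            refine Finset.prod_eq_zero (Finset.mem_univ (e.symm ⟨t, by simp [U, hlt]⟩)) ?_
            simp
          rw [this]; simp
        · simp [hst]
      · simp
    have e : Fin U.card ≃ U := U.equivFin.symm
    generalize U.card = n at e
    rw [← key n e]
    cases n with
    | zero => simpa [Finset.univ_unique, Subsingleton.elim (default : Finset (Fin 0)) ∅] using hf0 s s.2
    | succ k => exact hfcm k s _ s.2 fun i => (e i : S).2
  refine ⟨fun x => ∑ t, m t * (if x ≤ (t : L) then (1:ℝ) else 0), ⟨fun x => ?_, ?_⟩,
    fun x hx => (hfS x hx).symm⟩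
  · refine Finset.sum_nonneg fun t _ => mul_nonneg (hm0 t) ?_
    split_ifs <;> simp
  · intro k x y
    rw [cm_sum Finset.univ (fun t : S => (t : L)) m]
    refine Finset.sum_nonneg fun t _ => mul_nonneg (hm0 t) (mul_nonneg ?_ (hprod _ _ _))
    split_ifs <;> simp
end

section
/- Let n ≥ 2 and α ∈ (n−1, n). Then f_{n,α} is strictly Schur convex on A_n; that is, for all x, y ∈ A_n such that x is majorized by y and y is not a permutation of x, one has f_{n,α}(x) < f_{n,α}(y). -/
/-- The function `f_{n,α}(x) = 1 + Σ_{∅≠B⊆[n]} [(−1)^{n+1−|B|}(Σ_{i∈B} x_i)^α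
+ (−1)^{|B|}(1 − Σ_{i∈B} x_i)^α]`, where the powers are real powers. -/
noncomputable def fna (n : ℕ) (α : ℝ) (x : Fin n → ℝ) : ℝ :=
  1 + ∑ B ∈ Finset.univ.powerset.filter (fun B : Finset (Fin n) => B.Nonempty),
    ((-1 : ℝ) ^ (n + 1 - B.card) * (∑ i ∈ B, x i) ^ α +
      (-1 : ℝ) ^ B.card * (1 - ∑ i ∈ B, x i) ^ α)

/-- The open simplex `A_n = {x : 0 < x_i < 1, Σ x_i < 1}`. -/
def memA (n : ℕ) (x : Fin n → ℝ) : Prop :=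
  (∀ i, 0 < x i ∧ x i < 1) ∧ ∑ i, x i < 1

/-- `x` is majorized by `y`: the total sums agree and for each `k`, the maximum of
`Σ_{i∈S} x_i` over `|S| = k` is at most the corresponding maximum for `y`. -/
def Majorized {n : ℕ} (x y : Fin n → ℝ) : Prop :=
  (∑ i, x i = ∑ i, y i) ∧
  ∀ S : Finset (Fin n), ∃ T : Finset (Fin n),
    T.card = S.card ∧ ∑ i ∈ S, x i ≤ ∑ i ∈ T, y i


/-- Iterated (signed) finite difference. -/
noncomputable def DD {ι : Type*} [DecidableEq ι] (s : Finset ι) (h : ι → ℝ) (φ : ℝ → ℝ) (a : ℝ) : ℝ :=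
  ∑ B ∈ s.powerset, (-1 : ℝ) ^ B.card * φ (a + ∑ i ∈ B, h i)

noncomputable def PP (k : ℕ) (p : ℝ) : ℝ := ∏ i ∈ Finset.range k, (p - i)

lemma PP_succ' (k : ℕ) (p : ℝ) : PP (k + 1) p = PP k (p - 1) * p := by
  unfold PP
  rw [Finset.prod_range_succ']
  congr 1
  · apply Finset.prod_congr rfl
    intro i _
    push_cast
    ring
  · simp

lemma DD_insert {ι : Type*} [DecidableEq ι] (s : Finset ι) (i : ι) (hi : i ∉ s) (h : ι → ℝ)
    (φ : ℝ → ℝ) (a : ℝ) : DD (insert i s) h φ a = DD s h φ a - DD s h φ (a + h i) := by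
  unfold DD
  rw [Finset.sum_powerset_insert hi, sub_eq_add_neg, ← Finset.sum_neg_distrib]
  congr 1
  apply Finset.sum_congr rfl
  intro B hB
  have hiB : i ∉ B := fun h' => hi (Finset.mem_powerset.1 hB h')
  rw [Finset.card_insert_of_notMem hiB, Finset.sum_insert hiB, pow_succ, add_assoc]
  ring

lemma DD_congr {ι : Type*} [DecidableEq ι] (s : Finset ι) (h h' : ι → ℝ)
    (hh : ∀ i ∈ s, h i = h' i) (φ : ℝ → ℝ) (a : ℝ) : DD s h φ a = DD s h' φ a := by
  unfold DD
  apply Finset.sum_congr rfl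
  intro B hB
  rw [Finset.sum_congr rfl fun i hi => hh i (Finset.mem_powerset.1 hB hi)]

lemma DD_hasDeriv {ι : Type*} [DecidableEq ι] (s : Finset ι) (h : ι → ℝ)
    (hs : ∀ i ∈ s, 0 < h i) (p a : ℝ) (ha : 0 < a) :
    HasDerivAt (DD s h (fun t => t ^ p)) (p * DD s h (fun t => t ^ (p - 1)) a) a := by
  unfold DD
  rw [Finset.mul_sum]
  apply HasDerivAt.fun_sum
  intro B hB
  have h0 : 0 ≤ ∑ i ∈ B, h i :=
    Finset.sum_nonneg fun i hi => (hs i (Finset.mem_powerset.1 hB hi)).le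
  have h1 : a + ∑ i ∈ B, h i ≠ 0 := by positivity
  have := ((((hasDerivAt_id a).add_const (∑ i ∈ B, h i)).rpow_const (p := p)
    (Or.inl h1)).const_mul ((-1 : ℝ) ^ B.card))
  refine HasDerivAt.congr_deriv (f := fun a => (-1 : ℝ) ^ B.card * (a + ∑ i ∈ B, h i) ^ p) this ?_
  simp only [id]
  ring

lemma DD_mono_of_pos {ι : Type*} [DecidableEq ι] (s : Finset ι) (h : ι → ℝ)
    (hs : ∀ i ∈ s, 0 < h i) (p : ℝ) (hP : PP (s.card + 1) p ≠ 0)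
    (pos : ∀ a, 0 < a →
      0 < (-1 : ℝ) ^ s.card * PP s.card (p - 1) * DD s h (fun t => t ^ (p - 1)) a) :
    StrictMonoOn (fun a => (-1 : ℝ) ^ s.card * PP (s.card + 1) p * DD s h (fun t => t ^ p) a)
      (Set.Ioi 0) := by
  have hd : ∀ a ∈ Set.Ioi (0:ℝ), HasDerivAt
      (fun a => (-1 : ℝ) ^ s.card * PP (s.card + 1) p * DD s h (fun t => t ^ p) a)
      ((-1 : ℝ) ^ s.card * PP (s.card + 1) p * (p * DD s h (fun t => t ^ (p - 1)) a)) a :=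
    fun a ha => (DD_hasDeriv s h hs p a ha).const_mul _
  apply strictMonoOn_of_deriv_pos (convex_Ioi 0)
  · exact fun a ha => (hd a ha).continuousAt.continuousWithinAt
  · intro a ha
    rw [interior_Ioi] at ha
    rw [(hd a ha).deriv]
    rw [PP_succ'] at hP ⊢
    have hp : p ≠ 0 := right_ne_zero_of_mul hP
    have := mul_pos (pos a ha) (pow_pos (abs_pos.2 hp) 2)
    rw [sq_abs] at this
    linarith

lemma DD_pos {ι : Type*} [DecidableEq ι] (s : Finset ι) (h : ι → ℝ)
    (hs : ∀ i ∈ s, 0 < h i) : ∀ (p : ℝ), PP s.card p ≠ 0 → ∀ a, 0 < a →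
      0 < (-1 : ℝ) ^ s.card * PP s.card p * DD s h (fun t => t ^ p) a := by
  induction s using Finset.induction_on with
  | empty =>
    intro p _ a ha
    simp [DD, PP]
    positivity
  | insert i s hi ih =>
    intro p hP a ha
    rw [Finset.card_insert_of_notMem hi] at hP ⊢
    have hs' : ∀ j ∈ s, 0 < h j := fun j hj => hs j (Finset.mem_insert_of_mem hj)
    have hP' := hP
    rw [PP_succ'] at hP'
    have mono := DD_mono_of_pos s h hs' p hP (ih hs' (p - 1) (left_ne_zero_of_mul hP'))
    have hhi := hs i (Finset.mem_insert_self _ _)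
    have := mono (show a ∈ Set.Ioi 0 from ha)
      (show a + h i ∈ Set.Ioi 0 from add_pos ha hhi) (by linarith)
    simp only at this
    rw [DD_insert s i hi, pow_succ]
    linarith

lemma PP_pos (k : ℕ) (p : ℝ) (hp : (k : ℝ) - 1 < p) : 0 < PP k p := by
  apply Finset.prod_pos
  intro i hi
  have : ((i + 1 : ℕ) : ℝ) ≤ k := by exact_mod_cast Finset.mem_range.1 hi
  push_cast at this
  linarith

noncomputable def phi (n : ℕ) (α : ℝ) (s : ℝ) : ℝ := (-1 : ℝ) ^ (n + 1) * s ^ α + (1 - s) ^ α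

lemma key (n : ℕ) (α : ℝ) (hα1 : (n : ℝ) - 1 < α) (hα2 : α < n) (h : Fin n → ℝ)
    (hh : ∀ i, 0 < h i) (v : ℝ) (hv : 0 < v) (hvH : v + ∑ i, h i + v < 1) :
    DD Finset.univ h (phi n α) v < 0 := by
  have hneg : PP (n + 1) α < 0 := by
    unfold PP
    rw [Finset.prod_range_succ]
    exact mul_neg_of_pos_of_neg (PP_pos n α hα1) (by linarith)
  have hcard : (Finset.univ : Finset (Fin n)).card = n := by simp
  have hP' := hneg.ne
  rw [PP_succ'] at hP'
  have mono := DD_mono_of_pos Finset.univ h (fun i _ => hh i) α (by rw [hcard]; exact hneg.ne)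
    (DD_pos Finset.univ h (fun i _ => hh i) (α - 1) (by
      rw [hcard]; exact left_ne_zero_of_mul hP'))
  rw [hcard] at mono
  set w := 1 - v - ∑ i, h i with hw
  have hvw : v < w := by linarith
  have h1 := mono (show v ∈ Set.Ioi 0 from hv) (show w ∈ Set.Ioi 0 from hv.trans hvw) hvw
  simp only at h1
  have h2 : DD Finset.univ h (phi n α) v = (-1 : ℝ) ^ n *
      (DD Finset.univ h (fun t => t ^ α) w - DD Finset.univ h (fun t => t ^ α) v) := by
    have e : DD Finset.univ h (fun t => t ^ α) w = ∑ B ∈ (Finset.univ : Finset (Fin n)).powerset,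
        (-1 : ℝ) ^ Bᶜ.card * (w + ∑ i ∈ Bᶜ, h i) ^ α := by
      unfold DD
      simp only [Finset.powerset_univ]
      exact (Equiv.sum_comp (Function.Involutive.toPerm (compl : Finset (Fin n) → _) compl_involutive)
        (fun B => (-1 : ℝ) ^ B.card * (w + ∑ i ∈ B, h i) ^ α)).symm
    rw [e]
    unfold DD phi
    rw [← Finset.sum_sub_distrib, Finset.mul_sum]
    apply Finset.sum_congr rfl
    intro B _
    have hB : ∑ i ∈ Bᶜ, h i = ∑ i, h i - ∑ i ∈ B, h i := by
      rw [← Finset.sum_compl_add_sum B]; ring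
    have hc : Bᶜ.card + B.card = n := by
      rw [Finset.card_compl_add_card]; simp
    have hs : (-1 : ℝ) ^ n * (-1 : ℝ) ^ Bᶜ.card = (-1 : ℝ) ^ B.card := by
      have hn' : (-1 : ℝ) ^ n = (-1 : ℝ) ^ (Bᶜ.card + B.card) := congrArg _ hc.symm
      rw [hn', pow_add, mul_right_comm, ← mul_pow]
      simp
    have ha : w + ∑ i ∈ Bᶜ, h i = 1 - (v + ∑ i ∈ B, h i) := by rw [hB, hw]; ring
    rw [ha, mul_sub, ← mul_assoc, hs, pow_succ]
    ring
  rw [h2]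
  have h3 : PP (n+1) α * ((-1 : ℝ) ^ n *
      (DD Finset.univ h (fun t => t ^ α) w - DD Finset.univ h (fun t => t ^ α) v)) > 0 := by
    linarith
  by_contra hcon
  push Not at hcon
  nlinarith [mul_nonneg hcon (neg_nonneg.2 hneg.le)]

lemma fna_eq (n : ℕ) (α : ℝ) (hα : 0 < α) (x : Fin n → ℝ) :
    fna n α x = DD Finset.univ x (phi n α) 0 := by
  unfold fna DD phi
  have : (Finset.univ : Finset (Fin n)).powerset.filter (fun B : Finset (Fin n) => B.Nonempty)
      = (Finset.univ : Finset (Fin n)).powerset.erase ∅ := by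
    ext B; simp [Finset.nonempty_iff_ne_empty]
  rw [this, ← Finset.add_sum_erase _ _ (Finset.empty_mem_powerset _)]
  congr 1
  · simp [Real.zero_rpow hα.ne']
  · apply Finset.sum_congr rfl
    intro B _
    have hB : B.card ≤ n := by simpa using Finset.card_le_univ B
    have : (-1 : ℝ) ^ (n + 1) = (-1) ^ (n + 1 - B.card) * (-1) ^ B.card := by
      rw [← pow_add]; congr 1; omega
    have h1 : ((-1 : ℝ) ^ B.card) * (-1 : ℝ) ^ B.card = 1 := by
      rw [← mul_pow]; simp
    rw [this, zero_add]
    linear_combination (-(-1 : ℝ) ^ (n + 1 - B.card) * (∑ i ∈ B, x i) ^ α) * h1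

lemma DD_two (n : ℕ) (h : Fin n → ℝ) (φ : ℝ → ℝ) (j k : Fin n) (hjk : j ≠ k) (a : ℝ) :
    DD Finset.univ h φ a =
      DD ((Finset.univ.erase j).erase k) h φ a - DD ((Finset.univ.erase j).erase k) h φ (a + h k)
      - (DD ((Finset.univ.erase j).erase k) h φ (a + h j)
        - DD ((Finset.univ.erase j).erase k) h φ (a + h j + h k)) := by
  have hk : k ∈ (Finset.univ : Finset (Fin n)).erase j := by simp [hjk.symm]
  rw [← DD_insert _ k (Finset.notMem_erase _ _), ← DD_insert _ k (Finset.notMem_erase _ _),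
    Finset.insert_erase hk, ← DD_insert _ j (Finset.notMem_erase _ _),
    Finset.insert_erase (Finset.mem_univ j)]

lemma sum_two (n : ℕ) (h : Fin n → ℝ) (j k : Fin n) (hjk : j ≠ k) :
    ∑ i, h i = h j + (h k + ∑ i ∈ ((Finset.univ.erase j).erase k), h i) := by
  have hk : k ∈ (Finset.univ : Finset (Fin n)).erase j := by simp [hjk.symm]
  rw [Finset.add_sum_erase _ _ hk, Finset.add_sum_erase _ _ (Finset.mem_univ j)]

/-- A strict transfer decreases `fna`. -/
lemma transfer (n : ℕ) (α : ℝ) (hα : 0 < α) (hα1 : (n : ℝ) - 1 < α) (hα2 : α < n)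
    (y z : Fin n → ℝ) (hy : memA n y) (j k : Fin n) (hjk : j ≠ k) (δ : ℝ) (hδ : 0 < δ)
    (hδ2 : δ < y j - y k) (hzj : z j = y j - δ) (hzk : z k = y k + δ)
    (hz : ∀ i, i ≠ j → i ≠ k → z i = y i) :
    fna n α z < fna n α y := by
  classical
  rw [fna_eq n α hα, fna_eq n α hα, DD_two n z _ j k hjk, DD_two n y _ j k hjk]
  set h : Fin n → ℝ := fun i => if i = j then y j - y k - δ else if i = k then δ else y i with hh
  have hj : h j = y j - y k - δ := by simp [hh]
  have hk : h k = δ := by simp [hh, hjk.symm]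
  have hR : ∀ i ∈ (Finset.univ.erase j).erase k, h i = y i := by
    intro i hi
    simp only [Finset.mem_erase] at hi
    simp [hh, hi.1, hi.2.1]
  have hR' : ∀ i ∈ (Finset.univ.erase j).erase k, z i = y i := by
    intro i hi
    simp only [Finset.mem_erase] at hi
    exact hz i hi.2.1 hi.1
  have hpos : ∀ i, 0 < h i := by
    intro i
    simp only [hh]
    split_ifs
    · linarith
    · exact hδ
    · exact (hy.1 i).1
  have hsum : y k + ∑ i, h i + y k < 1 := by
    have := hy.2
    rw [sum_two n y j k hjk] at this
    rw [sum_two n h j k hjk, hj, hk, Finset.sum_congr rfl hR]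
    linarith
  have K := key n α hα1 hα2 h hpos (y k) (hy.1 k).1 hsum
  rw [DD_two n h _ j k hjk] at K
  simp only [DD_congr _ h y hR] at K
  simp only [DD_congr _ z y hR']
  rw [hj, hk] at K
  rw [hzj, hzk]
  have e1 : y k + (y j - y k - δ) = y j - δ := by ring
  have e2 : y j - δ + δ = y j := by ring
  have e3 : 0 + (y j - δ) + (y k + δ) = 0 + y j + y k := by ring
  rw [e1, e2] at K
  rw [e3]
  simp only [zero_add]
  linarith

lemma chain (n : ℕ) (α : ℝ) (hα : 0 < α) (hα1 : (n : ℝ) - 1 < α) (hα2 : α < n)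
    (x : Fin n → ℝ) (hx : memA n x) (hanti : Antitone x) :
    ∀ (N : ℕ) (y : Fin n → ℝ), memA n y → (Finset.univ.filter fun i => x i ≠ y i).card = N →
      ∑ i, x i = ∑ i, y i → (∀ m : Fin n, ∑ i ∈ Finset.Iio m, x i ≤ ∑ i ∈ Finset.Iio m, y i) →
      x ≠ y → fna n α x < fna n α y := by
  classical
  intro N
  induction N using Nat.strong_induction_on with
  | _ N ih =>
  intro y hy hN htot hpre hne
  -- smallest index with `y k < x k`
  have hex : (Finset.univ.filter fun i => y i < x i).Nonempty := by
    by_contra hcon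
    rw [Finset.not_nonempty_iff_eq_empty, Finset.filter_eq_empty_iff] at hcon
    apply hne
    funext i
    exact (Finset.sum_eq_sum_iff_of_le (fun i _ => not_lt.1 (hcon (Finset.mem_univ i)))).1 htot i
      (Finset.mem_univ i)
  obtain ⟨k, hkmem, hkmin⟩ := Finset.exists_min_image _ id hex
  have hk : y k < x k := by simpa using hkmem
  have hlt : ∀ i, i < k → x i ≤ y i := by
    intro i hi
    by_contra hcon
    exact absurd (hkmin i (by simpa using hcon)) (not_le.2 hi)
  have hj : ∃ j, j < k ∧ x j < y j := by
    by_contra hcon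
    push Not at hcon
    have e1 : ∑ i ∈ Finset.Iio k, x i = ∑ i ∈ Finset.Iio k, y i :=
      Finset.sum_congr rfl fun i hi =>
        le_antisymm (hlt i (Finset.mem_Iio.1 hi)) (hcon i (Finset.mem_Iio.1 hi))
    -- the partial sum through k contradicts
    have e2 : ∑ i ∈ Finset.Iic k, x i ≤ ∑ i ∈ Finset.Iic k, y i := by
      by_cases hlast : (k : ℕ) + 1 < n
      · have := hpre ⟨k + 1, hlast⟩
        have e : Finset.Iio (⟨k + 1, hlast⟩ : Fin n) = Finset.Iic k := by
          ext i; rw [Finset.mem_Iio, Finset.mem_Iic, Fin.lt_def, Fin.le_def]; exact Nat.lt_succ_iff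
        rwa [e] at this
      · have e : Finset.Iic k = Finset.univ := by
          ext i; rw [Finset.mem_Iic, Fin.le_def]; have := i.2; simp only [Finset.mem_univ, iff_true]; omega
        rw [e]; exact htot.le
    rw [← Finset.Iio_insert, Finset.sum_insert (by simp), Finset.sum_insert (by simp)] at e2
    linarith
  obtain ⟨j, hjk, hj⟩ := hj
  have hxjk := hanti hjk.le
  set δ := min (y j - x j) (x k - y k) with hδ
  have hδ0 : 0 < δ := lt_min (by linarith) (by linarith)
  have hδ1 : δ ≤ y j - x j := min_le_left _ _
  have hδ2 : δ ≤ x k - y k := min_le_right _ _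
  set z : Fin n → ℝ := fun i => if i = j then y j - δ else if i = k then y k + δ else y i with hzdef
  have hzj : z j = y j - δ := by simp [hzdef]
  have hzk : z k = y k + δ := by simp [hzdef, hjk.ne']
  have hz : ∀ i, i ≠ j → i ≠ k → z i = y i := by
    intro i h1 h2; simp [hzdef, h1, h2]
  have T := transfer n α hα hα1 hα2 y z hy j k hjk.ne δ hδ0 (by linarith) hzj hzk hz
  by_cases hxz : x = z
  · rw [hxz]; exact T
  refine lt_trans ?_ T
  have hzsum : ∑ i, z i = ∑ i, y i := by
    rw [sum_two n z j k hjk.ne, sum_two n y j k hjk.ne, hzj, hzk]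
    rw [Finset.sum_congr rfl (g := y)]
    · ring
    · intro i hi
      simp only [Finset.mem_erase] at hi
      exact hz i hi.2.1 hi.1
  have hzpos : ∀ i, 0 < z i := by
    intro i
    by_cases h1 : i = j
    · rw [h1, hzj]; linarith [(hx.1 j).1]
    by_cases h2 : i = k
    · rw [h2, hzk]; linarith [(hy.1 k).1]
    rw [hz i h1 h2]; exact (hy.1 i).1
  have hzA : memA n z := by
    refine ⟨fun i => ⟨hzpos i, ?_⟩, by rw [hzsum]; exact hy.2⟩
    calc z i ≤ ∑ i, z i := Finset.single_le_sum (fun i _ => (hzpos i).le) (Finset.mem_univ i)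
      _ < 1 := by rw [hzsum]; exact hy.2
  refine ih _ ?_ z hzA rfl (htot.trans hzsum.symm) ?_ hxz
  · rw [← hN]
    apply Finset.card_lt_card
    rw [Finset.ssubset_iff_of_subset]
    · rcases min_choice (y j - x j) (x k - y k) with h | h
      · refine ⟨j, by simpa using hj.ne, ?_⟩
        have : δ = y j - x j := h
        simp [hzj, this]
      · refine ⟨k, by simpa using hk.ne', ?_⟩
        have : δ = x k - y k := h
        simp [hzk, this]
    · intro i hi
      simp only [Finset.mem_filter, Finset.mem_univ, true_and] at hi ⊢
      by_cases h1 : i = j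
      · rw [h1]; exact hj.ne
      by_cases h2 : i = k
      · rw [h2]; exact hk.ne'
      rwa [hz i h1 h2] at hi
  · intro m
    by_cases hm : m ≤ k
    · apply Finset.sum_le_sum
      intro i hi
      have hik : i < k := (Finset.mem_Iio.1 hi).trans_le hm
      by_cases h1 : i = j
      · rw [h1, hzj]; linarith
      · rw [hz i h1 hik.ne]; exact hlt i hik
    · have hm' : k < m := not_le.1 hm
      refine (hpre m).trans (le_of_eq ?_)
      have hjm : j ∈ Finset.Iio m := Finset.mem_Iio.2 (hjk.trans hm')
      have hkm : k ∈ (Finset.Iio m).erase j :=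
        Finset.mem_erase.2 ⟨hjk.ne', Finset.mem_Iio.2 hm'⟩
      rw [← Finset.add_sum_erase _ _ hjm, ← Finset.add_sum_erase _ _ hkm,
        ← Finset.add_sum_erase _ z hjm, ← Finset.add_sum_erase _ z hkm, hzj, hzk]
      rw [Finset.sum_congr rfl (g := y) (f := z)]
      · ring
      · intro i hi
        simp only [Finset.mem_erase] at hi
        exact hz i hi.2.1 hi.1

lemma fna_perm (n : ℕ) (α : ℝ) (hα : 0 < α) (x : Fin n → ℝ) (σ : Equiv.Perm (Fin n)) :
    fna n α (x ∘ σ) = fna n α x := by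
  rw [fna_eq n α hα, fna_eq n α hα]
  unfold DD
  simp only [Finset.powerset_univ]
  conv_rhs => rw [← Equiv.sum_comp (Equiv.finsetCongr σ)]
  apply Finset.sum_congr rfl
  intro B _
  simp [Equiv.finsetCongr_apply]

lemma memA_perm (n : ℕ) (x : Fin n → ℝ) (σ : Equiv.Perm (Fin n)) (hx : memA n x) :
    memA n (x ∘ σ) := by
  refine ⟨fun i => hx.1 _, ?_⟩
  have := Equiv.sum_comp σ x
  simp only [Function.comp]
  rw [this]; exact hx.2

lemma antitone_sort (n : ℕ) (x : Fin n → ℝ) : ∃ σ : Equiv.Perm (Fin n), Antitone (x ∘ σ) := by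
  refine ⟨Tuple.sort (fun i => - x i), ?_⟩
  have := Tuple.monotone_sort (fun i => - x i)
  intro a b hab
  have := this hab
  simp only [Function.comp] at this ⊢
  linarith

lemma initial_sum_max (n : ℕ) (z : Fin n → ℝ) (hz : Antitone z) (m : Fin n) (T : Finset (Fin n))
    (hT : T.card = m) : ∑ i ∈ T, z i ≤ ∑ i ∈ Finset.Iio m, z i := by
  classical
  have hc : (T \ Finset.Iio m).card = (Finset.Iio m \ T).card := by
    apply Finset.card_sdiff_comm
    rw [hT, Fin.card_Iio]
  rw [← Finset.sum_inter_add_sum_sdiff T (Finset.Iio m),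
    ← Finset.sum_inter_add_sum_sdiff (Finset.Iio m) T, Finset.inter_comm]
  have h1 := Finset.sum_le_card_nsmul (T \ Finset.Iio m) z (z m) (by
    intro i hi
    simp at hi
    exact hz hi.2)
  have h2 := Finset.card_nsmul_le_sum (Finset.Iio m \ T) z (z m) (by
    intro i hi
    simp at hi
    exact hz hi.1.le)
  rw [hc] at h1
  linarith

theorem stmt7 (n : ℕ) (hn : 2 ≤ n) (α : ℝ) (hα1 : (n : ℝ) - 1 < α) (hα2 : α < n)
    (x y : Fin n → ℝ) (hx : memA n x) (hy : memA n y)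
    (hmaj : Majorized x y) (hperm : ¬ ∃ σ : Equiv.Perm (Fin n), y = x ∘ σ) :
    fna n α x < fna n α y := by
  have hα : 0 < α := by
    have : (2 : ℝ) ≤ n := by exact_mod_cast hn
    linarith
  obtain ⟨σ, hσ⟩ := antitone_sort n x
  obtain ⟨τ, hτ⟩ := antitone_sort n y
  rw [← fna_perm n α hα x σ, ← fna_perm n α hα y τ]
  refine chain n α hα hα1 hα2 _ (memA_perm n x σ hx) hσ _ _ (memA_perm n y τ hy) rfl ?_ ?_ ?_
  · simp only [Function.comp]
    rw [Equiv.sum_comp σ x, Equiv.sum_comp τ y]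
    exact hmaj.1
  · intro m
    obtain ⟨T, hT, hle⟩ := hmaj.2 ((Finset.Iio m).map σ.toEmbedding)
    rw [Finset.card_map, Fin.card_Iio] at hT
    have h1 := initial_sum_max n (y ∘ τ) hτ m (T.map τ.symm.toEmbedding) (by
      rw [Finset.card_map, hT])
    rw [Finset.sum_map] at h1 hle
    simp at h1 hle
    simpa using hle.trans h1
  · intro h
    apply hperm
    refine ⟨τ.symm.trans σ, ?_⟩
    funext i
    have := congrFun h (τ.symm i)
    simp at this
    simp [this]
end

section
/- Let n ≥ 2 and α ∈ (n−1, n). Consider f_{n,α} on the closed set Ā_n := { x ∈ ℝⁿ : x_i ≥ 0 for all i and Σ_{i=1}^n x_i ≤ 1 }. Then: (i) f_{n,α}(x) = 0 for every x ∈ Ā_n lying on the boundary of A_n, i.e., such that x_i = 0 for some i or Σ_{i=1}^n x_i = 1; and (ii) f_{n,α}(x) < 0 for every x with 0 < x_i < 1 for all i and Σ_{i=1}^n x_i < 1. -/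
/-- Iterated finite difference of `t ^ β` with steps `x i`, `i ∈ s`. -/
noncomputable def itDiff {n : ℕ} (x : Fin n → ℝ) (s : Finset (Fin n)) (β t : ℝ) : ℝ :=
  ∑ B ∈ s.powerset, (-1 : ℝ) ^ (s.card + B.card) * (t + ∑ i ∈ B, x i) ^ β

lemma itDiff_insert {n : ℕ} (x : Fin n → ℝ) (s : Finset (Fin n)) (a : Fin n) (ha : a ∉ s)
    (β t : ℝ) : itDiff x (insert a s) β t = itDiff x s β (t + x a) - itDiff x s β t := by
  unfold itDiff
  rw [Finset.sum_powerset_insert ha, sub_eq_add_neg, add_comm, ← Finset.sum_neg_distrib]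
  congr 1
  · refine Finset.sum_congr rfl fun B hB => ?_
    have haB : a ∉ B := fun h => ha (Finset.mem_powerset.1 hB h)
    rw [Finset.sum_insert haB, Finset.card_insert_of_notMem haB, Finset.card_insert_of_notMem ha,
      add_assoc t]
    congr 1
    ring
  · refine Finset.sum_congr rfl fun B hB => ?_
    rw [Finset.card_insert_of_notMem ha]
    ring

lemma itDiff_hasDerivAt {n : ℕ} (x : Fin n → ℝ) (hx : ∀ i, 0 < x i) (s : Finset (Fin n))
    (β t : ℝ) (ht : 0 < t) : HasDerivAt (itDiff x s β) (β * itDiff x s (β - 1) t) t := by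
  unfold itDiff
  rw [Finset.mul_sum]
  apply HasDerivAt.fun_sum
  intro B hB
  have hpos : 0 < t + ∑ i ∈ B, x i := by
    have := Finset.sum_nonneg (s := B) (fun i _ => (hx i).le)
    linarith
  have h1 : HasDerivAt (fun u : ℝ => u + ∑ i ∈ B, x i) 1 t := (hasDerivAt_id t).add_const _
  have h2 := (h1.rpow_const (p := β) (Or.inl hpos.ne')).const_mul ((-1 : ℝ) ^ (s.card + B.card))
  exact h2.congr_deriv (by ring)

lemma itDiff_continuous {n : ℕ} (x : Fin n → ℝ) (s : Finset (Fin n))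
    (β : ℝ) (hβ : 0 < β) : Continuous (itDiff x s β) := by
  unfold itDiff
  refine continuous_finsetSum _ fun B _ => ?_
  refine continuous_const.mul ?_
  exact (continuous_id.add continuous_const).rpow_const (fun _ => Or.inr hβ.le)

lemma itDiff_sign {n : ℕ} (x : Fin n → ℝ) (hx : ∀ i, 0 < x i) (s : Finset (Fin n)) :
    ∀ β t : ℝ, 0 < t → (∏ j ∈ Finset.range s.card, (β - j)) ≠ 0 →
      0 < (∏ j ∈ Finset.range s.card, (β - j)) * itDiff x s β t := by
  induction s using Finset.induction_on with
  | empty =>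
    intro β t ht _
    simp only [itDiff]
    simpa using Real.rpow_pos_of_pos ht β
  | insert a s ha ih =>
    intro β t ht hP
    have hprod : (∏ j ∈ Finset.range (insert a s).card, (β - j)) =
        (∏ j ∈ Finset.range s.card, ((β - 1) - j)) * β := by
      rw [Finset.card_insert_of_notMem ha, Finset.prod_range_succ']
      congr 1
      · refine Finset.prod_congr rfl fun j _ => ?_
        push_cast
        ring
      · simp
    rw [hprod] at hP ⊢
    have hP1 := left_ne_zero_of_mul hP
    have hβ := right_ne_zero_of_mul hP
    have hlt : t < t + x a := by linarith [hx a]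
    obtain ⟨c, hc, hce⟩ := exists_hasDerivAt_eq_slope (itDiff x s β)
      (fun u => β * itDiff x s (β - 1) u) hlt
      (fun u hu => (itDiff_hasDerivAt x hx s β u
        (lt_of_lt_of_le ht hu.1)).continuousAt.continuousWithinAt)
      (fun u hu => itDiff_hasDerivAt x hx s β u (ht.trans hu.1))
    have hI := ih (β - 1) c (ht.trans hc.1) hP1
    rw [itDiff_insert x s a ha]
    rw [add_sub_cancel_left, eq_div_iff (hx a).ne'] at hce
    rw [← hce]
    have : 0 < ((∏ j ∈ Finset.range s.card, ((β - 1) - j)) * itDiff x s (β - 1) c) *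
      (β ^ 2 * x a) := mul_pos hI (mul_pos (by positivity) (hx a))
    calc _ < _ := this
      _ = _ := by ring

lemma fna_eq_itDiff {n : ℕ} (α : ℝ) (hα : 0 < α) (x : Fin n → ℝ) :
    fna n α x = itDiff x Finset.univ α (1 - ∑ i, x i) - itDiff x Finset.univ α 0 := by
  have h1 : fna n α x = ∑ B : Finset (Fin n),
      ((-1 : ℝ) ^ (n + 1 - B.card) * (∑ i ∈ B, x i) ^ α +
      (-1 : ℝ) ^ B.card * (1 - ∑ i ∈ B, x i) ^ α) := by
    unfold fna
    rw [Finset.powerset_univ,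
      ← Finset.sum_filter_add_sum_filter_not Finset.univ (fun B : Finset (Fin n) => B.Nonempty),
      add_comm]
    congr 1
    have : Finset.univ.filter (fun B : Finset (Fin n) => ¬ B.Nonempty) = {∅} := by
      ext B
      simp [Finset.not_nonempty_iff_eq_empty]
    rw [this]
    simp [Real.zero_rpow hα.ne']
  rw [h1, Finset.sum_add_distrib, add_comm, sub_eq_add_neg]
  unfold itDiff
  rw [Finset.powerset_univ, ← Finset.sum_neg_distrib]
  congr 1
  · rw [← Equiv.sum_comp (Function.Involutive.toPerm (compl : Finset (Fin n) → Finset (Fin n))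
      compl_involutive)]
    refine Finset.sum_congr rfl fun B _ => ?_
    have hs := Finset.sum_add_sum_compl B x
    have hc := Finset.card_add_card_compl B
    simp only [Function.Involutive.coe_toPerm]
    have e1 : 1 - ∑ i ∈ Bᶜ, x i = 1 - ∑ i, x i + ∑ i ∈ B, x i := by linarith
    rw [e1]
    congr 1
    have : (Finset.univ : Finset (Fin n)).card + B.card = Bᶜ.card + 2 * B.card := by
      rw [Finset.card_univ]; omega
    rw [this, pow_add, pow_mul]
    simp
  · refine Finset.sum_congr rfl fun B _ => ?_
    have hc := Finset.card_le_univ B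
    rw [Fintype.card_fin] at hc
    have : (Finset.univ : Finset (Fin n)).card + B.card + 1 = (n + 1 - B.card) + 2 * B.card := by
      rw [Finset.card_univ, Fintype.card_fin]; omega
    have h2 : (-1 : ℝ) ^ ((Finset.univ : Finset (Fin n)).card + B.card + 1)
        = (-1 : ℝ) ^ (n + 1 - B.card) := by
      rw [this, pow_add _ _ (2 * B.card), pow_mul]
      simp
    rw [← h2, zero_add, pow_succ]
    ring

/-- For `n ≥ 2` and `α ∈ (n−1, n)`: `f_{n,α}` vanishes on the boundary of the simplex
`A_n` (inside the closed simplex), and is strictly negative on the open simplex `A_n`. -/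
theorem stmt8 (n : ℕ) (hn : 2 ≤ n) (α : ℝ) (hα1 : (n : ℝ) - 1 < α) (hα2 : α < n) :
    (∀ x : Fin n → ℝ, (∀ i, 0 ≤ x i) → (∑ i, x i) ≤ 1 →
      ((∃ i, x i = 0) ∨ (∑ i, x i) = 1) → fna n α x = 0) ∧
    (∀ x : Fin n → ℝ, (∀ i, 0 < x i ∧ x i < 1) → (∑ i, x i) < 1 →
      fna n α x < 0) := by
  have hn' : (2 : ℝ) ≤ n := by exact_mod_cast hn
  have hα : 0 < α := by linarith
  refine ⟨fun x hx hs hb => ?_, fun x hx hs => ?_⟩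
  · rw [fna_eq_itDiff α hα]
    rcases hb with ⟨i, hi⟩ | h
    · have key : ∀ t, itDiff x Finset.univ α t = 0 := by
        intro t
        rw [← Finset.insert_erase (Finset.mem_univ i),
          itDiff_insert x _ i (Finset.notMem_erase i _), hi, add_zero, sub_self]
      rw [key, key, sub_self]
    · rw [h, sub_self, sub_self]
  · rw [fna_eq_itDiff α hα]
    have hx' : ∀ i, 0 < x i := fun i => (hx i).1
    have h0 : 0 < 1 - ∑ i, x i := by linarith
    obtain ⟨c, hc, hce⟩ := exists_hasDerivAt_eq_slope (itDiff x Finset.univ α)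
      (fun u => α * itDiff x Finset.univ (α - 1) u) h0
      (itDiff_continuous x _ α hα).continuousOn
      (fun u hu => itDiff_hasDerivAt x hx' _ α u hu.1)
    rw [sub_zero, eq_div_iff h0.ne'] at hce
    rw [← hce]
    have hP : (∏ j ∈ Finset.range (Finset.univ : Finset (Fin n)).card, ((α - 1) - j)) < 0 := by
      rw [Finset.card_univ, Fintype.card_fin]
      obtain ⟨m, rfl⟩ : ∃ m, n = m + 1 := ⟨n - 1, by omega⟩
      push_cast at hα1 hα2
      rw [Finset.prod_range_succ]
      refine mul_neg_of_pos_of_neg (Finset.prod_pos fun j hj => ?_) (by linarith)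
      have : (j : ℝ) + 1 ≤ m := by exact_mod_cast Finset.mem_range.1 hj
      linarith
    have hS := itDiff_sign x hx' Finset.univ (α - 1) c hc.1 hP.ne
    have hneg : itDiff x Finset.univ (α - 1) c < 0 := by
      by_contra hcon
      push Not at hcon
      exact absurd hS (not_lt.2 (mul_nonpos_of_nonpos_of_nonneg hP.le hcon))
    exact mul_neg_of_neg_of_pos (mul_neg_of_pos_of_neg hα hneg) h0
end

section
/- Fix n ≥ 1 and positive real numbers p₁, …, pₙ. Define q(α) := Σ_{A ⊆ {1,…,n}} (−1)^{n−|A|} (Σ_{i∈A} p_i)^α for α > 0 (the empty sum is 0 and 0^α = 0 for α > 0). Then q(j) = 0 for every integer j with 1 ≤ j ≤ n−1, and q(α) ≥ 0 for every real α > n−1. -/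
/-- Iterated finite difference of `f` over the steps `p i`, `i ∈ s`. -/
noncomputable def iterDiff {ι : Type} [DecidableEq ι] (p : ι → ℝ) (s : Finset ι) (f : ℝ → ℝ)
    (x : ℝ) : ℝ :=
  ∑ A ∈ s.powerset, (-1 : ℝ) ^ (s.card - A.card) * f (x + ∑ i ∈ A, p i)

lemma iterDiff_insert {ι : Type} [DecidableEq ι] (p : ι → ℝ) (s : Finset ι) (f : ℝ → ℝ)
    (x : ℝ) (a : ι) (ha : a ∉ s) :
    iterDiff p (insert a s) f x = iterDiff p s f (x + p a) - iterDiff p s f x := by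
  unfold iterDiff
  rw [Finset.sum_powerset_insert ha, add_comm, sub_eq_add_neg, ← Finset.sum_neg_distrib]
  congr 1
  · refine Finset.sum_congr rfl fun A hA => ?_
    have haA : a ∉ A := fun h => ha (Finset.mem_powerset.1 hA h)
    rw [Finset.card_insert_of_notMem ha, Finset.card_insert_of_notMem haA,
      Finset.sum_insert haA, Nat.add_sub_add_right, add_assoc]
  · refine Finset.sum_congr rfl fun A hA => ?_
    have hc := Finset.card_le_card (Finset.mem_powerset.1 hA)
    rw [Finset.card_insert_of_notMem ha, Nat.sub_add_comm hc, pow_succ]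
    ring

lemma iterDiff_hasDerivAt {ι : Type} [DecidableEq ι] (p : ι → ℝ) (s : Finset ι) (f g : ℝ → ℝ)
    (c x : ℝ) (h : ∀ A ⊆ s, HasDerivAt f (c * g (x + ∑ i ∈ A, p i)) (x + ∑ i ∈ A, p i)) :
    HasDerivAt (iterDiff p s f) (c * iterDiff p s g x) x := by
  unfold iterDiff
  rw [Finset.mul_sum]
  refine HasDerivAt.fun_sum fun A hA => ?_
  have h1 := ((h A (Finset.mem_powerset.1 hA)).comp_add_const x _).const_mul
    ((-1 : ℝ) ^ (s.card - A.card))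
  rw [mul_left_comm]
  exact h1

lemma iterDiff_pow {ι : Type} [DecidableEq ι] (p : ι → ℝ) (s : Finset ι) :
    ∀ j : ℕ, j < s.card → ∀ x : ℝ, iterDiff p s (fun y => y ^ j) x = 0 := by
  induction s using Finset.induction_on with
  | empty => intro j hj; simp at hj
  | insert a s ha ih =>
    intro j hj x
    rw [Finset.card_insert_of_notMem ha] at hj
    rw [iterDiff_insert _ _ _ _ _ ha, sub_eq_zero]
    rcases j with _ | k
    · simp [iterDiff]
    · have hd : ∀ y, HasDerivAt (iterDiff p s (fun y => y ^ (k + 1))) 0 y := by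
        intro y
        have := iterDiff_hasDerivAt p s (fun y => y ^ (k + 1)) (fun y => y ^ k) ((k + 1 : ℕ) : ℝ) y
          (fun A _ => by simpa using hasDerivAt_pow (k + 1) (y + ∑ i ∈ A, p i))
        rwa [ih k (by omega), mul_zero] at this
      exact is_const_of_deriv_eq_zero (fun y => (hd y).differentiableAt) (fun y => (hd y).deriv) _ _

lemma iterDiff_rpow {ι : Type} [DecidableEq ι] (p : ι → ℝ) (hp : ∀ i, 0 < p i) (s : Finset ι) :
    ∀ α : ℝ, (s.card : ℝ) - 1 < α → ∀ x : ℝ, 0 ≤ x →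
      0 ≤ iterDiff p s (fun y => y ^ α) x := by
  induction s using Finset.induction_on with
  | empty => intro α _ x hx; simpa [iterDiff] using Real.rpow_nonneg hx α
  | insert a s ha ih =>
    intro α hα x hx
    rw [Finset.card_insert_of_notMem ha] at hα
    push_cast at hα
    have hα' : (s.card : ℝ) < α := by linarith
    have hα0 : 0 < α := lt_of_le_of_lt (Nat.cast_nonneg _) hα'
    rw [iterDiff_insert _ _ _ _ _ ha, sub_nonneg]
    have hd : ∀ y, 0 < y → HasDerivAt (iterDiff p s (fun y => y ^ α))
        (α * iterDiff p s (fun y => y ^ (α - 1)) y) y := by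
      intro y hy
      refine iterDiff_hasDerivAt p s _ (fun y => y ^ (α - 1)) α y fun A _ => ?_
      have : 0 ≤ ∑ i ∈ A, p i := Finset.sum_nonneg fun i _ => (hp i).le
      exact Real.hasDerivAt_rpow_const (Or.inl (by positivity))
    have hm : MonotoneOn (iterDiff p s (fun y => y ^ α)) (Set.Ici 0) := by
      refine monotoneOn_of_deriv_nonneg (convex_Ici 0) ?_ ?_ ?_
      · refine Continuous.continuousOn ?_
        unfold iterDiff
        refine continuous_finsetSum _ fun A _ => continuous_const.mul ?_
        exact (continuous_id.add continuous_const).rpow_const fun _ => Or.inr hα0.le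
      · intro y hy
        rw [interior_Ici] at hy
        exact (hd y hy).differentiableAt.differentiableWithinAt
      · intro y hy
        rw [interior_Ici] at hy
        rw [(hd y hy).deriv]
        exact mul_nonneg hα0.le (ih _ (by linarith) y (le_of_lt hy))
    have := (hp a).le
    exact hm hx (by simpa using add_nonneg hx this) (by linarith)

/-- For positive reals `p₁,…,pₙ`, the function
`q(α) = Σ_{A ⊆ [n]} (−1)^{n−|A|} (Σ_{i∈A} p_i)^α` vanishes at every integer
`1 ≤ j ≤ n−1` and is nonnegative for every real `α > n−1`. -/
theorem stmt9 (n : ℕ) (hn : 1 ≤ n) (p : Fin n → ℝ) (hp : ∀ i, 0 < p i) :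
    (∀ j : ℕ, 1 ≤ j → j ≤ n - 1 →
      (∑ A : Finset (Fin n), (-1 : ℝ) ^ (n - A.card) * (∑ i ∈ A, p i) ^ (j : ℝ)) = 0) ∧
    (∀ α : ℝ, (n : ℝ) - 1 < α →
      0 ≤ ∑ A : Finset (Fin n), (-1 : ℝ) ^ (n - A.card) * (∑ i ∈ A, p i) ^ α) := by
  constructor
  · intro j _ hj
    have := iterDiff_pow p Finset.univ j (by simp; omega) 0
    simpa [iterDiff] using this
  · intro α hα
    have := iterDiff_rpow p hp Finset.univ α (by simpa using hα) 0 le_rfl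
    simpa [iterDiff] using this
end

section
/- Fix n ≥ 1 and p₁, …, pₙ ∈ (0,1) with Σ_{i=1}^n p_i = 1. Define V on the Boolean lattice of subsets of {1,…,n} by V(A) := 1 − Σ_{i∈A} p_i. Then for real α ≥ 0, the pointwise power V^α is completely monotone if and only if α ∈ {0, 1, …, n−2} or α ≥ n−1. -/
/-- Alternating sum of shifted powers. -/
noncomputable def altPow {ι : Type*} (p : ι → ℝ) (S : Finset ι) (β x : ℝ) : ℝ :=
  ∑ J ∈ S.powerset, (-1 : ℝ) ^ J.card * (x + ∑ i ∈ J, p i) ^ β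

lemma altPow_insert {ι : Type*} [DecidableEq ι] (p : ι → ℝ) (S : Finset ι) (a : ι) (ha : a ∉ S)
    (β x : ℝ) : altPow p (insert a S) β x = altPow p S β x - altPow p S β (x + p a) := by
  unfold altPow
  rw [Finset.sum_powerset_insert ha, sub_eq_add_neg, ← Finset.sum_neg_distrib]
  congr 1
  apply Finset.sum_congr rfl
  intro J hJ
  have haJ : a ∉ J := fun h => ha (Finset.mem_powerset.1 hJ h)
  rw [Finset.card_insert_of_notMem haJ, Finset.sum_insert haJ, pow_succ, add_assoc]
  ring

lemma altPow_hasDerivAt {ι : Type*} (p : ι → ℝ) (hp : ∀ i, 0 < p i) (S : Finset ι)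
    (β x : ℝ) (hx : 0 < x) : HasDerivAt (altPow p S β) (β * altPow p S (β - 1) x) x := by
  unfold altPow
  rw [Finset.mul_sum]
  apply HasDerivAt.fun_sum
  intro J _
  have h0 : 0 ≤ ∑ i ∈ J, p i := Finset.sum_nonneg fun i _ => (hp i).le
  have h1 : x + ∑ i ∈ J, p i ≠ 0 := by positivity
  have hd : HasDerivAt (fun y : ℝ => y + ∑ i ∈ J, p i) 1 x :=
    (hasDerivAt_id' x).add_const (∑ i ∈ J, p i)
  have := (hd.rpow_const (p := β)
    (Or.inl h1)).const_mul ((-1 : ℝ) ^ J.card)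
  exact this.congr_deriv (by ring)

lemma altPow_continuous {ι : Type*} (p : ι → ℝ) (S : Finset ι)
    (β : ℝ) (hβ : 0 ≤ β) : Continuous (altPow p S β) := by
  unfold altPow
  apply continuous_finsetSum
  intro J _
  exact continuous_const.mul ((Real.continuous_rpow_const hβ).comp
    (continuous_id.add continuous_const))

lemma altPow_step {ι : Type*} [DecidableEq ι] (p : ι → ℝ) (hp : ∀ i, 0 < p i) (S : Finset ι)
    (ih : ∀ β x : ℝ, 0 < x → ∃ c : ℝ, 0 < c ∧
      altPow p S β x = c * ∏ i ∈ Finset.range S.card, ((i : ℝ) - β))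
    (a : ι) (ha : a ∉ S) (β x : ℝ) (hx : 0 ≤ x)
    (hc : ContinuousOn (altPow p S β) (Set.Icc x (x + p a))) :
    ∃ c : ℝ, 0 < c ∧ altPow p (insert a S) β x =
      c * ∏ i ∈ Finset.range (insert a S).card, ((i : ℝ) - β) := by
  have hlt : x < x + p a := by linarith [hp a]
  obtain ⟨ξ, hξ, h⟩ := exists_hasDerivAt_eq_slope (altPow p S β)
    (fun x => β * altPow p S (β - 1) x) hlt hc
    (fun y hy => altPow_hasDerivAt p hp S β y (lt_of_le_of_lt hx hy.1))
  obtain ⟨c, hc0, hc1⟩ := ih (β - 1) ξ (lt_of_le_of_lt hx hξ.1)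
  refine ⟨c * p a, mul_pos hc0 (hp a), ?_⟩
  rw [altPow_insert p S a ha, Finset.card_insert_of_notMem ha, Finset.prod_range_succ']
  have hpa := (hp a).ne'
  simp only [add_sub_cancel_left] at h
  rw [hc1, eq_div_iff hpa] at h
  have e : ∏ i ∈ Finset.range S.card, (((i + 1 : ℕ) : ℝ) - β)
      = ∏ i ∈ Finset.range S.card, ((i : ℝ) - (β - 1)) := by
    apply Finset.prod_congr rfl
    intro i _
    push_cast
    ring
  rw [e]
  push_cast
  linarith

lemma altPow_pos {ι : Type*} [DecidableEq ι] (p : ι → ℝ) (hp : ∀ i, 0 < p i) (S : Finset ι) :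
    ∀ β x : ℝ, 0 < x → ∃ c : ℝ, 0 < c ∧
      altPow p S β x = c * ∏ i ∈ Finset.range S.card, ((i : ℝ) - β) := by
  induction S using Finset.induction_on with
  | empty =>
    intro β x hx
    exact ⟨x ^ β, Real.rpow_pos_of_pos hx β, by simp [altPow]⟩
  | insert a S ha ih =>
    intro β x hx
    refine altPow_step p hp S ih a ha β x hx.le ?_
    intro y hy
    exact (altPow_hasDerivAt p hp S β y (lt_of_lt_of_le hx hy.1)).continuousAt.continuousWithinAt

lemma altPow_zero {ι : Type*} [DecidableEq ι] (p : ι → ℝ) (hp : ∀ i, 0 < p i) (S : Finset ι)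
    (hS : S.Nonempty) (β : ℝ) (hβ : 0 ≤ β) : ∃ c : ℝ, 0 < c ∧
      altPow p S β 0 = c * ∏ i ∈ Finset.range S.card, ((i : ℝ) - β) := by
  obtain ⟨a, ha⟩ := hS
  rw [← Finset.insert_erase ha]
  exact altPow_step p hp _ (altPow_pos p hp _) a (Finset.notMem_erase a S) β 0 le_rfl
    (altPow_continuous p _ β hβ).continuousOn

lemma neg_pow_prod (k : ℕ) (β : ℝ) :
    (-1 : ℝ) ^ k * ∏ i ∈ Finset.range k, ((i : ℝ) - β) = ∏ i ∈ Finset.range k, (β - (i : ℝ)) := by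
  induction k with
  | zero => simp
  | succ k ih =>
    rw [Finset.prod_range_succ, Finset.prod_range_succ, ← ih, pow_succ]
    ring

/-- Moebius transform. -/
noncomputable def moeb {ι : Type*} (g : Finset ι → ℝ) (B : Finset ι) : ℝ :=
  ∑ J ∈ B.powerset, (-1 : ℝ) ^ (B.card + J.card) * g J

lemma moeb_insert {ι : Type*} [DecidableEq ι] (g : Finset ι → ℝ) (B : Finset ι) (a : ι)
    (ha : a ∉ B) : moeb g (insert a B) = moeb (fun J => g (insert a J)) B - moeb g B := by
  unfold moeb
  rw [Finset.sum_powerset_insert ha, sub_eq_add_neg, ← Finset.sum_neg_distrib, add_comm]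
  congr 1
  · apply Finset.sum_congr rfl
    intro J hJ
    have haJ : a ∉ J := fun h => ha (Finset.mem_powerset.1 hJ h)
    rw [Finset.card_insert_of_notMem haJ, Finset.card_insert_of_notMem ha]
    ring
  · apply Finset.sum_congr rfl
    intro J hJ
    rw [Finset.card_insert_of_notMem ha]
    ring

lemma sum_moeb {ι : Type*} [DecidableEq ι] (C : Finset ι) : ∀ g : Finset ι → ℝ,
    ∑ B ∈ C.powerset, moeb g B = g C := by
  induction C using Finset.induction_on with
  | empty => intro g; simp [moeb]
  | insert a C ha ih =>
    intro g
    rw [Finset.sum_powerset_insert ha]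
    have : ∑ B ∈ C.powerset, moeb g (insert a B)
        = ∑ B ∈ C.powerset, (moeb (fun J => g (insert a J)) B - moeb g B) := by
      apply Finset.sum_congr rfl
      intro B hB
      exact moeb_insert g B a (fun h => ha (Finset.mem_powerset.1 hB h))
    rw [this, Finset.sum_sub_distrib, ih, ih]
    ring

lemma fold_disjoint {ι κ : Type*} [DecidableEq ι] [DecidableEq κ] (J : Finset κ)
    (x B : Finset ι) (y : κ → Finset ι) :
    Disjoint (J.fold (fun a b : Finset ι => a ⊔ b) x y) B ↔ Disjoint x B ∧ ∀ i ∈ J, Disjoint (y i) B := by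
  induction J using Finset.induction_on with
  | empty => simp
  | insert a J ha ih =>
    rw [Finset.fold_insert ha, disjoint_sup_left, ih, Finset.forall_mem_insert]
    tauto

lemma isCM_of_moeb {n : ℕ} (g : Finset (Fin n) → ℝ) (hg : ∀ B, 0 ≤ moeb g B) :
    IsCM (fun A : Finset (Fin n) => g Aᶜ) := by
  have key : ∀ A : Finset (Fin n), g Aᶜ = ∑ B, if Disjoint A B then moeb g B else 0 := by
    intro A
    rw [← sum_moeb Aᶜ g, ← Finset.sum_filter]
    apply Finset.sum_congr _ (fun _ _ => rfl)
    ext B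
    simp [Finset.subset_compl_comm, ← Finset.subset_compl_iff_disjoint_right]
  constructor
  · intro A
    show 0 ≤ g Aᶜ
    rw [key]
    apply Finset.sum_nonneg
    intro B _
    split_ifs
    · exact hg B
    · exact le_rfl
  · intro k x y
    simp only [key, Finset.mul_sum]
    rw [Finset.sum_comm]
    apply Finset.sum_nonneg
    intro B _
    simp only [fold_disjoint]
    have : ∀ J : Finset (Fin (k+1)), (-1 : ℝ) ^ J.card *
        (if Disjoint x B ∧ ∀ i ∈ J, Disjoint (y i) B then moeb g B else 0)
        = (if Disjoint x B then moeb g B else 0) *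
          ((∏ i ∈ J, (-(if Disjoint (y i) B then (1:ℝ) else 0))) * ∏ i ∈ Finset.univ \ J, (1:ℝ)) := by
      intro J
      rw [Finset.prod_neg, Finset.prod_const_one, mul_one, Finset.prod_ite_zero]
      by_cases h1 : Disjoint x B <;> by_cases h2 : ∀ i ∈ J, Disjoint (y i) B <;>
        simp [h1, h2, mul_comm]
    rw [Finset.sum_congr rfl fun J _ => this J, ← Finset.mul_sum, ← Finset.powerset_univ,
      ← Finset.prod_add]
    apply mul_nonneg
    · split_ifs
      · exact hg B
      · exact le_rfl
    · apply Finset.prod_nonneg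
      intro i _
      split_ifs <;> norm_num

lemma moeb_pow {ι : Type*} (p : ι → ℝ) (B : Finset ι) (α : ℝ) :
    moeb (fun J => (∑ i ∈ J, p i) ^ α) B = (-1 : ℝ) ^ B.card * altPow p B α 0 := by
  unfold moeb altPow
  rw [Finset.mul_sum]
  apply Finset.sum_congr rfl
  intro J _
  rw [pow_add, zero_add, mul_assoc]

lemma fold_sum {n m : ℕ} (e : Fin m ↪ Fin n) (p : Fin n → ℝ) (hsum : ∑ i, p i = 1)
    (J : Finset (Fin m)) :
    1 - ∑ i ∈ J.fold (· ⊔ ·) ((Finset.univ.map e)ᶜ) (fun i => {e i}), p i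
      = ∑ i ∈ Jᶜ, p (e i) := by
  have h : J.fold (· ⊔ ·) ((Finset.univ.map e)ᶜ) (fun i => {e i}) = (Jᶜ.map e)ᶜ := by
    induction J using Finset.induction_on with
    | empty => simp
    | insert a J ha ih =>
      rw [Finset.fold_insert ha, ih]
      ext j
      simp only [Finset.sup_eq_union, Finset.mem_union, Finset.mem_singleton, Finset.mem_compl,
        Finset.mem_map, Finset.mem_insert, not_exists, not_and, not_or]
      constructor
      · rintro (h | h) b hb hbj
        · subst h
          exact hb.1 (e.injective hbj)
        · exact h b hb.2 hbj
      · intro h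
        by_cases hj : j = e a
        · exact Or.inl hj
        · refine Or.inr fun b hb hbj => h b ⟨?_, hb⟩ hbj
          rintro rfl
          exact hj hbj.symm
  rw [h, ← hsum, ← Finset.sum_compl_add_sum (Jᶜ.map e), add_sub_cancel_left, Finset.sum_map]

/-- Let `p₁,…,pₙ ∈ (0,1)` sum to `1` and let `V A = 1 − Σ_{i∈A} p_i` be the void
functional of the corresponding random singleton. For `α ≥ 0`, the pointwise power `V^α`
is completely monotone if and only if `α ∈ {0,1,…,n−2}` or `α ≥ n − 1`. -/
theorem stmt10 (n : ℕ) (hn : 1 ≤ n) (p : Fin n → ℝ)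
    (hp : ∀ i, 0 < p i ∧ p i < 1) (hsum : ∑ i, p i = 1) (α : ℝ) (hα : 0 ≤ α) :
    IsCM (fun A : Finset (Fin n) => (1 - ∑ i ∈ A, p i) ^ α) ↔
      ((∃ j : ℕ, (j : ℝ) ≤ (n : ℝ) - 2 ∧ α = j) ∨ (n : ℝ) - 1 ≤ α) := by
  classical
  have hp0 : ∀ i, 0 < p i := fun i => (hp i).1
  constructor
  · intro hcm
    by_contra hcon
    rw [not_or] at hcon
    obtain ⟨h1, h2⟩ := hcon
    rw [not_le] at h2
    have hnat : ∀ j : ℕ, α ≠ j := by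
      intro j hj
      apply h1
      refine ⟨j, ?_, hj⟩
      rw [hj] at h2
      have : j + 1 < n := by
        have : ((j + 1 : ℕ) : ℝ) < n := by push_cast; linarith
        exact_mod_cast this
      have : ((j + 2 : ℕ) : ℝ) ≤ n := by exact_mod_cast this
      push_cast at this
      linarith
    obtain ⟨N, hN⟩ : ∃ N, N = ⌊α⌋₊ := ⟨_, rfl⟩
    have hN1 : (N : ℝ) < α := lt_of_le_of_ne (hN ▸ Nat.floor_le hα) (hnat N).symm
    have hN2 : α < N + 1 := hN ▸ Nat.lt_floor_add_one α
    have hNn : N + 1 + 1 ≤ n := by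
      have : ((N + 1 : ℕ) : ℝ) < n := by push_cast; linarith
      have : N + 1 < n := by exact_mod_cast this
      omega
    have h := hcm.2 (N + 1) ((Finset.univ.map (Fin.castLEEmb hNn))ᶜ)
      (fun i => {Fin.castLEEmb hNn i})
    simp only [fold_sum _ p hsum] at h
    have hcompl : ∑ J : Finset (Fin (N + 1 + 1)),
        (-1 : ℝ) ^ J.card * (∑ i ∈ Jᶜ, p (Fin.castLEEmb hNn i)) ^ α
        = moeb (fun J => (∑ i ∈ J, p (Fin.castLEEmb hNn i)) ^ α) Finset.univ := by
      unfold moeb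
      rw [Finset.powerset_univ]
      apply Fintype.sum_equiv (Equiv.ofBijective _ (compl_bijective (α := Finset (Fin (N+1+1)))))
      intro J
      simp only [Equiv.ofBijective_apply]
      congr 1
      have hc := Finset.card_add_card_compl J
      have hu : (Finset.univ : Finset (Fin (N + 1 + 1))).card = J.card + Jᶜ.card := by
        rw [hc, Finset.card_univ]
      rw [hu, add_assoc J.card, ← two_mul, pow_add, pow_mul]
      simp
    rw [hcompl, moeb_pow] at h
    obtain ⟨c, hc, hc1⟩ := altPow_zero (fun i => p (Fin.castLEEmb hNn i)) (fun i => hp0 _)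
      Finset.univ Finset.univ_nonempty α hα
    rw [hc1, mul_left_comm, neg_pow_prod, Finset.card_univ, Fintype.card_fin,
      Finset.prod_range_succ] at h
    have hpos : 0 < ∏ i ∈ Finset.range (N + 1), (α - (i : ℝ)) := by
      apply Finset.prod_pos
      intro i hi
      have : (i : ℝ) ≤ N := by exact_mod_cast Nat.lt_succ_iff.1 (Finset.mem_range.1 hi)
      linarith
    have hneg : α - ((N + 1 : ℕ) : ℝ) < 0 := by push_cast; linarith
    have := mul_neg_of_pos_of_neg hc (mul_neg_of_pos_of_neg hpos hneg)
    linarith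
  · intro hor
    have hV : (fun A : Finset (Fin n) => (1 - ∑ i ∈ A, p i) ^ α)
        = fun A => (fun J : Finset (Fin n) => (∑ i ∈ J, p i) ^ α) Aᶜ := by
      funext A
      have := Finset.sum_compl_add_sum A p
      show _ = (∑ i ∈ Aᶜ, p i) ^ α
      congr 1
      linarith
    rw [hV]
    refine isCM_of_moeb (fun J : Finset (Fin n) => (∑ i ∈ J, p i) ^ α) ?_
    intro B
    rcases B.eq_empty_or_nonempty with rfl | hB
    · simp [moeb, Real.rpow_nonneg]
    rw [moeb_pow]
    obtain ⟨c, hc, hc1⟩ := altPow_zero p hp0 B hB α hα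
    rw [hc1, mul_left_comm, neg_pow_prod]
    apply mul_nonneg hc.le
    have hcard : B.card ≤ n := by simpa using Finset.card_le_univ B
    rcases hor with ⟨j, -, rfl⟩ | hge
    · by_cases hj : j < B.card
      · rw [Finset.prod_eq_zero (Finset.mem_range.2 hj) (sub_self _)]
      · apply Finset.prod_nonneg
        intro i hi
        have : i ≤ j := by have := Finset.mem_range.1 hi; omega
        have : (i : ℝ) ≤ j := by exact_mod_cast this
        linarith
    · apply Finset.prod_nonneg
      intro i hi
      have : i + 1 ≤ n := by have := Finset.mem_range.1 hi; omega
      have : ((i + 1 : ℕ) : ℝ) ≤ n := by exact_mod_cast this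
      push_cast at this
      linarith
end

section
/- Fix n ≥ 4 and an integer k with 2 ≤ k ≤ n−2. Then there exist δ > 0 and a function Q from subsets of {1,…,n} to ℝ with Q(A) ≥ 0 for all A, Σ_{A ⊆ {1,…,n}} Q(A) = 1, and Q(A) = Q(B) whenever |A| = |B|, such that, writing F(A) := Σ_{C ⊆ A} Q(C) and r_B(α) := Σ_{A ⊆ B} (−1)^{|B|−|A|} F(A)^α for B ⊆ {1,…,n} and α > 0, the following hold: (1) Q(A) = 0 if and only if A = ∅ or 1 < |A| ≤ n−k+1; (2) for every non-integer real α with 0 < α ≤ n−k−1 there exists B ⊆ {1,…,n} with r_B(α) < 0; (3) for every integer j with n−k ≤ j ≤ n−2 and every α ∈ [j, j+δ), r_B(α) ≥ 0 for all B ⊆ {1,…,n}; (4) for every integer j with n−k ≤ j ≤ n−2 there exist α ∈ (j, j+1) and B ⊆ {1,…,n} with r_B(α) < 0; (5) for every B ⊆ {1,…,n} with |B| ≥ n−k+2, every integer j with 1 ≤ j ≤ n−2, and every α ∈ (j−δ, j+δ) with α > 0, r_B(α) > 0. -/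
/-- `F Q A = Σ_{C ⊆ A} Q C`, i.e. `P(X ⊆ A)` for a random set `X` with distribution `Q`. -/
def F {n : ℕ} (Q : Finset (Fin n) → ℝ) (A : Finset (Fin n)) : ℝ :=
  ∑ C ∈ A.powerset, Q C

/-- `r Q B α = Σ_{A ⊆ B} (−1)^{|B|−|A|} (F Q A)^α`; nonnegativity of all these quantities is
equivalent to the existence of the random set with void functional `P(X ⊆ ·)^α`. -/
noncomputable def r {n : ℕ} (Q : Finset (Fin n) → ℝ) (B : Finset (Fin n)) (α : ℝ) : ℝ :=
  ∑ A ∈ B.powerset, (-1 : ℝ) ^ (B.card - A.card) * (F Q A) ^ α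


open Finset Filter Topology fwdDiff

theorem h_hasDeriv (m : ℕ) : ∀ (β x : ℝ), 0 < x →
    HasDerivAt ((fwdDiff (1:ℝ))^[m] (fun y : ℝ => y ^ β))
      (β * ((fwdDiff (1:ℝ))^[m] (fun y : ℝ => y ^ (β - 1))) x) x := by
  induction m with
  | zero =>
    intro β x hx
    simpa using Real.hasDerivAt_rpow_const (x := x) (p := β) (Or.inl hx.ne')
  | succ m ih =>
    intro β x hx
    rw [Function.iterate_succ_apply', Function.iterate_succ_apply']
    have h1 := (ih β (x + 1) (by linarith)).comp_add_const x 1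
    have h2 := ih β x hx
    have h3 := h1.sub h2
    refine h3.congr_deriv ?_
    rw [fwdDiff]
    ring

theorem h_cont (m : ℕ) (β : ℝ) (hβ : 0 < β) :
    Continuous ((fwdDiff (1:ℝ))^[m] (fun y : ℝ => y ^ β)) := by
  induction m with
  | zero => simpa using Real.continuous_rpow_const hβ.le
  | succ m ih =>
    rw [Function.iterate_succ_apply']
    exact (ih.comp (continuous_id.add continuous_const)).sub ih

theorem h_pos_form (m : ℕ) : ∀ (β x : ℝ), 0 < x → ∃ c : ℝ, 0 < c ∧
    ((fwdDiff (1:ℝ))^[m] (fun y : ℝ => y ^ β)) x = (∏ i ∈ range m, (β - i)) * c := by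
  induction m with
  | zero =>
    intro β x hx
    exact ⟨x ^ β, Real.rpow_pos_of_pos hx _, by simp⟩
  | succ m ih =>
    intro β x hx
    obtain ⟨ξ, hξ, h⟩ := exists_hasDerivAt_eq_slope ((fwdDiff (1:ℝ))^[m] (fun y : ℝ => y ^ β))
      (fun x => β * ((fwdDiff (1:ℝ))^[m] (fun y : ℝ => y ^ (β - 1))) x) (show x < x + 1 by linarith)
      (fun y hy => (h_hasDeriv m β y (by linarith [hy.1])).continuousAt.continuousWithinAt)
      (fun y hy => h_hasDeriv m β y (by linarith [hy.1]))
    obtain ⟨c, hc, h2⟩ := ih (β - 1) ξ (by linarith [hξ.1])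
    refine ⟨c, hc, ?_⟩
    rw [Function.iterate_succ_apply', fwdDiff]
    have h3 : x + 1 - x = 1 := by ring
    rw [h3, div_one] at h
    rw [← h, h2, prod_range_succ']
    have : ∀ i : ℕ, β - 1 - (i:ℝ) = β - ((i + 1 : ℕ) : ℝ) := by intro i; push_cast; ring
    simp only [this]
    push_cast
    ring

theorem h_zero_form (m : ℕ) (β : ℝ) (hβ : 0 < β) : ∃ c : ℝ, 0 < c ∧
    ((fwdDiff (1:ℝ))^[m+1] (fun y : ℝ => y ^ β)) 0 = (∏ i ∈ range (m+1), (β - i)) * c := by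
  obtain ⟨ξ, hξ, h⟩ := exists_hasDerivAt_eq_slope ((fwdDiff (1:ℝ))^[m] (fun y : ℝ => y ^ β))
    (fun x => β * ((fwdDiff (1:ℝ))^[m] (fun y : ℝ => y ^ (β - 1))) x) (show (0:ℝ) < 1 by norm_num)
    (h_cont m β hβ).continuousOn
    (fun y hy => h_hasDeriv m β y hy.1)
  obtain ⟨c, hc, h2⟩ := h_pos_form m (β - 1) ξ hξ.1
  refine ⟨c, hc, ?_⟩
  rw [Function.iterate_succ_apply', fwdDiff]
  rw [sub_zero, div_one] at h
  rw [zero_add, ← h, h2, prod_range_succ']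
  have : ∀ i : ℕ, β - 1 - (i:ℝ) = β - ((i + 1 : ℕ) : ℝ) := by intro i; push_cast; ring
  simp only [this]
  push_cast
  ring

theorem h_nonneg (m : ℕ) (β : ℝ) (hβ : 0 < β) (h : (m:ℝ) ≤ β + 1) :
    0 ≤ ((fwdDiff (1:ℝ))^[m] (fun y : ℝ => y ^ β)) 0 := by
  cases m with
  | zero => simp [Real.zero_rpow hβ.ne']
  | succ m =>
    obtain ⟨c, hc, h2⟩ := h_zero_form m β hβ
    rw [h2]
    refine mul_nonneg (prod_nonneg fun i hi => ?_) hc.le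
    have : (i:ℝ) ≤ m := by exact_mod_cast Nat.lt_succ_iff.1 (mem_range.1 hi)
    push_cast at h
    linarith

theorem h_neg (j : ℕ) (β : ℝ) (h0 : (j:ℝ) < β) (h1 : β < j + 1) :
    ((fwdDiff (1:ℝ))^[j+2] (fun y : ℝ => y ^ β)) 0 < 0 := by
  have hβ : 0 < β := lt_of_le_of_lt (Nat.cast_nonneg j) h0
  obtain ⟨c, hc, h2⟩ := h_zero_form (j+1) β hβ
  rw [h2, prod_range_succ]
  refine mul_neg_of_neg_of_pos (mul_neg_of_pos_of_neg (prod_pos fun i hi => ?_) ?_) hc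
  · have : (i:ℝ) ≤ j := by exact_mod_cast Nat.lt_succ_iff.1 (mem_range.1 hi)
    linarith
  · push_cast; linarith

theorem h_r_linear {n : ℕ} (Q : Finset (Fin n) → ℝ) (B : Finset (Fin n)) (c α : ℝ) (hc : 0 ≤ c)
    (hF : ∀ A ⊆ B, F Q A = c * A.card) :
    r Q B α = c ^ α * ((fwdDiff (1:ℝ))^[B.card] (fun y : ℝ => y ^ α)) 0 := by
  unfold r
  rw [fwdDiff_iter_eq_sum_shift]
  have : ∀ A ∈ B.powerset, (-1 : ℝ) ^ (B.card - A.card) * (F Q A) ^ α =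
      (fun m : ℕ => (-1 : ℝ) ^ (B.card - m) * (c * (m:ℝ)) ^ α) A.card := by
    intro A hA
    rw [hF A (mem_powerset.1 hA)]
  rw [sum_congr rfl this, sum_powerset_apply_card (fun m : ℕ => (-1 : ℝ) ^ (B.card - m) * (c * (m:ℝ)) ^ α), mul_sum]
  refine sum_congr rfl fun m _ => ?_
  rw [Real.mul_rpow hc (Nat.cast_nonneg m)]
  simp
  ring

theorem h_mobius_aux {n : ℕ} (B C : Finset (Fin n)) (hC : C ⊆ B) :
    ∑ A ∈ B.powerset with C ⊆ A, (-1 : ℝ) ^ (B.card - A.card) = if C = B then 1 else 0 := by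
  have h1 : ∑ A ∈ B.powerset with C ⊆ A, (-1 : ℝ) ^ (B.card - A.card)
      = ∑ D ∈ (B \ C).powerset, (-1 : ℝ) ^ D.card := by
    refine sum_nbij' (fun A => B \ A) (fun D => B \ D) ?_ ?_ ?_ ?_ ?_
    · intro A hA
      simp only [mem_filter, mem_powerset] at hA ⊢
      exact sdiff_subset_sdiff le_rfl hA.2
    · intro D hD
      simp only [mem_filter, mem_powerset] at hD ⊢
      refine ⟨sdiff_subset, fun x hx => mem_sdiff.2 ⟨hC hx, fun h => ?_⟩⟩
      exact (mem_sdiff.1 (hD h)).2 hx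
    · intro A hA
      simp only [mem_filter, mem_powerset] at hA
      simp [inter_eq_right.2 hA.1]
    · intro D hD
      simp only [mem_powerset] at hD
      simp [inter_eq_right.2 (hD.trans sdiff_subset)]
    · intro A hA
      simp only [mem_filter, mem_powerset] at hA
      rw [card_sdiff_of_subset hA.1]
  rw [h1]
  have h2 := sum_powerset_neg_one_pow_card (x := B \ C)
  have h3 : ∑ D ∈ (B \ C).powerset, (-1 : ℝ) ^ D.card =
      ((∑ D ∈ (B \ C).powerset, (-1 : ℤ) ^ D.card : ℤ) : ℝ) := by push_cast; rfl
  rw [h3, h2]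
  have : B \ C = ∅ ↔ C = B := by
    rw [sdiff_eq_empty_iff_subset]
    exact ⟨fun h => Subset.antisymm hC h, fun h => h ▸ Subset.refl _⟩
  simp [this]

theorem h_mobius {n : ℕ} (P : Finset (Fin n) → ℝ) (B : Finset (Fin n)) :
    ∑ A ∈ B.powerset, (-1 : ℝ) ^ (B.card - A.card) * F P A = P B := by
  have h1 : ∀ A ∈ B.powerset, (-1 : ℝ) ^ (B.card - A.card) * F P A =
      ∑ C ∈ B.powerset, if C ⊆ A then (-1 : ℝ) ^ (B.card - A.card) * P C else 0 := by
    intro A hA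
    rw [F, mul_sum, ← sum_filter]
    refine sum_congr ?_ fun _ _ => rfl
    ext C
    simp only [mem_filter, mem_powerset] at hA ⊢
    exact ⟨fun h => ⟨h.trans hA, h⟩, fun h => h.2⟩
  rw [sum_congr rfl h1, sum_comm]
  have h2 : ∀ C ∈ B.powerset,
      (∑ A ∈ B.powerset, if C ⊆ A then (-1 : ℝ) ^ (B.card - A.card) * P C else 0)
      = if C = B then P B else 0 := by
    intro C hC
    rw [← sum_filter, ← sum_mul, h_mobius_aux B C (mem_powerset.1 hC)]
    split_ifs with h
    · rw [h, one_mul]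
    · rw [zero_mul]
  rw [sum_congr rfl h2]
  simp

theorem h_power {n : ℕ} (Q : Finset (Fin n) → ℝ) (hQ : ∀ A, 0 ≤ Q A) (j : ℕ) :
    ∃ P : Finset (Fin n) → ℝ, (∀ A, Q A ^ (j+1) ≤ P A) ∧ ∀ A, F P A = F Q A ^ (j+1) := by
  induction j with
  | zero => exact ⟨Q, by simp, by simp⟩
  | succ j ih =>
    obtain ⟨P, hP, hPF⟩ := ih
    have hP0 : ∀ A, 0 ≤ P A := fun A => (pow_nonneg (hQ A) _).trans (hP A)
    refine ⟨fun D => ∑ p : Finset (Fin n) × Finset (Fin n) with p.1 ∪ p.2 = D, P p.1 * Q p.2,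
      fun A => ?_, fun A => ?_⟩
    · rw [pow_succ]
      refine (mul_le_mul_of_nonneg_right (hP A) (hQ A)).trans ?_
      exact single_le_sum (f := fun p : Finset (Fin n) × Finset (Fin n) => P p.1 * Q p.2)
        (fun p _ => mul_nonneg (hP0 _) (hQ _)) (a := (A, A)) (by simp)
    · rw [pow_succ, ← hPF, F, F, F, sum_mul_sum, ← sum_product']
      rw [← sum_fiberwise_of_maps_to (s := A.powerset ×ˢ A.powerset) (t := A.powerset)
        (g := fun p => p.1 ∪ p.2)]
      · refine sum_congr rfl fun D hD => sum_congr ?_ fun _ _ => rfl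
        ext p
        simp only [mem_filter, mem_univ, true_and, mem_product, mem_powerset] at hD ⊢
        constructor
        · rintro rfl
          exact ⟨⟨subset_union_left.trans hD, subset_union_right.trans hD⟩, rfl⟩
        · exact fun h => h.2
      · intro p hp
        simp only [mem_product, mem_powerset] at hp ⊢
        exact union_subset hp.1 hp.2

theorem h_r_int {n : ℕ} (Q : Finset (Fin n) → ℝ) (hQ : ∀ A, 0 ≤ Q A) (j : ℕ) (hj : 1 ≤ j)
    (B : Finset (Fin n)) (hB : 0 < Q B) : 0 < r Q B j := by
  obtain ⟨i, rfl⟩ : ∃ i, j = i + 1 := ⟨j - 1, by omega⟩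
  obtain ⟨P, hP, hPF⟩ := h_power Q hQ i
  have : r Q B ((i+1 : ℕ) : ℝ) = P B := by
    rw [← h_mobius P B, r]
    refine sum_congr rfl fun A _ => ?_
    rw [hPF, Real.rpow_natCast]
  rw [this]
  exact (pow_pos hB _).trans_le (hP B)

theorem h_r_contAt {n : ℕ} (Q : Finset (Fin n) → ℝ) (B : Finset (Fin n)) (a : ℝ) (ha : 0 < a) :
    ContinuousAt (fun t => r Q B t) a := by
  unfold r
  refine tendsto_finsetSum _ fun A _ => ?_
  refine Tendsto.mul tendsto_const_nhds ?_
  by_cases h : F Q A = 0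
  · rw [h, Real.zero_rpow ha.ne']
    refine tendsto_const_nhds.congr' ?_
    filter_upwards [lt_mem_nhds ha] with t ht
    rw [Real.zero_rpow ht.ne']
  · exact Real.continuousAt_const_rpow h

theorem h_delta {n : ℕ} (Q : Finset (Fin n) → ℝ) (hQ : ∀ A, 0 ≤ Q A) (N : ℕ) :
    ∃ δ : ℝ, 0 < δ ∧ ∀ B, 0 < Q B → ∀ j : ℕ, 1 ≤ j → j ≤ N → ∀ α : ℝ,
      (j:ℝ) - δ < α → α < j + δ → 0 < r Q B α := by
  have key : ∀ᶠ t in 𝓝 (0:ℝ), ∀ B : Finset (Fin n), ∀ j ∈ Icc 1 N,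
      0 < Q B → 0 < r Q B (j + t) := by
    rw [eventually_all]
    intro B
    rw [Filter.eventually_all_finset]
    intro j hj
    rw [mem_Icc] at hj
    by_cases hB : 0 < Q B
    · have hjp : (0:ℝ) < j := by exact_mod_cast hj.1
      have hc : ContinuousAt (fun t : ℝ => r Q B (j + t)) 0 := by
        have h1 : ContinuousAt (fun t : ℝ => r Q B t) ((j:ℝ) + 0) := by
          rw [add_zero]; exact h_r_contAt Q B j hjp
        exact ContinuousAt.comp (f := fun t : ℝ => (j:ℝ) + t) h1 (by fun_prop)
      have h2 : 0 < r Q B ((j:ℝ) + 0) := by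
        rw [add_zero]; exact h_r_int Q hQ j hj.1 B hB
      filter_upwards [hc.eventually (lt_mem_nhds h2)] with t ht _
      exact ht
    · exact Eventually.of_forall fun t h => absurd h hB
  obtain ⟨δ, hδ, h⟩ := Metric.eventually_nhds_iff.1 key
  refine ⟨δ, hδ, fun B hB j h1 h2 α ha hb => ?_⟩
  have := h (y := α - j) (by rw [Real.dist_eq, sub_zero, abs_lt]; constructor <;> linarith)
    B j (mem_Icc.2 ⟨h1, h2⟩) hB
  simpa using this

/-- The family of distributions. -/
noncomputable def hQ (n s : ℕ) (ε : ℝ) (A : Finset (Fin n)) : ℝ :=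
  (if A.card = 1 then (1 - ε) / n else 0) +
  (if s ≤ A.card then ε / (#{C : Finset (Fin n) | s ≤ C.card} : ℕ) else 0)

theorem h_F (n s : ℕ) (ε : ℝ) (A : Finset (Fin n)) :
    F (hQ n s ε) A = (1 - ε) / n * A.card +
      (#{C ∈ A.powerset | s ≤ C.card} : ℕ) *
        (ε / (#{C : Finset (Fin n) | s ≤ C.card} : ℕ)) := by
  unfold F hQ
  rw [sum_add_distrib, ← sum_filter, ← sum_filter, sum_const, sum_const, nsmul_eq_mul,
    nsmul_eq_mul, ← powersetCard_eq_filter, card_powersetCard, Nat.choose_one_right]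
  ring

theorem h_F_small (n s : ℕ) (ε : ℝ) (A : Finset (Fin n)) (hA : A.card < s) :
    F (hQ n s ε) A = (1 - ε) / n * A.card := by
  rw [h_F]
  have : ({C ∈ A.powerset | s ≤ C.card} : Finset (Finset (Fin n))) = ∅ := by
    rw [filter_eq_empty_iff]
    intro C hC
    have := card_le_card (mem_powerset.1 hC)
    omega
  rw [this]
  simp

theorem h_r_small (n s : ℕ) (ε α : ℝ) (hε : ε ≤ 1) (B : Finset (Fin n)) (hB : B.card < s) :
    r (hQ n s ε) B α = ((1 - ε) / n) ^ α * ((fwdDiff (1:ℝ))^[B.card] (fun y : ℝ => y ^ α)) 0 :=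
  h_r_linear _ _ _ _ (div_nonneg (by linarith) (Nat.cast_nonneg n))
    fun A hA => h_F_small n s ε A ((card_le_card hA).trans_lt hB)

theorem h_eps (n s : ℕ) (hn : 0 < n) (N : ℕ) (hN : N + 2 ≤ n) :
    ∃ ε : ℝ, 0 < ε ∧ ε < 1 ∧ ∀ j ≤ N, ∃ B : Finset (Fin n), r (hQ n s ε) B (j + 1/2) < 0 := by
  have key : ∀ᶠ ε in 𝓝 (0:ℝ), ∀ j ∈ range (N+1),
      ∃ B : Finset (Fin n), r (hQ n s ε) B (j + 1/2) < 0 := by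
    rw [Filter.eventually_all_finset]
    intro j hj
    rw [mem_range] at hj
    obtain ⟨B, -, hB⟩ := exists_subset_card_eq
      (s := (univ : Finset (Fin n))) (n := j + 2) (by simp; omega)
    have hp : (0:ℝ) < (j:ℝ) + 1/2 := by positivity
    have hc : ContinuousAt (fun ε => r (hQ n s ε) B (j + 1/2)) 0 := by
      simp only [r, h_F]
      refine tendsto_finsetSum _ fun A _ => ?_
      refine Tendsto.mul tendsto_const_nhds ?_
      refine ((Real.continuous_rpow_const hp.le).comp ?_).continuousAt
      fun_prop
    have h0 : r (hQ n s 0) B (j + 1/2) < 0 := by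
      rw [h_r_linear _ _ (1 / n) _ (by positivity) (fun A _ => by rw [h_F]; simp), hB]
      exact mul_neg_of_pos_of_neg (by positivity) (h_neg j _ (by linarith) (by linarith))
    filter_upwards [hc.eventually (gt_mem_nhds h0)] with ε hε
    exact ⟨B, hε⟩
  obtain ⟨ε, ⟨h1, h2⟩, h3⟩ := ((key.filter_mono nhdsWithin_le_nhds).and
    (Ioo_mem_nhdsGT (show (0:ℝ) < 1 by norm_num))).exists.imp fun _ h => And.comm.1 h
  exact ⟨ε, h1, h2, fun j hj => h3 j (mem_range.2 (by omega))⟩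

/-- For `n ≥ 4` and `2 ≤ k ≤ n−2` there are `δ > 0` and a probability distribution `Q` on
subsets of `[n]`, depending only on cardinality, satisfying properties (1)–(5) of
Theorem 6 (multiple interval components of the set of admissible powers). -/
theorem stmt11 (n k : ℕ) (hn : 4 ≤ n) (hk2 : 2 ≤ k) (hkn : k ≤ n - 2) :
    ∃ (δ : ℝ) (Q : Finset (Fin n) → ℝ), 0 < δ ∧
      (∀ A, 0 ≤ Q A) ∧
      (∑ A : Finset (Fin n), Q A) = 1 ∧
      (∀ A B : Finset (Fin n), A.card = B.card → Q A = Q B) ∧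
      -- (1)
      (∀ A : Finset (Fin n), Q A = 0 ↔ (A = ∅ ∨ (1 < A.card ∧ A.card ≤ n - k + 1))) ∧
      -- (2)
      (∀ α : ℝ, (∀ j : ℤ, α ≠ j) → 0 < α → α ≤ (n : ℝ) - k - 1 →
        ∃ B : Finset (Fin n), r Q B α < 0) ∧
      -- (3)
      (∀ j : ℕ, n - k ≤ j → j ≤ n - 2 → ∀ α : ℝ, (j : ℝ) ≤ α → α < j + δ →
        ∀ B : Finset (Fin n), 0 ≤ r Q B α) ∧
      -- (4)
      (∀ j : ℕ, n - k ≤ j → j ≤ n - 2 →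
        ∃ α : ℝ, (j : ℝ) < α ∧ α < j + 1 ∧ ∃ B : Finset (Fin n), r Q B α < 0) ∧
      -- (5)
      (∀ B : Finset (Fin n), n - k + 2 ≤ B.card → ∀ j : ℕ, 1 ≤ j → j ≤ n - 2 →
        ∀ α : ℝ, (j : ℝ) - δ < α → α < j + δ → 0 < α → 0 < r Q B α) := by
  have hn0 : (0:ℝ) < n := by exact_mod_cast (by omega : 0 < n)
  obtain ⟨ε, h0, h1, hneg⟩ := h_eps n (n - k + 2) (by omega) (n - 2) (by omega)
  have hN : (0:ℝ) < (#{C : Finset (Fin n) | n - k + 2 ≤ C.card} : ℕ) := by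
    rw [Nat.cast_pos, card_pos]
    exact ⟨univ, by simp; omega⟩
  have hp1 : 0 < (1 - ε) / n := div_pos (by linarith) hn0
  have hp2 := div_pos h0 hN
  have hQ0 : ∀ A, 0 ≤ hQ n (n - k + 2) ε A := by
    intro A
    unfold hQ
    refine add_nonneg ?_ ?_ <;> split_ifs <;> first | exact hp1.le | exact hp2.le | exact le_rfl
  have hQpos : ∀ A : Finset (Fin n), n - k + 2 ≤ A.card → 0 < hQ n (n - k + 2) ε A := by
    intro A hA
    unfold hQ
    rw [if_neg (by omega), if_pos hA, zero_add]
    exact hp2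
  obtain ⟨δ, hδ, hd⟩ := h_delta (hQ n (n - k + 2) ε) hQ0 (n - 2)
  refine ⟨δ, hQ n (n - k + 2) ε, hδ, hQ0, ?_, ?_, ?_, ?_, ?_, ?_, ?_⟩
  · have := h_F n (n - k + 2) ε univ
    rw [F, powerset_univ] at this
    rw [this, card_univ, Fintype.card_fin]
    field_simp
    ring
  · intro A B h
    simp only [hQ, h]
  · intro A
    rw [← card_eq_zero]
    unfold hQ
    split_ifs with ha hb hb
    · omega
    · rw [add_zero]
      exact ⟨fun h => absurd h hp1.ne', fun h => by omega⟩
    · rw [zero_add]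
      exact ⟨fun h => absurd h hp2.ne', fun h => by omega⟩
    · rw [add_zero]
      exact ⟨fun _ => by omega, fun _ => rfl⟩
  · intro α hα ha hb
    have hf1 : ((⌊α⌋₊ : ℕ) : ℝ) < α :=
      lt_of_le_of_ne (Nat.floor_le ha.le) fun h => hα ⌊α⌋₊ (by push_cast; exact h.symm)
    have hf2 := Nat.lt_floor_add_one α
    have hf3 : ⌊α⌋₊ + 2 < n - k + 2 := by
      have : ((⌊α⌋₊ + k + 1 : ℕ) : ℝ) < n := by push_cast; linarith
      have : ⌊α⌋₊ + k + 1 < n := by exact_mod_cast this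
      omega
    obtain ⟨B, -, hB⟩ := exists_subset_card_eq
      (s := (univ : Finset (Fin n))) (n := ⌊α⌋₊ + 2) (by simp; omega)
    refine ⟨B, ?_⟩
    rw [h_r_small n _ ε α h1.le B (by omega), hB]
    exact mul_neg_of_pos_of_neg (Real.rpow_pos_of_pos hp1 _) (h_neg _ _ hf1 hf2)
  · intro j hj1 hj2 α ha hb B
    by_cases hB : n - k + 2 ≤ B.card
    · exact (hd B (hQpos B hB) j (by omega) hj2 α (by linarith) hb).le
    · rw [h_r_small n _ ε α h1.le B (by omega)]
      have hj : (1:ℝ) ≤ j := by exact_mod_cast (by omega : 1 ≤ j)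
      have hBj : (B.card : ℝ) ≤ j + 1 := by exact_mod_cast (by omega : B.card ≤ j + 1)
      exact mul_nonneg (Real.rpow_nonneg hp1.le _) (h_nonneg _ _ (by linarith) (by linarith))
  · intro j _ hj
    obtain ⟨B, hB⟩ := hneg j hj
    exact ⟨j + 1/2, by linarith, by linarith, B, hB⟩
  · intro B hB j hj1 hj2 α ha hb _
    exact hd B (hQpos B hB) j hj1 hj2 α ha hb
end

section
/- Fix x ∈ (0,1) and define the sequence a : ℕ → ℝ by a_k := (1 + x^k)/2. Then a is a completely monotone sequence, and for every real α > 0, the sequence k ↦ a_k^α is completely monotone if and only if α is a positive integer. -/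
/-- A sequence `a : ℕ → ℝ` is completely monotone if
`Σ_{i=0}^{k} (−1)^i (k choose i) a_{j+i} ≥ 0` for all `j, k ≥ 0`. -/
def IsCMSeq (a : ℕ → ℝ) : Prop :=
  ∀ j k : ℕ, 0 ≤ ∑ i ∈ Finset.range (k + 1), (-1 : ℝ) ^ i * (k.choose i : ℝ) * a (j + i)

lemma hasSum_of_eq {f g : ℕ → ℝ} {c : ℝ} (h : HasSum f c) (e : ∀ n, g n = f n) :
    HasSum g c := by
  rwa [show g = f from funext e]

open unitInterval in
lemma diff_hasSum (t : ℕ → I) (w b : ℕ → ℝ)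
    (hb : ∀ k, HasSum (fun n => w n * (t n : ℝ) ^ k) (b k)) (j k : ℕ) :
    HasSum (fun n => w n * ((t n : ℝ) ^ j * (1 - (t n : ℝ)) ^ k))
      (∑ i ∈ Finset.range (k + 1), (-1 : ℝ) ^ i * (k.choose i : ℝ) * b (j + i)) := by
  have h := hasSum_sum (s := Finset.range (k + 1))
    (fun i _ => (hb (j + i)).mul_left ((-1 : ℝ) ^ i * (k.choose i : ℝ)))
  refine hasSum_of_eq h fun n => ?_
  have : (1 - (t n : ℝ)) = -(t n : ℝ) + 1 := by ring
  rw [this, add_pow, Finset.mul_sum, Finset.mul_sum]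
  refine Finset.sum_congr rfl fun i _ => ?_
  rw [neg_pow, pow_add]
  ring

open unitInterval in
lemma cm_of_hasSum (t : ℕ → I) (w b : ℕ → ℝ) (hw : ∀ n, 0 ≤ w n)
    (hb : ∀ k, HasSum (fun n => w n * (t n : ℝ) ^ k) (b k)) : IsCMSeq b := by
  intro j k
  refine (diff_hasSum t w b hb j k).nonneg fun n => ?_
  have h1 := (t n).2.1
  have h2 : 0 ≤ 1 - (t n : ℝ) := sub_nonneg.2 (t n).2.2
  have := hw n
  positivity

open unitInterval in
lemma key_s12 (t : ℕ → I) (w b : ℕ → ℝ) (hs : Summable (fun n => |w n|))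
    (hb : ∀ k, HasSum (fun n => w n * (t n : ℝ) ^ k) (b k)) (hcm : IsCMSeq b)
    (f : C(I, ℝ)) (hf : ∀ y, 0 ≤ f y) (N : ℕ) (hN : ∀ n, n ≠ N → f (t n) = 0) :
    0 ≤ w N * f (t N) := by
  by_contra! hneg
  set S := ∑' n, |w n| with hS
  have hS0 : 0 ≤ S := tsum_nonneg fun n => abs_nonneg _
  set δ := -(w N * f (t N)) / (S + 1) with hδ
  have hδ0 : 0 < δ := div_pos (by linarith) (by linarith)
  obtain ⟨m, hm⟩ := ((Metric.tendsto_nhds.1 (bernsteinApproximation_uniform f)) δ hδ0).exists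
  have hB : ∃ c, 0 ≤ c ∧ HasSum (fun n => w n * bernsteinApproximation m f (t n)) c := by
    have h := hasSum_sum (s := (Finset.univ : Finset (Fin (m + 1))))
      (fun v _ => (diff_hasSum t w b hb v (m - v)).mul_left
        ((m.choose v : ℝ) * f (bernstein.z v)))
    refine ⟨_, ?_, hasSum_of_eq h fun n => ?_⟩
    rotate_left
    · rw [bernsteinApproximation.apply, Finset.mul_sum]
      refine Finset.sum_congr rfl fun v _ => ?_
      rw [bernstein_apply, smul_eq_mul]
      ring
    · refine Finset.sum_nonneg fun v _ => mul_nonneg (mul_nonneg (by positivity) (hf _)) ?_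
      exact hcm v (m - v)
  obtain ⟨c, hc0, hc⟩ := hB
  have h1 : HasSum (fun n => w n * f (t n)) (w N * f (t N)) :=
    hasSum_single N fun n hn => by rw [hN n hn, mul_zero]
  have h2 := h1.add (hs.hasSum.mul_right δ)
  have h3 : c ≤ w N * f (t N) + S * δ := by
    refine hasSum_le (fun n => ?_) hc h2
    have h4 : |bernsteinApproximation m f (t n) - f (t n)| ≤ δ := by
      have := ContinuousMap.dist_apply_le_dist (f := bernsteinApproximation m f) (g := f) (t n)
      rw [Real.dist_eq] at this
      linarith
    have h5 : w n * (bernsteinApproximation m f (t n) - f (t n)) ≤ |w n| * δ := by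
      refine (le_abs_self _).trans ?_
      rw [abs_mul]
      exact mul_le_mul_of_nonneg_left h4 (abs_nonneg _)
    linarith
  have h6 : δ * (S + 1) = -(w N * f (t N)) := div_mul_cancel₀ _ (by linarith)
  nlinarith

lemma choose_neg_of_not_nat (α : ℝ) (hα : 0 < α) (h : ¬ ∃ m : ℕ, 0 < m ∧ α = m) :
    ∃ N : ℕ, Ring.choose α N < 0 := by
  refine ⟨⌊α⌋₊ + 1 + 1, ?_⟩
  have hfl : (⌊α⌋₊ : ℝ) < α := by
    refine lt_of_le_of_ne (Nat.floor_le hα.le) fun he => h ⟨⌊α⌋₊, ?_, he.symm⟩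
    rw [← he] at hα
    exact_mod_cast hα
  have hlt := Nat.lt_floor_add_one α
  have hpos : 0 < (descPochhammer ℝ (⌊α⌋₊ + 1)).eval α :=
    descPochhammer_pos (by push_cast; linarith)
  have h1 := Ring.descPochhammer_eq_factorial_smul_choose α (⌊α⌋₊ + 1 + 1)
  have h2 : (descPochhammer ℤ (⌊α⌋₊ + 1 + 1)).smeval α
      = (descPochhammer ℝ (⌊α⌋₊ + 1 + 1)).eval α := by
    rw [← Polynomial.aeval_eq_smeval, ← descPochhammer_map (algebraMap ℤ ℝ),
      Polynomial.eval_map_algebraMap]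
  rw [h2, descPochhammer_succ_eval, nsmul_eq_mul] at h1
  push_cast at h1
  have h3 : (descPochhammer ℝ (⌊α⌋₊ + 1)).eval α * (α - (⌊α⌋₊ + 1)) < 0 :=
    mul_neg_of_pos_of_neg hpos (by linarith)
  rw [h1] at h3
  by_contra! hc
  have : (0 : ℝ) ≤ ((⌊α⌋₊ + 1 + 1).factorial : ℝ) * Ring.choose α (⌊α⌋₊ + 1 + 1) := by positivity
  linarith

lemma binom_hasSum (α y : ℝ) (hy : |y| < 1) :
    HasSum (fun n => Ring.choose α n * y ^ n) ((1 + y) ^ α) := by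
  have hmem : y ∈ Metric.eball (0 : ℝ) 1 := by
    rw [← ENNReal.ofReal_one, Metric.eball_ofReal]; simpa using hy
  have := (Real.one_add_rpow_hasFPowerSeriesOnBall_zero (a := α)).hasSum hmem
  simpa [-FormalMultilinearSeries.apply_eq_prod_smul_coeff] using this

lemma pow_cm (x : ℝ) (hx0 : 0 < x) (hx1 : x < 1) (m : ℕ) :
    IsCMSeq (fun k => ((1 + x ^ k) / 2) ^ m) := by
  refine cm_of_hasSum (fun n => ⟨x ^ n, by positivity, pow_le_one₀ hx0.le hx1.le⟩)
    (fun n => (m.choose n : ℝ) / 2 ^ m) _ (fun n => by positivity) fun k => ?_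
  have h := hasSum_sum_of_ne_finset_zero (L := .unconditional ℕ) (s := Finset.range (m + 1))
    (f := fun n => (m.choose n : ℝ) / 2 ^ m * (x ^ n) ^ k) (fun n hn => by
      rw [Nat.choose_eq_zero_of_lt (by simpa using hn)]; simp)
  convert h using 1
  rw [div_pow, add_comm, add_pow, Finset.sum_div]
  refine Finset.sum_congr rfl fun n _ => ?_
  rw [← pow_mul, ← pow_mul, mul_comm k n]
  simp
  ring

lemma nat_of_cm (x : ℝ) (hx0 : 0 < x) (hx1 : x < 1) (α : ℝ) (hα : 0 < α)
    (hcm : IsCMSeq (fun k => ((1 + x ^ k) / 2) ^ α)) : ∃ m : ℕ, 0 < m ∧ α = m := by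
  by_contra h
  obtain ⟨N, hN⟩ := choose_neg_of_not_nat α hα h
  set ε := x ^ N * (1 - x) with hε
  have hε0 : 0 < ε := mul_pos (by positivity) (by linarith)
  have h2 : (0 : ℝ) < 2 ^ α := by positivity
  set w : ℕ → ℝ := fun n => Ring.choose α n * x ^ n / 2 ^ α with hw
  have hx' : |x| < 1 := by rwa [abs_of_pos hx0]
  have := key_s12 (fun n => ⟨x ^ n, by positivity, pow_le_one₀ hx0.le hx1.le⟩) w
    (fun k => ((1 + x ^ (k + 1)) / 2) ^ α)
    ((binom_hasSum α x hx').summable.div_const _).abs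
    (fun k => ?_) (fun j k => ?_)
    ⟨fun y => max 0 (ε - |(y : ℝ) - x ^ N|), by fun_prop⟩ (fun y => le_max_left _ _) N
    (fun n hn => ?_)
  · simp only [ContinuousMap.coe_mk, sub_self, abs_zero, sub_zero, max_eq_right hε0.le] at this
    have hwN : w N < 0 := div_neg_of_neg_of_pos (mul_neg_of_neg_of_pos hN (by positivity)) h2
    nlinarith
  · have hy : |x ^ (k + 1)| < 1 := by
      rw [abs_of_pos (by positivity)]
      exact pow_lt_one₀ hx0.le hx1 (by simp)
    have h3 := (binom_hasSum α _ hy).div_const (2 ^ α)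
    rw [Real.div_rpow (by positivity) (by norm_num)]
    refine hasSum_of_eq h3 fun n => ?_
    simp only [hw]
    rw [← pow_mul, ← pow_mul, mul_comm (k + 1) n, mul_add, pow_add]
    ring
  · have := hcm (j + 1) k
    simpa only [add_right_comm j 1] using this
  · refine max_eq_left ?_
    simp only [sub_nonpos]
    rcases lt_or_gt_of_ne hn with h | h
    · have h4 : x ^ N ≤ x ^ (n + 1) := pow_le_pow_of_le_one hx0.le hx1.le h
      have h5 : x ^ N ≤ x ^ n := pow_le_pow_of_le_one hx0.le hx1.le h.le
      rw [pow_succ] at h4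
      refine le_trans ?_ (le_abs_self _)
      nlinarith
    · have h4 : x ^ n ≤ x ^ (N + 1) := pow_le_pow_of_le_one hx0.le hx1.le h
      rw [pow_succ] at h4
      refine le_trans ?_ (neg_le_abs _)
      nlinarith

/-- For `x ∈ (0,1)`, the sequence `a_k = (1 + x^k)/2` is completely monotone, and for real
`α > 0` the sequence `k ↦ a_k^α` is completely monotone if and only if `α` is a positive
integer. -/
theorem stmt12 (x : ℝ) (hx0 : 0 < x) (hx1 : x < 1) :
    IsCMSeq (fun k => (1 + x ^ k) / 2) ∧
    ∀ α : ℝ, 0 < α →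
      (IsCMSeq (fun k => ((1 + x ^ k) / 2) ^ α) ↔ ∃ m : ℕ, 0 < m ∧ α = m) := by
  refine ⟨by simpa using pow_cm x hx0 hx1 1, fun α hα => ⟨nat_of_cm x hx0 hx1 α hα, ?_⟩⟩
  rintro ⟨m, _, rfl⟩
  simpa only [Real.rpow_natCast] using pow_cm x hx0 hx1 m
end

section
/- Fix y > 0 and define g : (0,∞) → ℝ by g(t) := (1 + e^{−yt})/2. Then g is a completely monotone function on (0,∞), and for every real α > 0, the function t ↦ g(t)^α is completely monotone on (0,∞) if and only if α is a positive integer. -/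
/-- A function `g : ℝ → ℝ` is completely monotone on `(0,∞)` if it is smooth there and
`(−1)^k g^{(k)}(t) ≥ 0` for every `t > 0` and every `k ≥ 0`. -/
def IsCMOn (g : ℝ → ℝ) : Prop :=
  ContDiffOn ℝ (⊤ : ℕ∞) g (Set.Ioi 0) ∧
  ∀ (k : ℕ) (t : ℝ), 0 < t →
    0 ≤ (-1 : ℝ) ^ k * iteratedDerivWithin k g (Set.Ioi 0) t

lemma rc_succ (α : ℝ) (n : ℕ) :
    ((n : ℝ) + 1) * Ring.choose α (n + 1) = Ring.choose α n * (α - n) := by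
  have h := Ring.choose_smul_choose α (Nat.le_succ n)
  simpa [nsmul_eq_mul] using h

lemma rc_bdd (α : ℝ) (hα : 0 < α) : ∃ C : ℝ, ∀ n, |Ring.choose α n| ≤ C := by
  obtain ⟨N, hN⟩ := exists_nat_ge α
  refine ⟨∑ i ∈ Finset.range (N + 1), |Ring.choose α i|, fun n => ?_⟩
  have hs : ∀ n ≤ N, |Ring.choose α n| ≤ ∑ i ∈ Finset.range (N + 1), |Ring.choose α i| := by
    intro n hn
    exact Finset.single_le_sum (f := fun i => |Ring.choose α i|) (fun i _ => abs_nonneg _)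
      (Finset.mem_range.2 (by omega))
  induction n with
  | zero => exact hs 0 (Nat.zero_le _)
  | succ n ih =>
    by_cases hn : n + 1 ≤ N
    · exact hs _ hn
    · have hNn : (N : ℝ) ≤ n := by exact_mod_cast (by omega : N ≤ n)
      have h := congrArg abs (rc_succ α n)
      rw [abs_mul, abs_mul, abs_of_pos (by positivity : (0 : ℝ) < (n : ℝ) + 1),
        abs_of_nonpos (by linarith : α - (n : ℝ) ≤ 0)] at h
      have h0 := abs_nonneg (Ring.choose α n)
      have h1 : ((n : ℝ) + 1) * |Ring.choose α (n + 1)| ≤ ((n : ℝ) + 1) * |Ring.choose α n| := by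
        rw [h, mul_comm]
        exact mul_le_mul_of_nonneg_right (by linarith) h0
      exact (le_of_mul_le_mul_left h1 (by positivity)).trans ih

lemma rc_pos (α : ℝ) (m : ℕ) (h : (m : ℝ) < α) : ∀ n ≤ m + 1, 0 < Ring.choose α n := by
  intro n
  induction n with
  | zero => intro _; simp
  | succ n ih =>
    intro hn
    have h1 := ih (by omega)
    have h2 : (n : ℝ) ≤ m := by exact_mod_cast (by omega : n ≤ m)
    have h3 := rc_succ α n
    have h4 : 0 < Ring.choose α n * (α - n) := mul_pos h1 (by linarith)
    rw [← h3] at h4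
    exact pos_of_mul_pos_right h4 (by positivity)

lemma rc_neg (α : ℝ) (m : ℕ) (h : (m : ℝ) < α) (h' : α < m + 1) :
    Ring.choose α (m + 2) < 0 := by
  have h1 := rc_pos α m h (m + 1) le_rfl
  have h3 := rc_succ α (m + 1)
  have h4 : Ring.choose α (m + 1) * (α - (m + 1 : ℕ)) < 0 :=
    mul_neg_of_pos_of_neg h1 (by push_cast; linarith)
  rw [← h3] at h4
  exact neg_of_mul_neg_right h4 (by positivity)

lemma summ_aux (a : ℕ → ℝ) (C : ℝ) (ha : ∀ n, |a n| ≤ C) (y : ℝ) (hy : 0 < y) (k : ℕ)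
    (t : ℝ) (ht : 0 < t) :
    Summable (fun n : ℕ => C * (n * y) ^ k * Real.exp (-(n * y) * t)) := by
  have h := (summable_pow_mul_geometric_of_norm_lt_one k (r := Real.exp (-(y * t)))
    (by rw [Real.norm_eq_abs, abs_of_pos (Real.exp_pos _), Real.exp_lt_one_iff]
        nlinarith [mul_pos hy ht])).mul_left (C * y ^ k)
  refine h.congr fun n => ?_
  rw [← Real.exp_nat_mul, mul_pow]
  ring_nf

lemma norm_aux (a : ℕ → ℝ) (C : ℝ) (ha : ∀ n, |a n| ≤ C) (y : ℝ) (hy : 0 < y) (k : ℕ)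
    (s t : ℝ) (hst : s ≤ t) (n : ℕ) :
    ‖a n * (-(n * y)) ^ k * Real.exp (-(n * y) * t)‖
      ≤ C * (n * y) ^ k * Real.exp (-(n * y) * s) := by
  have hny : 0 ≤ (n : ℝ) * y := by positivity
  have hC : 0 ≤ C := (abs_nonneg _).trans (ha 0)
  rw [norm_mul, norm_mul, norm_pow, norm_neg, Real.norm_of_nonneg hny,
    Real.norm_of_nonneg (Real.exp_pos _).le]
  have := ha n
  rw [Real.norm_eq_abs]
  gcongr ?_ * _ * Real.exp ?_
  nlinarith

lemma deriv_aux (a : ℕ → ℝ) (C : ℝ) (ha : ∀ n, |a n| ≤ C) (y : ℝ) (hy : 0 < y) (k : ℕ)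
    (t : ℝ) (ht : 0 < t) :
    HasDerivAt (fun t => ∑' n : ℕ, a n * (-(n * y)) ^ k * Real.exp (-(n * y) * t))
      (∑' n : ℕ, a n * (-(n * y)) ^ (k + 1) * Real.exp (-(n * y) * t)) t := by
  have hmem : t ∈ Set.Ioi (t / 2) := Set.mem_Ioi.2 (by linarith)
  refine hasDerivAt_tsum_of_isPreconnected (t := Set.Ioi (t / 2)) (y₀ := t)
    (g := fun (n : ℕ) (t : ℝ) => a n * (-(n * y)) ^ k * Real.exp (-(n * y) * t))
    (g' := fun (n : ℕ) (t : ℝ) => a n * (-(n * y)) ^ (k + 1) * Real.exp (-(n * y) * t))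
    (summ_aux a C ha y hy (k + 1) (t / 2) (by linarith)) isOpen_Ioi isPreconnected_Ioi
    ?_ ?_ hmem ?_ hmem
  · intro n s _
    have h : HasDerivAt (fun s : ℝ => -(n * y) * s) (-(n * y)) s := by
      simpa using (hasDerivAt_id s).const_mul (-((n : ℝ) * y))
    exact (h.exp.const_mul (a n * (-(n * y)) ^ k)).congr_deriv (by rw [pow_succ]; ring)
  · intro n s hs
    exact norm_aux a C ha y hy (k + 1) (t / 2) s (le_of_lt hs) n
  · exact Summable.of_norm_bounded (summ_aux a C ha y hy k t ht)
      (fun n => norm_aux a C ha y hy k t t le_rfl n)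

lemma iter_aux (a : ℕ → ℝ) (C : ℝ) (ha : ∀ n, |a n| ≤ C) (y : ℝ) (hy : 0 < y) (f : ℝ → ℝ)
    (hf : ∀ t, 0 < t → f t = ∑' n : ℕ, a n * Real.exp (-(n * y) * t)) (k : ℕ) :
    ∀ t, 0 < t → iteratedDerivWithin k f (Set.Ioi 0) t =
      ∑' n : ℕ, a n * (-(n * y)) ^ k * Real.exp (-(n * y) * t) := by
  induction k with
  | zero => intro t ht; simp [hf t ht]
  | succ k ih =>
    intro t ht
    rw [iteratedDerivWithin_succ, derivWithin_congr (s := Set.Ioi 0) (fun s hs => ih s hs) (ih t ht)]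
    exact (deriv_aux a C ha y hy k t ht).hasDerivWithinAt.derivWithin
      (isOpen_Ioi.uniqueDiffWithinAt ht)

lemma iter_sign (a : ℕ → ℝ) (C : ℝ) (ha : ∀ n, |a n| ≤ C) (y : ℝ) (hy : 0 < y) (f : ℝ → ℝ)
    (hf : ∀ t, 0 < t → f t = ∑' n : ℕ, a n * Real.exp (-(n * y) * t)) (k : ℕ)
    (t : ℝ) (ht : 0 < t) : (-1) ^ k * iteratedDerivWithin k f (Set.Ioi 0) t =
      ∑' n : ℕ, a n * (n * y) ^ k * Real.exp (-(n * y) * t) := by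
  rw [iter_aux a C ha y hy f hf k t ht, ← tsum_mul_left]
  congr 1
  ext n
  rw [neg_pow ((n : ℝ) * y)]
  have : ((-1 : ℝ) ^ k) * (-1) ^ k = 1 := by rw [← mul_pow]; simp
  linear_combination (a n * (n * y) ^ k * Real.exp (-(n * y) * t)) * this

/-- If all the signed derivatives are nonnegative, so are the coefficients. -/
lemma coeff_nonneg (a : ℕ → ℝ) (C : ℝ) (ha : ∀ n, |a n| ≤ C) (y : ℝ) (hy : 0 < y)
    (h : ∀ (k : ℕ) (t : ℝ), 0 < t →
      0 ≤ ∑' n : ℕ, a n * (n * y) ^ k * Real.exp (-(n * y) * t)) (N : ℕ) (hN : 0 < N) :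
    0 ≤ a N := by
  have hN' : (0 : ℝ) < N := by exact_mod_cast hN
  have hC : 0 ≤ C := (abs_nonneg _).trans (ha 0)
  set r : ℕ → ℝ := fun n => (n / N : ℝ) * Real.exp (1 - n / N) with hr
  have r0 : ∀ n, 0 ≤ r n := fun n => by positivity
  have r1 : ∀ n, n ≠ N → r n < 1 := by
    intro n hn
    have h1 : (n / N : ℝ) - 1 ≠ 0 := by
      intro h
      apply hn
      have : (n : ℝ) = N := by field_simp at h; linarith
      exact_mod_cast this
    have h2 := Real.add_one_lt_exp h1
    have h3 : Real.exp ((n / N : ℝ) - 1) * Real.exp (1 - n / N) = 1 := by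
      rw [← Real.exp_add]; simp
    rw [← h3]
    exact mul_lt_mul_of_pos_right (by linarith) (Real.exp_pos _)
  have rN : r N = 1 := by simp [hr, hN'.ne']
  have r1' : ∀ n, r n ≤ 1 := fun n => by
    by_cases hn : n = N
    · rw [hn, rN]
    · exact (r1 n hn).le
  have key : Filter.Tendsto (fun k : ℕ => ∑' n, a n * r n ^ k) Filter.atTop
      (nhds (∑' n, a n * (if n = N then 1 else 0))) := by
    refine tendsto_tsum_of_dominated_convergence (bound := fun n => C * r n) ?_ ?_ ?_
    · have hs := (summ_aux a C ha 1 one_pos 1 (1 / N) (by positivity)).mul_left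
        (Real.exp 1 / N)
      refine hs.congr fun n => ?_
      simp only [hr]
      rw [sub_eq_add_neg, Real.exp_add]
      ring_nf
    · intro n
      suffices hp : Filter.Tendsto (fun k : ℕ => r n ^ k) Filter.atTop
          (nhds (if n = N then (1 : ℝ) else 0)) from hp.const_mul _
      by_cases hn : n = N
      · subst hn
        have e1 : (fun k : ℕ => r n ^ k) = fun _ => 1 := by
          ext k
          rw [rN, one_pow]
        rw [e1, if_pos rfl]
        exact tendsto_const_nhds
      · simpa [hn] using tendsto_pow_atTop_nhds_zero_of_lt_one (r0 n) (r1 n hn)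
    · filter_upwards [Filter.eventually_ge_atTop 1] with k hk n
      rw [norm_mul, norm_pow, Real.norm_of_nonneg (r0 n), Real.norm_eq_abs]
      have := ha n
      have h2 : r n ^ k ≤ r n := pow_le_of_le_one (r0 n) (r1' n) (by omega)
      exact mul_le_mul this h2 (pow_nonneg (r0 n) k) hC
  have e : ∑' n, a n * (if n = N then (1 : ℝ) else 0) = a N := by
    rw [tsum_eq_single N (fun n hn => by simp [hn])]
    simp
  rw [e] at key
  refine ge_of_tendsto key ?_
  filter_upwards [Filter.eventually_ge_atTop 1] with k hk
  have hk' : (0 : ℝ) < k := by exact_mod_cast hk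
  have h1 := h k (k / (N * y)) (by positivity)
  have h2 : ∑' n, a n * r n ^ k = (Real.exp 1 / (N * y)) ^ k *
      ∑' n : ℕ, a n * (n * y) ^ k * Real.exp (-(n * y) * (k / (N * y))) := by
    rw [← tsum_mul_left]
    congr 1
    ext n
    have h3 : Real.exp (-(n * y) * (k / (N * y))) = Real.exp (-(n / N)) ^ k := by
      rw [← Real.exp_nat_mul]
      congr 1
      field_simp
    rw [h3]
    simp only [hr]
    rw [sub_eq_add_neg, Real.exp_add]
    have h4 : (n / N : ℝ) * (Real.exp 1 * Real.exp (-(n / N)))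
      = (Real.exp 1 / (N * y)) * (n * y) * Real.exp (-(n / N)) := by
      field_simp
    rw [h4, mul_pow, mul_pow]
    ring
  rw [h2]
  positivity

lemma series_aux (y : ℝ) (hy : 0 < y) (α : ℝ) (t : ℝ) (ht : 0 < t) :
    ((1 + Real.exp (-(y * t))) / 2) ^ α =
      ∑' n : ℕ, (Ring.choose α n / 2 ^ α) * Real.exp (-(n * y) * t) := by
  have hx : Real.exp (-(y * t)) < 1 := by
    rw [Real.exp_lt_one_iff]; nlinarith [mul_pos hy ht]
  have h := (Real.one_add_rpow_hasFPowerSeriesOnBall_zero (a := α)).hasSum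
    (y := Real.exp (-(y * t))) (by
      rw [← ENNReal.ofReal_one, Metric.eball_ofReal]
      simpa using hx)
  have h2 := h.tsum_eq
  simp only [zero_add] at h2
  rw [Real.div_rpow (by positivity) (by norm_num), ← h2, ← tsum_div_const]
  congr 1
  ext n
  rw [binomialSeries_apply]
  simp only [List.ofFn_const, List.prod_replicate, smul_eq_mul, ← Real.exp_nat_mul]
  ring_nf

lemma cm_smooth (y α : ℝ) :
    ContDiffOn ℝ (⊤ : ℕ∞) (fun t => ((1 + Real.exp (-(y * t))) / 2) ^ α) (Set.Ioi 0) := by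
  refine ContDiffOn.rpow_const_of_ne ?_ ?_
  · fun_prop
  · intro t _
    positivity

lemma cm_iff (y : ℝ) (hy : 0 < y) (α : ℝ) (hα : 0 < α) :
    IsCMOn (fun t => ((1 + Real.exp (-(y * t))) / 2) ^ α) ↔ ∃ m : ℕ, 0 < m ∧ α = m := by
  obtain ⟨C, hC⟩ := rc_bdd α hα
  have h2 : (0 : ℝ) < 2 ^ α := by positivity
  have ha : ∀ n, |Ring.choose α n / 2 ^ α| ≤ C / 2 ^ α := by
    intro n
    rw [abs_div, abs_of_pos h2]
    have := hC n
    gcongr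
  have key := iter_sign (fun n => Ring.choose α n / 2 ^ α) _ ha y hy _
    (fun t ht => series_aux y hy α t ht)
  constructor
  · rintro ⟨-, h⟩
    by_contra hcon
    have hm1 : ((⌊α⌋₊ : ℕ) : ℝ) ≤ α := Nat.floor_le hα.le
    have hm2 : α < (⌊α⌋₊ : ℕ) + 1 := Nat.lt_floor_add_one α
    have hne : ((⌊α⌋₊ : ℕ) : ℝ) ≠ α := by
      intro he
      refine hcon ⟨⌊α⌋₊, ?_, he.symm⟩
      have : (0 : ℝ) < (⌊α⌋₊ : ℕ) := by rw [he]; exact hα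
      exact_mod_cast this
    have hneg := rc_neg α ⌊α⌋₊ (lt_of_le_of_ne hm1 hne) hm2
    have hnn := coeff_nonneg _ _ ha y hy (fun k t ht => by
      rw [← key k t ht]; exact h k t ht) (⌊α⌋₊ + 2) (by omega)
    have := div_neg_of_neg_of_pos hneg h2
    linarith
  · rintro ⟨m, hm, rfl⟩
    refine ⟨cm_smooth y m, fun k t ht => ?_⟩
    rw [key k t ht]
    refine tsum_nonneg fun n => ?_
    simp only [Ring.choose_natCast]
    positivity

/-- For `y > 0`, the function `g t = (1 + e^{−yt})/2` is completely monotone on `(0,∞)`, and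
for real `α > 0` the function `t ↦ g(t)^α` is completely monotone on `(0,∞)` if and only
if `α` is a positive integer. -/
theorem stmt13 (y : ℝ) (hy : 0 < y) :
    IsCMOn (fun t => (1 + Real.exp (-(y * t))) / 2) ∧
    ∀ α : ℝ, 0 < α →
      (IsCMOn (fun t => ((1 + Real.exp (-(y * t))) / 2) ^ α) ↔ ∃ m : ℕ, 0 < m ∧ α = m) := by
  refine ⟨?_, fun α hα => cm_iff y hy α hα⟩
  have h := (cm_iff y hy 1 one_pos).2 ⟨1, one_pos, by simp⟩
  simpa only [Real.rpow_one] using h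
end

section
/- For all nonnegative real numbers p₀, p_a, p_b, p_c, p_i and every real α ≥ 1, one has (p₀ + p_a + p_b + p_c + p_i)^α − (p_a + p_i)^α − (p_b + p_i)^α − (p_c + p_i)^α + 2·p_i^α ≥ 0. -/
/-- Superadditivity of increments of `t ^ α`, by convexity. -/
theorem rpow_aux (x y i α : ℝ) (hx : 0 ≤ x) (hy : 0 ≤ y) (hi : 0 ≤ i) (hα : 1 ≤ α) :
    (x + i) ^ α + (y + i) ^ α ≤ (x + y + i) ^ α + i ^ α := by
  rcases eq_or_lt_of_le (add_nonneg hx hy) with h | h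
  · have hx0 : x = 0 := by linarith
    have hy0 : y = 0 := by linarith
    subst hx0 hy0
    simp
  · have hne : x + y ≠ 0 := h.ne'
    have hs : x / (x + y) + y / (x + y) = 1 := by field_simp
    have hs2 : y / (x + y) + x / (x + y) = 1 := by rw [add_comm, hs]
    have hxx : 0 ≤ x / (x + y) := by positivity
    have hyy : 0 ≤ y / (x + y) := by positivity
    have hz : x + y + i ∈ Set.Ici (0 : ℝ) := by
      simp only [Set.mem_Ici]; positivity
    have h1 := (convexOn_rpow hα).2 hz (Set.mem_Ici.2 hi) hxx hyy hs
    have h2 := (convexOn_rpow hα).2 hz (Set.mem_Ici.2 hi) hyy hxx hs2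
    simp only [smul_eq_mul] at h1 h2
    have e1 : x / (x + y) * (x + y + i) + y / (x + y) * i = x + i := by
      field_simp; ring
    have e2 : y / (x + y) * (x + y + i) + x / (x + y) * i = y + i := by
      field_simp; ring
    rw [e1] at h1
    rw [e2] at h2
    have e3 : y / (x + y) = 1 - x / (x + y) := by linarith
    rw [e3] at h1 h2
    linarith


/-- For nonnegative reals `p₀, p_a, p_b, p_c, p_i` and real `α ≥ 1`,
`(p₀+p_a+p_b+p_c+p_i)^α − (p_a+p_i)^α − (p_b+p_i)^α − (p_c+p_i)^α + 2 p_i^α ≥ 0`,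
where the powers are real powers. -/
theorem stmt14 (p0 pa pb pc pi : ℝ) (h0 : 0 ≤ p0) (ha : 0 ≤ pa) (hb : 0 ≤ pb)
    (hc : 0 ≤ pc) (hi : 0 ≤ pi) (α : ℝ) (hα : 1 ≤ α) :
    0 ≤ (p0 + pa + pb + pc + pi) ^ α - (pa + pi) ^ α - (pb + pi) ^ α - (pc + pi) ^ α
        + 2 * pi ^ α := by
  have h1 := rpow_aux pa pb pi α ha hb hi hα
  have h2 := rpow_aux (pa + pb) pc pi α (add_nonneg ha hb) hc hi hα
  have h3 : (pa + pb + pc + pi) ^ α ≤ (p0 + pa + pb + pc + pi) ^ α :=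
    Real.rpow_le_rpow (by positivity) (by linarith) (by linarith)
  linarith
end

section
/- Let L be a lattice, h : L → ℝ a completely monotone function, and C ≥ 0 a real number. Then the function x ↦ exp(−C(1 − h(x))) is completely monotone on L. -/
/-- Iterated discrete derivative along a list. -/
def dlt {L : Type*} [Lattice L] : List L → (L → ℝ) → L → ℝ
  | [], f => f
  | a :: l, f => dlt l (fun x => f x - f (x ⊔ a))

theorem dlt_eq {L ι : Type*} [Lattice L] [DecidableEq ι] (y : ι → L) (s : List ι)
    (hs : s.Nodup) : ∀ (f : L → ℝ) (x : L), dlt (s.map y) f x =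
      ∑ J ∈ s.toFinset.powerset, (-1 : ℝ) ^ J.card * f (J.fold (· ⊔ ·) x y) := by
  induction s with
  | nil => intro f x; simp [dlt]
  | cons a s ih =>
    intro f x
    rw [List.nodup_cons] at hs
    have ha : a ∉ s.toFinset := by simpa using hs.1
    rw [List.map_cons, dlt, ih hs.2, List.toFinset_cons, Finset.sum_powerset_insert ha,
      ← Finset.sum_add_distrib]
    refine Finset.sum_congr rfl fun J hJ => ?_
    have haJ : a ∉ J := fun h => ha (Finset.mem_powerset.1 hJ h)
    rw [Finset.card_insert_of_notMem haJ, Finset.fold_insert haJ, sup_comm (y a)]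
    ring

theorem dlt_add {L : Type*} [Lattice L] (l : List L) : ∀ (f g : L → ℝ) (x : L),
    dlt l (fun x => f x + g x) x = dlt l f x + dlt l g x := by
  induction l with
  | nil => intro f g x; rfl
  | cons a l ih =>
    intro f g x
    simp only [dlt]
    rw [← ih]
    congr 1
    funext z
    ring

theorem dlt_shift {L : Type*} [Lattice L] (a : L) (l : List L) : ∀ (f : L → ℝ) (x : L),
    dlt l (fun x => f (x ⊔ a)) x = dlt l f (x ⊔ a) := by
  induction l with
  | nil => intro f x; rfl
  | cons b l ih =>
    intro f x
    simp only [dlt]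
    rw [← ih]
    congr 1
    funext z
    rw [sup_right_comm]

theorem dlt_const {L : Type*} [Lattice L] (c : ℝ) (hc : 0 ≤ c) (l : List L) (x : L) :
    0 ≤ dlt l (fun _ => c) x := by
  induction l generalizing c with
  | nil => exact hc
  | cons b l ih => simpa only [dlt, sub_self] using ih 0 le_rfl

theorem dlt_mul {L : Type*} [Lattice L] (l : List L) : ∀ (f g : L → ℝ),
    (∀ l x, 0 ≤ dlt l f x) → (∀ l x, 0 ≤ dlt l g x) →
    ∀ x, 0 ≤ dlt l (fun x => f x * g x) x := by
  induction l with
  | nil => intro f g hf hg x; exact mul_nonneg (hf [] x) (hg [] x)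
  | cons a l ih =>
    intro f g hf hg x
    have e : (fun x => f x * g x - f (x ⊔ a) * g (x ⊔ a)) =
        fun x => (fun x => (f x - f (x ⊔ a)) * g x) x +
          (fun x => f (x ⊔ a) * (g x - g (x ⊔ a))) x := by
      funext z; ring
    simp only [dlt]
    rw [e, dlt_add]
    refine add_nonneg (ih _ _ (fun l x => hf (a :: l) x) hg x)
      (ih _ _ (fun l x => ?_) (fun l x => hg (a :: l) x) x)
    rw [dlt_shift]
    exact hf _ _

theorem dlt_hasSum {L : Type*} [Lattice L] (l : List L) : ∀ (F : ℕ → L → ℝ) (f : L → ℝ),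
    (∀ x, HasSum (fun n => F n x) (f x)) → ∀ x, HasSum (fun n => dlt l (F n) x) (dlt l f x) := by
  induction l with
  | nil => intro F f h; exact h
  | cons a l ih =>
    intro F f h
    exact ih (fun n x => F n x - F n (x ⊔ a)) _ fun x => (h x).sub (h (x ⊔ a))

theorem isCM_iff {L : Type*} [Lattice L] (f : L → ℝ) : IsCM f ↔ ∀ l x, 0 ≤ dlt l f x := by
  constructor
  · rintro ⟨h0, h⟩ l x
    cases l with
    | nil => exact h0 x
    | cons a l =>
      have := h l.length x (a :: l).get
      have e := dlt_eq (a :: l).get (List.finRange (l.length + 1)) (List.nodup_finRange _) f x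
      have e2 : (List.finRange (l.length + 1)).map (a :: l).get = a :: l :=
        List.map_get_finRange (a :: l)
      rw [e2, List.toFinset_finRange, Finset.powerset_univ] at e
      rw [e]
      exact this
  · intro h
    refine ⟨h [], fun k x y => ?_⟩
    have e := dlt_eq y (List.finRange (k + 1)) (List.nodup_finRange _) f x
    rw [List.toFinset_finRange, Finset.powerset_univ] at e
    rw [← e]
    exact h _ _

/-- If `h` is completely monotone on a lattice `L` and `C ≥ 0`, then
`x ↦ exp(−C(1 − h x))` is completely monotone on `L`. -/
theorem stmt15 {L : Type*} [Lattice L] (h : L → ℝ) (hh : IsCM h) (C : ℝ) (hC : 0 ≤ C) :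
    IsCM (fun x => Real.exp (-(C * (1 - h x)))) := by
  rw [isCM_iff] at hh ⊢
  have hpow : ∀ n : ℕ, ∀ l x, 0 ≤ dlt l (fun x => (C * h x) ^ n) x := by
    intro n
    induction n with
    | zero => simpa only [pow_zero] using fun l x => dlt_const 1 zero_le_one l x
    | succ n ih =>
      intro l x
      simp only [pow_succ]
      exact dlt_mul l _ _ ih
        (fun l x => dlt_mul l _ _ (fun l x => dlt_const C hC l x) hh x) x
  intro l x
  have hs := dlt_hasSum l
    (fun n x => (Real.exp (-C) * ((n.factorial : ℝ))⁻¹) * (C * h x) ^ n)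
    (fun x => Real.exp (-(C * (1 - h x)))) (fun x => by
      have h1 := (NormedSpace.expSeries_div_hasSum_exp (C * h x)).mul_left (Real.exp (-C))
      rw [← Real.exp_eq_exp_ℝ, ← Real.exp_add] at h1
      convert h1 using 1
      · rfl
      · funext n
        ring
      · congr 1
        ring) x
  refine hs.nonneg fun n => ?_
  exact dlt_mul l _ _ (fun l x => dlt_const _ (by positivity) l x) (hpow n) x
end

section
/- For every integer m ≥ 1 and every t ∈ [0,1], one has 0 ≤ e^{m(t−1)} − t^m ≤ 1/m. -/
/-- For every integer `m ≥ 1` and every `t ∈ [0,1]`, `0 ≤ e^{m(t−1)} − t^m ≤ 1/m`. -/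
theorem stmt16 (m : ℕ) (hm : 1 ≤ m) (t : ℝ) (ht0 : 0 ≤ t) (ht1 : t ≤ 1) :
    0 ≤ Real.exp ((m : ℝ) * (t - 1)) - t ^ m ∧
      Real.exp ((m : ℝ) * (t - 1)) - t ^ m ≤ 1 / m := by
  have hm0 : (0 : ℝ) < m := by exact_mod_cast hm
  constructor
  · rw [Real.exp_nat_mul]
    have h : t ≤ Real.exp (t - 1) := by linarith [Real.add_one_le_exp (t - 1)]
    exact sub_nonneg.2 (pow_le_pow_left₀ ht0 h m)
  · obtain ⟨s, rfl⟩ : ∃ s, t = 1 - s := ⟨1 - t, by ring⟩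
    have hs0 : 0 ≤ s := by linarith
    have hs1 : s ≤ 1 := by linarith
    have hx0 : 0 ≤ (m : ℝ) * s := by positivity
    have h1 : 1 + (m : ℝ) * (-s ^ 2) ≤ (1 + -s ^ 2) ^ m :=
      one_add_mul_le_pow (by nlinarith) m
    have h2 : (1 + -s ^ 2) ^ m ≤ ((1 - s) * Real.exp s) ^ m := by
      apply pow_le_pow_left₀ (by nlinarith)
      nlinarith [Real.add_one_le_exp s]
    rw [mul_pow, ← Real.exp_nat_mul] at h2
    have h3 : ((m : ℝ) * s) ^ 2 ≤ Real.exp (m * s) := by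
      have h := Real.quadratic_le_exp_of_nonneg (x := m * s / 2) (by positivity)
      have h' : (m : ℝ) * s ≤ Real.exp (m * s / 2) := by
        nlinarith [sq_nonneg ((m : ℝ) * s - 2)]
      have h4 : Real.exp (m * s) = Real.exp (m * s / 2) ^ 2 := by
        rw [← Real.exp_nat_mul]; congr 1; push_cast; ring
      rw [h4]
      exact pow_le_pow_left₀ hx0 h' 2
    have e1 : (m : ℝ) * (1 - s - 1) = -(m * s) := by ring
    rw [e1, Real.exp_neg]
    have hE := Real.exp_pos ((m : ℝ) * s)
    set E := Real.exp ((m : ℝ) * s)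
    have h5 : 1 - (1 - s) ^ m * E ≤ E / m := by
      rw [le_div_iff₀ hm0]
      nlinarith
    have h6 : E⁻¹ - (1 - s) ^ m = (1 - (1 - s) ^ m * E) / E := by field_simp
    rw [h6, div_le_iff₀ hE]
    calc _ ≤ E / m := h5
      _ = _ := by ring
end

section
/- Let b, c, d be real numbers with 0 < b ≤ 1, 0 < c ≤ 1, 0 < d ≤ 1. If 1 − b^α − c^α + d^α ≥ 0 for every real α > 0, then d ≥ b·c. -/
/-- If `b, c, d ∈ (0,1]` and `1 − b^α − c^α + d^α ≥ 0` for every real `α > 0`, then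
`d ≥ b·c`. (Powers are real powers.) -/
theorem stmt17 (b c d : ℝ) (hb0 : 0 < b) (hb1 : b ≤ 1) (hc0 : 0 < c) (hc1 : c ≤ 1)
    (hd0 : 0 < d) (hd1 : d ≤ 1)
    (h : ∀ α : ℝ, 0 < α → 0 ≤ 1 - b ^ α - c ^ α + d ^ α) :
    b * c ≤ d := by
  have key : ∀ x : ℝ, 0 < x → HasDerivAt (fun α : ℝ => x ^ α) (Real.log x) 0 := by
    intro x hx
    simpa using (Real.hasStrictDerivAt_const_rpow hx 0).hasDerivAt
  have hf : HasDerivAt (fun α : ℝ => 1 - b ^ α - c ^ α + d ^ α)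
      (0 - Real.log b - Real.log c + Real.log d) 0 :=
    (((hasDerivAt_const (0 : ℝ) (1 : ℝ)).sub (key b hb0)).sub (key c hc0)).add (key d hd0)
  have h0 : 0 ≤ 0 - Real.log b - Real.log c + Real.log d := by
    refine ge_of_tendsto hf.tendsto_slope_zero_right ?_
    filter_upwards [self_mem_nhdsWithin] with t ht
    have ht' : 0 < t := ht
    have h1 := h t ht'
    simp only [zero_add, Real.rpow_zero, smul_eq_mul]
    apply mul_nonneg (inv_nonneg.mpr ht'.le)
    linarith
  rw [← Real.log_le_log_iff (mul_pos hb0 hc0) hd0, Real.log_mul hb0.ne' hc0.ne']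
  linarith
end

section
/- Let L be a lattice, m ≥ 1 an integer, and let f, h : L → ℝ be completely monotone functions with f(x) = h(x)^m and 0 ≤ f(x) ≤ 1 for all x ∈ L. Define g(x) := exp(−m(1 − h(x))). Then: (i) for every integer k ≥ 1 the pointwise power g^{1/k} is completely monotone (so g is an infinitely divisible completely monotone function); and (ii) |f(x) − g(x)| ≤ 1/m for every x ∈ L. -/
namespace CMaux

variable {L : Type*} [Lattice L]

/-- One discrete difference. -/
def dl (y : L) (f : L → ℝ) : L → ℝ := fun x => f x - f (x ⊔ y)

/-- Iterated difference along a list. -/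
def D : List L → (L → ℝ) → L → ℝ
  | [], f => f
  | y :: l, f => D l (dl y f)

/-- List form of complete monotonicity. -/
def CM (f : L → ℝ) : Prop := ∀ l x, 0 ≤ D l f x

/-- The alternating sum over subsets of a finset. -/
noncomputable def S {ι : Type*} (s : Finset ι) (y : ι → L) (f : L → ℝ) (x : L) : ℝ :=
  ∑ J ∈ s.powerset, (-1 : ℝ) ^ J.card * f (J.fold (· ⊔ ·) x y)

lemma fold_sup {ι : Type*} (J : Finset ι) (y : ι → L) (x a : L) :
    J.fold (fun a b : L => a ⊔ b) (x ⊔ a) y = J.fold (fun a b : L => a ⊔ b) x y ⊔ a := by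
  classical
  induction J using Finset.induction_on with
  | empty => simp
  | insert b s hb ih => rw [Finset.fold_insert hb, Finset.fold_insert hb, ih, sup_assoc]

lemma S_insert {ι : Type*} [DecidableEq ι] (s : Finset ι) (a : ι) (ha : a ∉ s) (y : ι → L)
    (f : L → ℝ) (x : L) : S (insert a s) y f x = S s y (dl (y a) f) x := by
  unfold S
  rw [Finset.sum_powerset_insert ha, ← Finset.sum_add_distrib]
  refine Finset.sum_congr rfl fun J hJ => ?_
  have haJ : a ∉ J := fun h => ha (Finset.mem_powerset.1 hJ h)
  rw [Finset.card_insert_of_notMem haJ, Finset.fold_insert haJ, dl, sup_comm (y a), pow_succ]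
  ring

lemma S_map {ι κ : Type*} (e : ι ↪ κ) (s : Finset ι) (y : κ → L) (f : L → ℝ) (x : L) :
    S (s.map e) y f x = S s (y ∘ e) f x := by
  classical
  induction s using Finset.induction_on generalizing f with
  | empty => simp [S]
  | insert b s hb ih =>
    rw [Finset.map_insert, S_insert _ _ (by simpa using hb), S_insert _ _ hb, ih]
    rfl

lemma D_eq_S (l : List L) (f : L → ℝ) (x : L) :
    D l f x = S (Finset.univ : Finset (Fin l.length)) l.get f x := by
  classical
  induction l generalizing f with
  | nil => simp [D, S]
  | cons a l ih =>
    have : (Finset.univ : Finset (Fin (a :: l).length)) =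
        insert 0 ((Finset.univ : Finset (Fin l.length)).map (Fin.succEmb l.length)) := by
      ext i
      refine Fin.cases ?_ (fun j => ?_) i <;> simp
    rw [this, S_insert _ _ (by simp), S_map, D, ih]
    rfl

lemma S_nonneg {ι : Type*} (s : Finset ι) (y : ι → L) (f : L → ℝ) (hf : CM f) (x : L) :
    0 ≤ S s y f x := by
  classical
  induction s using Finset.induction_on generalizing f with
  | empty => simpa [S, D] using hf [] x
  | insert b s hb ih =>
    rw [S_insert _ _ hb]
    exact ih _ fun l x => hf (y b :: l) x

lemma isCM_iff (f : L → ℝ) : IsCM f ↔ CM f := by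
  constructor
  · rintro ⟨h0, h1⟩ l x
    cases l with
    | nil => exact h0 x
    | cons a l =>
      rw [D_eq_S]
      simpa [S] using h1 l.length x (a :: l).get
  · intro h
    refine ⟨fun x => h [] x, fun k x y => ?_⟩
    simpa [S] using S_nonneg Finset.univ y f h x

lemma D_add (l : List L) (f g : L → ℝ) (x : L) :
    D l (fun x => f x + g x) x = D l f x + D l g x := by
  induction l generalizing f g with
  | nil => rfl
  | cons a l ih =>
    rw [D, D, D, ← ih]
    congr 1
    funext z
    simp only [dl]
    ring

lemma D_shift (l : List L) (f : L → ℝ) (y x : L) :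
    D l (fun x => f (x ⊔ y)) x = D l f (x ⊔ y) := by
  induction l generalizing f with
  | nil => rfl
  | cons a l ih =>
    rw [D, D, ← ih]
    congr 1
    funext z
    simp only [dl]
    rw [sup_right_comm]

lemma D_mul (l : List L) (f g : L → ℝ) (hf : CM f) (hg : CM g) (x : L) :
    0 ≤ D l (fun x => f x * g x) x := by
  induction l generalizing f g with
  | nil => exact mul_nonneg (hf [] x) (hg [] x)
  | cons a l ih =>
    have e : dl a (fun x => f x * g x) =
        fun x => dl a f x * g x + (fun x => f (x ⊔ a)) x * dl a g x := by
      funext z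
      simp only [dl]
      ring
    rw [D, e, D_add]
    refine add_nonneg (ih _ _ (fun l x => hf (a :: l) x) hg)
      (ih (fun x => f (x ⊔ a)) _ (fun l x => ?_) (fun l x => hg (a :: l) x))
    rw [D_shift]
    exact hf _ _

lemma CM_const (c : ℝ) (hc : 0 ≤ c) : CM (fun _ : L => c) := by
  intro l x
  induction l generalizing c with
  | nil => exact hc
  | cons a l ih =>
    have : dl a (fun _ : L => c) = fun _ => (0 : ℝ) := by
      funext z
      simp [dl]
    rw [D, this]
    exact ih 0 le_rfl

lemma CM_pow (f : L → ℝ) (hf : CM f) (n : ℕ) : CM (fun x => f x ^ n) := by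
  induction n with
  | zero => simpa using CM_const (L := L) 1 zero_le_one
  | succ n ih =>
    simp only [pow_succ]
    exact fun l x => D_mul l _ _ ih hf x

lemma D_hasSum (l : List L) (F : ℕ → L → ℝ) (G : L → ℝ)
    (h : ∀ x, HasSum (fun n => F n x) (G x)) (x : L) :
    HasSum (fun n => D l (F n) x) (D l G x) := by
  induction l generalizing F G with
  | nil => exact h x
  | cons a l ih => exact ih _ _ fun z => (h z).sub (h (z ⊔ a))

lemma CM_exp (f : L → ℝ) (hf : CM f) : CM (fun x => Real.exp (f x)) := by
  intro l x
  have hs : ∀ x, HasSum (fun n : ℕ => (1 / (n.factorial : ℝ)) * f x ^ n) (Real.exp (f x)) := by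
    intro x
    have := NormedSpace.expSeries_div_hasSum_exp (f x)
    rw [← Real.exp_eq_exp_ℝ] at this
    simpa [div_eq_inv_mul] using this
  refine (D_hasSum l (fun n x => (1 / (n.factorial : ℝ)) * f x ^ n) _ hs x).nonneg fun n => ?_
  exact D_mul l _ _ (CM_const _ (by positivity)) (CM_pow f hf n) x

lemma bound (m : ℕ) (hm : 1 ≤ m) (a : ℝ) (h0 : 0 ≤ a) (h1 : a ≤ 1) :
    |a ^ m - Real.exp (-((m : ℝ) * (1 - a)))| ≤ 1 / m := by
  obtain ⟨t, rfl⟩ : ∃ t, a = 1 - t := ⟨1 - a, by ring⟩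
  have ht0 : 0 ≤ t := by linarith
  have ht1 : t ≤ 1 := by linarith
  have hm' : (0 : ℝ) < m := by exact_mod_cast hm
  have e : Real.exp (-((m : ℝ) * (1 - (1 - t)))) = Real.exp (-t) ^ m := by
    rw [← Real.exp_nat_mul]
    congr 1
    ring
  rw [e]
  have hup : (1 - t) ^ m ≤ Real.exp (-t) ^ m :=
    pow_le_pow_left₀ h0 (by linarith [Real.add_one_le_exp (-t)]) m
  have hE : Real.exp (-t) * Real.exp t = 1 := by rw [← Real.exp_add]; simp
  have hlo1 : Real.exp (-t) * (1 - t ^ 2) ≤ 1 - t := by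
    have : Real.exp (-t) * (1 + t) ≤ 1 := by
      rw [← hE]
      exact mul_le_mul_of_nonneg_left (by linarith [Real.add_one_le_exp t]) (Real.exp_pos _).le
    nlinarith
  have ht2 : t ^ 2 ≤ 1 := by nlinarith
  have hlo : Real.exp (-t) ^ m * (1 - t ^ 2) ^ m ≤ (1 - t) ^ m := by
    rw [← mul_pow]
    exact pow_le_pow_left₀ (mul_nonneg (Real.exp_pos _).le (by linarith)) hlo1 m
  have hB : 1 - m * t ^ 2 ≤ (1 - t ^ 2) ^ m := by
    have := one_add_mul_le_pow (a := -t ^ 2) (by linarith) m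
    calc 1 - m * t ^ 2 = 1 + m * (-t ^ 2) := by ring
      _ ≤ _ := this
      _ = _ := by ring
  have hp : 0 < Real.exp (-t) ^ m := by positivity
  have hdiff : Real.exp (-t) ^ m - (1 - t) ^ m ≤ Real.exp (-t) ^ m * (m * t ^ 2) := by
    nlinarith [mul_le_mul_of_nonneg_left hB hp.le]
  have hs : ((m : ℝ) * t) ^ 2 ≤ Real.exp t ^ m := by
    have h2 : (m : ℝ) * t ≤ Real.exp (m * t / 2) := by
      have h3 := Real.add_one_le_exp ((m : ℝ) * t / 2 - 1)
      have h4 := Real.add_one_le_exp (1 : ℝ)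
      have h5 : Real.exp (m * t / 2) = Real.exp (m * t / 2 - 1) * Real.exp 1 := by
        rw [← Real.exp_add]; congr 1; ring
      have h6 : 0 ≤ (m : ℝ) * t := by positivity
      rw [h5]
      nlinarith [Real.exp_pos ((m : ℝ) * t / 2 - 1)]
    calc ((m : ℝ) * t) ^ 2 ≤ Real.exp (m * t / 2) ^ 2 := pow_le_pow_left₀ (by positivity) h2 2
      _ = Real.exp t ^ m := by
        rw [← Real.exp_nat_mul, ← Real.exp_nat_mul]; congr 1; push_cast; ring
  have hfin : Real.exp (-t) ^ m * (m * t ^ 2) ≤ 1 / m := by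
    rw [le_div_iff₀ hm']
    calc Real.exp (-t) ^ m * (m * t ^ 2) * m = Real.exp (-t) ^ m * ((m : ℝ) * t) ^ 2 := by ring
      _ ≤ Real.exp (-t) ^ m * Real.exp t ^ m := mul_le_mul_of_nonneg_left hs hp.le
      _ = 1 := by rw [← mul_pow, hE, one_pow]
  rw [abs_le]
  constructor
  · linarith
  · have : (0 : ℝ) ≤ 1 / m := by positivity
    linarith

end CMaux

/-- Let `f = h^m` with `f, h` completely monotone on a lattice `L` and `0 ≤ f ≤ 1`.
Then `g x := exp(−m(1 − h x))` is infinitely divisible (every root `g^{1/k}` is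
completely monotone), and `|f x − g x| ≤ 1/m` for all `x`. -/
theorem stmt18 {L : Type*} [Lattice L] (m : ℕ) (hm : 1 ≤ m) (f h : L → ℝ)
    (hf : IsCM f) (hh : IsCM h) (hfh : ∀ x, f x = h x ^ m)
    (hf01 : ∀ x, 0 ≤ f x ∧ f x ≤ 1) :
    (∀ k : ℕ, 1 ≤ k →
      IsCM (fun x => Real.exp (-((m : ℝ) * (1 - h x))) ^ (1 / (k : ℝ)))) ∧
    (∀ x, |f x - Real.exp (-((m : ℝ) * (1 - h x)))| ≤ 1 / m) := by
  refine ⟨fun k hk => ?_, fun x => ?_⟩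
  · rw [CMaux.isCM_iff] at hh ⊢
    have e : (fun x => Real.exp (-((m : ℝ) * (1 - h x))) ^ (1 / (k : ℝ))) =
        fun x => Real.exp (-((m : ℝ) / k)) * Real.exp ((m : ℝ) / k * h x) := by
      funext x
      rw [← Real.exp_mul, ← Real.exp_add]
      congr 1
      ring
    rw [e]
    have hu : CMaux.CM (fun x => (m : ℝ) / k * h x) := fun l x =>
      CMaux.D_mul l _ _ (CMaux.CM_const _ (by positivity)) hh x
    exact fun l x => CMaux.D_mul l _ _ (CMaux.CM_const _ (Real.exp_pos _).le)
      (CMaux.CM_exp _ hu) x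
  · rw [hfh]
    refine CMaux.bound m hm _ (hh.1 x) ?_
    have := (hf01 x).2
    rw [hfh] at this
    exact (pow_le_one_iff_of_nonneg (hh.1 x) (by omega)).1 this
end
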